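/- Let α ∈ (0,1) and let the temporal mesh be quasi-graded with parameter r ≥ 1 and constants c_0 ≤ C_0, and satisfy the Alikhanov mesh condition. Let u ∈ C([0,T]) ∩ C^3((0,T]) satisfy, for some constant C_u > 0, |u′(t)| ≤ C_u(1 + t^{α−1}) and |u‴(t)| ≤ C_u(1 + t^{α−3}) for all t ∈ (0,T]. Let the discrete solution U^0,...,U^M be defined by U^0 = u(0) and δ_t^{α,*} U^m = D_t^α u(t_m^*) for m = 1,...,M (the Alikhanov discretization of the initial-value problem D_t^α u = f with f(t_m^*) := D_t^α u(t_m^*)). Then there exists a constant C > 0, depending only on α, r, T, c_0, C_0, C_u, such that |u(t_m) − U^m| ≤ C ℰ^{m,*} for all m = 1,...,M. -/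

import Mathlib

open Real MeasureTheory Set

/-- The L1 discrete fractional-derivative operator associated with the mesh `t`,
applied to the sequence `V`, at time level `m`. -/
noncomputable def deltaL1 (α : ℝ) (t : ℕ → ℝ) (V : ℕ → ℝ) (m : ℕ) : ℝ :=
  (1 / Real.Gamma (1 - α)) *
    ∑ j ∈ Finset.Icc 1 m,
      ((V j - V (j - 1)) / (t j - t (j - 1))) *
        ∫ s in (t (j - 1))..(t j), (t m - s) ^ (-α)

/-- `t 0 = 0 < t 1 < ... < t M = T` with `M ≥ 2`. -/
def IsMesh (T : ℝ) (M : ℕ) (t : ℕ → ℝ) : Prop :=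
  2 ≤ M ∧ t 0 = 0 ∧ (∀ j, j < M → t j < t (j + 1)) ∧ t M = T

/-- Quasi-graded mesh with parameter `r` and constants `c0 ≤ C0`. -/
def QuasiGraded (r c0 C0 : ℝ) (M : ℕ) (t : ℕ → ℝ) : Prop :=
  (c0 * (M : ℝ) ^ (-r) ≤ t 1 ∧ t 1 ≤ C0 * (M : ℝ) ^ (-r)) ∧
  (∀ j : ℕ, 1 ≤ j → j ≤ M →
    c0 * (t 1 * (j : ℝ) ^ r) ≤ t j ∧ t j ≤ C0 * (t 1 * (j : ℝ) ^ r)) ∧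
  (∀ j : ℕ, 1 ≤ j → j ≤ M →
    c0 * ((t 1) ^ (1 / r) * (t j) ^ (1 - 1 / r)) ≤ t j - t (j - 1) ∧
    t j - t (j - 1) ≤ C0 * ((t 1) ^ (1 / r) * (t j) ^ (1 - 1 / r)))

/-- The stability majorant `𝒱^j`. -/
noncomputable def Vcal (α γ τ tj : ℝ) : ℝ :=
  if 0 < γ then τ * tj ^ (α - 1)
  else if γ = 0 then τ * tj ^ (α - 1) * (1 + Real.log (tj / τ))
  else τ * tj ^ (α - 1) * (τ / tj) ^ γ

/-- The Caputo fractional derivative of order `α`. -/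
noncomputable def caputo (α : ℝ) (u : ℝ → ℝ) (t : ℝ) : ℝ :=
  (1 / Real.Gamma (1 - α)) * ∫ s in (0:ℝ)..t, (t - s) ^ (-α) * deriv u s

/-- Linear Lagrange interpolant with data `(a, ya)`, `(b, yb)`. -/
noncomputable def lagLin (a b ya yb s : ℝ) : ℝ := ya + (yb - ya) / (b - a) * (s - a)

/-- Quadratic Lagrange interpolant with data `(x0, y0)`, `(x1, y1)`, `(x2, y2)`. -/
noncomputable def lagQuad (x0 x1 x2 y0 y1 y2 s : ℝ) : ℝ :=
  y0 * ((s - x1) * (s - x2)) / ((x0 - x1) * (x0 - x2)) +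
  y1 * ((s - x0) * (s - x2)) / ((x1 - x0) * (x1 - x2)) +
  y2 * ((s - x0) * (s - x1)) / ((x2 - x0) * (x2 - x1))

/-- The Alikhanov collocation point `t_m^* = t_m - (α/2) τ_m`. -/
noncomputable def tStar (α : ℝ) (t : ℕ → ℝ) (m : ℕ) : ℝ :=
  t m - (α / 2) * (t m - t (m - 1))

/-- The Alikhanov discrete fractional-derivative operator `δ_t^{α,*}`:
`(1/Γ(1-α)) ∫_0^{t_m^*} (t_m^* - s)^{-α} (Π^m U)'(s) ds`, where `Π^m U` is the
quadratic Lagrange interpolant of `(t_{j-1},U^{j-1}), (t_j,U^j), (t_{j+1},U^{j+1})`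
on `(t_{j-1},t_j)` for `j < m`, and the linear interpolant of
`(t_{m-1},U^{m-1}), (t_m,U^m)` on `(t_{m-1}, t_m^*)`. -/
noncomputable def deltaAlik (α : ℝ) (t : ℕ → ℝ) (U : ℕ → ℝ) (m : ℕ) : ℝ :=
  (1 / Real.Gamma (1 - α)) *
    ((∑ j ∈ Finset.Icc 1 (m - 1),
        ∫ s in (t (j - 1))..(t j),
          (tStar α t m - s) ^ (-α) *
            deriv (fun x =>
              lagQuad (t (j - 1)) (t j) (t (j + 1)) (U (j - 1)) (U j) (U (j + 1)) x) s) +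
      ∫ s in (t (m - 1))..(tStar α t m),
        (tStar α t m - s) ^ (-α) * ((U m - U (m - 1)) / (t m - t (m - 1))))

/-- The Alikhanov mesh condition ensuring the discrete maximum principle:
with `ρ_j = τ_{j+1}/τ_j`, either `0.4656 ≤ ρ_j ≤ ρ_{j-1}` for all `2 ≤ j ≤ M-1`,
or `ρ_j ≥ 4/7` for all `2 ≤ j ≤ M-1`. -/
def AlikhanovCond (M : ℕ) (t : ℕ → ℝ) : Prop :=
  (∀ j : ℕ, 2 ≤ j → j ≤ M - 1 →
      (0.4656 : ℝ) ≤ (t (j + 1) - t j) / (t j - t (j - 1)) ∧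
      (t (j + 1) - t j) / (t j - t (j - 1)) ≤
        (t j - t (j - 1)) / (t (j - 1) - t (j - 2))) ∨
  (∀ j : ℕ, 2 ≤ j → j ≤ M - 1 →
      (4 / 7 : ℝ) ≤ (t (j + 1) - t j) / (t j - t (j - 1)))

/-- The pointwise-in-time error majorant `ℰ^{m,*}` of (4.6). -/
noncomputable def EcalAlik (α r : ℝ) (M : ℕ) (τ tm : ℝ) : ℝ :=
  if r < 3 - α then (M : ℝ) ^ (-r) * tm ^ (α - 1)
  else if r = 3 - α then (M : ℝ) ^ (α - 3) * tm ^ (α - 1) * (1 + Real.log (tm / τ))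
  else (M : ℝ) ^ (α - 3) * tm ^ (α - (3 - α) / r)

/-! ### The weakly singular kernel -/

section Kernel

variable {α x a b : ℝ}

theorem kernel_hasDerivAt {s : ℝ} (hs : s < x) :
    HasDerivAt (fun s => (x - s) ^ (-α)) (α * (x - s) ^ (-α - 1)) s := by
  have h1 : HasDerivAt (fun s => x - s) (-1) s := by
    simpa using (hasDerivAt_id s).const_sub x
  have h2 := h1.rpow_const (p := -α) (Or.inl (by linarith : x - s ≠ 0))
  convert h2 using 1
  ring

theorem kernel_continuousOn (hb : b < x) :
    ContinuousOn (fun s => (x - s) ^ (-α)) (Icc a b) := fun _ hs =>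
  (kernel_hasDerivAt (lt_of_le_of_lt hs.2 hb)).continuousAt.continuousWithinAt

theorem kernel_intervalIntegrable (hab : a ≤ b) (hb : b < x) :
    IntervalIntegrable (fun s => (x - s) ^ (-α)) volume a b :=
  (kernel_continuousOn hb).intervalIntegrable_of_Icc hab

theorem kernel_intervalIntegrable_sing (hα1 : α < 1) :
    IntervalIntegrable (fun s => (x - s) ^ (-α)) volume a x := by
  have h := (intervalIntegral.intervalIntegrable_rpow' (a := x - a) (b := 0) (r := -α)
    (by linarith)).comp_sub_left x
  simpa using h

theorem kernel_integral (hα1 : α < 1) :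
    ∫ s in a..x, (x - s) ^ (-α) = (x - a) ^ (1 - α) / (1 - α) := by
  rw [intervalIntegral.integral_comp_sub_left (fun y => y ^ (-α)) x, sub_self,
    integral_rpow (Or.inl (by linarith)), zero_rpow (by linarith), sub_zero]
  ring_nf

theorem kernel_deriv_mono (hα0 : 0 < α) {s y : ℝ} (hsy : s ≤ y) (hy : y < x) :
    α * (x - s) ^ (-α - 1) ≤ α * (x - y) ^ (-α - 1) :=
  mul_le_mul_of_nonneg_left
    (rpow_le_rpow_of_nonpos (by linarith) (by linarith) (by linarith)) hα0.le

theorem kernel_mono (hα0 : 0 < α) {s y : ℝ} (hsy : s ≤ y) (hy : y < x) :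
    (x - s) ^ (-α) ≤ (x - y) ^ (-α) :=
  rpow_le_rpow_of_nonpos (by linarith) (by linarith) (by linarith)

theorem kernel_slope (hα0 : 0 < α) {s y : ℝ} (hsy : s ≤ y) (hy : y < x) :
    α * (x - s) ^ (-α - 1) * (y - s) ≤ (x - y) ^ (-α) - (x - s) ^ (-α) ∧
    (x - y) ^ (-α) - (x - s) ^ (-α) ≤ α * (x - y) ^ (-α - 1) * (y - s) := by
  rcases hsy.eq_or_lt with rfl | hlt
  · simp
  obtain ⟨ξ, hξ, he⟩ := exists_hasDerivAt_eq_slope (fun s => (x - s) ^ (-α))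
    (fun s => α * (x - s) ^ (-α - 1)) hlt (kernel_continuousOn hy)
    (fun z hz => kernel_hasDerivAt (hz.2.trans hy))
  have hpos : 0 < y - s := sub_pos.2 hlt
  have he' : α * (x - ξ) ^ (-α - 1) * (y - s) = (x - y) ^ (-α) - (x - s) ^ (-α) := by
    rw [he]; field_simp
  rw [← he']
  exact ⟨mul_le_mul_of_nonneg_right (kernel_deriv_mono hα0 hξ.1.le (hξ.2.trans hy)) hpos.le,
    mul_le_mul_of_nonneg_right (kernel_deriv_mono hα0 hξ.2.le hy) hpos.le⟩

theorem integral_quadratic (a b c A B : ℝ) :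
    ∫ s in a..b, (A * (s - c) + B * (s - c) ^ 2) =
      A * ((b - c) ^ 2 - (a - c) ^ 2) / 2 + B * ((b - c) ^ 3 - (a - c) ^ 3) / 3 := by
  have h : ∀ s ∈ uIcc a b, HasDerivAt
      (fun s => A * (s - c) ^ 2 / 2 + B * (s - c) ^ 3 / 3) (A * (s - c) + B * (s - c) ^ 2) s := by
    intro s _
    have h1 : HasDerivAt (fun s => s - c) 1 s := by simpa using (hasDerivAt_id s).sub_const c
    refine HasDerivAt.congr_deriv ((((h1.pow 2).const_mul A).div_const 2).add
      (((h1.pow 3).const_mul B).div_const 3)) ?_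
    norm_num
    ring
  rw [intervalIntegral.integral_eq_sub_of_hasDerivAt h
    (Continuous.intervalIntegrable (by fun_prop) _ _)]
  ring

/-- First moment of the kernel about the midpoint of the interval. -/
noncomputable def kernelMoment (α x a b : ℝ) : ℝ :=
  ∫ s in a..b, (s - (a + b) / 2) * (x - s) ^ (-α)

theorem kernel_moment_integrable (c : ℝ) (hab : a ≤ b) (hb : b < x) :
    IntervalIntegrable (fun s => (s - c) * (x - s) ^ (-α)) volume a b :=
  (ContinuousOn.mul (by fun_prop) (kernel_continuousOn hb)).intervalIntegrable_of_Icc hab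

theorem kernelMoment_ge (hα0 : 0 < α) (hab : a ≤ b) (hb : b < x) :
    α * (x - a) ^ (-α - 1) * (b - a) ^ 3 / 12 ≤ kernelMoment α x a b := by
  have h := integral_quadratic a b ((a + b) / 2) ((x - (a + b) / 2) ^ (-α))
    (α * (x - a) ^ (-α - 1))
  calc _ = ∫ s in a..b, ((x - (a + b) / 2) ^ (-α) * (s - (a + b) / 2) +
        α * (x - a) ^ (-α - 1) * (s - (a + b) / 2) ^ 2) := by rw [h]; ring
    _ ≤ _ := by
      refine intervalIntegral.integral_mono_on hab
        (Continuous.intervalIntegrable (by fun_prop) _ _) (kernel_moment_integrable _ hab hb) ?_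
      intro s hs
      rcases le_total s ((a + b) / 2) with hc | hc
      · have h1 := (kernel_slope hα0 hc (by linarith : (a + b) / 2 < x)).1
        have h2 := kernel_deriv_mono hα0 hs.1 (lt_of_le_of_lt hs.2 hb)
        have h3 : 0 ≤ (a + b) / 2 - s := by linarith
        nlinarith [mul_le_mul_of_nonneg_right h2 h3, mul_le_mul_of_nonneg_right
          (le_trans (mul_le_mul_of_nonneg_right h2 h3) h1) h3]
      · have h1 := (kernel_slope hα0 hc (lt_of_le_of_lt hs.2 hb)).1
        have h2 := kernel_deriv_mono (s := a) (y := (a + b) / 2) hα0 (by linarith)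
          (by linarith : (a + b) / 2 < x)
        have h3 : 0 ≤ s - (a + b) / 2 := by linarith
        nlinarith [mul_le_mul_of_nonneg_right
          (le_trans (mul_le_mul_of_nonneg_right h2 h3) h1) h3]

theorem kernelMoment_le (hα0 : 0 < α) (hab : a ≤ b) (hb : b < x) :
    kernelMoment α x a b ≤ α * (x - b) ^ (-α - 1) * (b - a) ^ 3 / 12 := by
  have h := integral_quadratic a b ((a + b) / 2) ((x - (a + b) / 2) ^ (-α))
    (α * (x - b) ^ (-α - 1))
  calc _ ≤ ∫ s in a..b, ((x - (a + b) / 2) ^ (-α) * (s - (a + b) / 2) +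
        α * (x - b) ^ (-α - 1) * (s - (a + b) / 2) ^ 2) := by
        refine intervalIntegral.integral_mono_on hab (kernel_moment_integrable _ hab hb)
          (Continuous.intervalIntegrable (by fun_prop) _ _) ?_
        intro s hs
        rcases le_total s ((a + b) / 2) with hc | hc
        · have h1 := (kernel_slope hα0 hc (by linarith : (a + b) / 2 < x)).2
          have h2 := kernel_deriv_mono (s := (a + b) / 2) (y := b) hα0 (by linarith) hb
          have h3 : 0 ≤ (a + b) / 2 - s := by linarith
          nlinarith [mul_le_mul_of_nonneg_right
            (le_trans h1 (mul_le_mul_of_nonneg_right h2 h3)) h3]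
        · have h1 := (kernel_slope hα0 hc (lt_of_le_of_lt hs.2 hb)).2
          have h2 := kernel_deriv_mono hα0 hs.2 hb
          have h3 : 0 ≤ s - (a + b) / 2 := by linarith
          nlinarith [mul_le_mul_of_nonneg_right
            (le_trans h1 (mul_le_mul_of_nonneg_right h2 h3)) h3]
    _ = _ := by rw [h]; ring

theorem kernelMoment_nonneg (hα0 : 0 < α) (hab : a ≤ b) (hb : b < x) :
    0 ≤ kernelMoment α x a b := by
  refine le_trans ?_ (kernelMoment_ge hα0 hab hb)
  have := rpow_nonneg (by linarith : 0 ≤ x - a) (-α - 1)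
  have : 0 ≤ b - a := by linarith
  positivity

theorem kernel_integral_le (hα0 : 0 < α) (hab : a ≤ b) (hb : b < x) :
    ∫ s in a..b, (x - s) ^ (-α) ≤ (x - b) ^ (-α) * (b - a) := by
  calc _ ≤ ∫ _ in a..b, (x - b) ^ (-α) :=
        intervalIntegral.integral_mono_on hab (kernel_intervalIntegrable hab hb) (by simp)
          fun s hs => kernel_mono hα0 hs.2 hb
    _ = _ := by simp [mul_comm]

theorem kernel_integral_le_sub (hα0 : 0 < α) (hab : a ≤ b) (hb : b < x) :
    ∫ s in a..b, (x - s) ^ (-α) ≤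
      (x - b) ^ (-α) * (b - a) - α * (x - a) ^ (-α - 1) * (b - a) ^ 2 / 2 := by
  have h := integral_quadratic a b b (α * (x - a) ^ (-α - 1)) 0
  calc _ ≤ ∫ s in a..b, ((x - b) ^ (-α) +
        (α * (x - a) ^ (-α - 1) * (s - b) + 0 * (s - b) ^ 2)) := by
        refine intervalIntegral.integral_mono_on hab (kernel_intervalIntegrable hab hb)
          (Continuous.intervalIntegrable (by fun_prop) _ _) fun s hs => ?_
        have h1 := (kernel_slope hα0 hs.2 hb).1
        have h2 := kernel_deriv_mono hα0 hs.1 (lt_of_le_of_lt hs.2 hb)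
        nlinarith [mul_le_mul_of_nonneg_right h2 (by linarith [hs.2] : 0 ≤ b - s)]
    _ = _ := by
        rw [intervalIntegral.integral_add (by simp)
          (Continuous.intervalIntegrable (by fun_prop) _ _), h]
        simp
        ring

theorem kernel_integral_sub_moment_ge (hα0 : 0 < α) (hab : a < b) (hb : b < x) :
    (x - a) ^ (-α) * (b - a) ≤
      (∫ s in a..b, (x - s) ^ (-α)) - 2 / (b - a) * kernelMoment α x a b := by
  have h := integral_quadratic a b b (-(2 / (b - a) * (x - a) ^ (-α))) 0
  have hpos : 0 < b - a := sub_pos.2 hab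
  have e1 : (x - a) ^ (-α) * (b - a) = ∫ s in a..b,
      (-(2 / (b - a) * (x - a) ^ (-α)) * (s - b) + 0 * (s - b) ^ 2) := by
    rw [h]; field_simp; ring
  rw [e1, kernelMoment, ← intervalIntegral.integral_const_mul, ← intervalIntegral.integral_sub
    (kernel_intervalIntegrable hab.le hb) ((kernel_moment_integrable _ hab.le hb).const_mul _)]
  refine intervalIntegral.integral_mono_on hab.le (Continuous.intervalIntegrable (by fun_prop) _ _)
    ((kernel_intervalIntegrable hab.le hb).sub
      ((kernel_moment_integrable _ hab.le hb).const_mul _)) fun s hs => ?_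
  have h1 := kernel_mono hα0 hs.1 (lt_of_le_of_lt hs.2 hb)
  have h2 : 0 ≤ 2 / (b - a) * (b - s) := mul_nonneg (by positivity) (by linarith [hs.2])
  have h3 : (x - s) ^ (-α) - 2 / (b - a) * ((s - (a + b) / 2) * (x - s) ^ (-α)) =
      2 / (b - a) * (b - s) * (x - s) ^ (-α) := by
    field_simp; ring
  rw [h3]
  nlinarith [mul_le_mul_of_nonneg_left h1 h2]

theorem kernel_moment_le_integral (hα0 : 0 < α) (hab : a < b) (hb : b < x) :
    2 / (b - a) * kernelMoment α x a b ≤ ∫ s in a..b, (x - s) ^ (-α) := by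
  have h := kernel_integral_sub_moment_ge hα0 hab hb
  have : 0 ≤ (x - a) ^ (-α) * (b - a) :=
    mul_nonneg (rpow_nonneg (by linarith) _) (by linarith)
  linarith

/-- The Alikhanov point annihilates the first moment of the kernel on the last subinterval. -/
theorem kernel_moment_eq_zero (hα0 : 0 < α) (hα1 : α < 1) (hab : a < b)
    (hx : x = b - α / 2 * (b - a)) :
    ∫ s in a..x, (x - s) ^ (-α) * (s - (a + b) / 2) = 0 := by
  have hxa : 0 < x - a := by rw [hx]; nlinarith
  have hI : ∀ p : ℝ, -1 < p → IntervalIntegrable (fun y : ℝ => y ^ p) volume 0 (x - a) :=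
    fun p hp => intervalIntegral.intervalIntegrable_rpow' hp
  have e : ∀ s ∈ uIcc a x, (x - s) ^ (-α) * (s - (a + b) / 2) =
      (fun y => (1 - α) / 2 * (b - a) * y ^ (-α) - y ^ (1 - α)) (x - s) := by
    intro s hs
    rw [uIcc_of_le (by linarith)] at hs
    rcases hs.2.eq_or_lt with rfl | h
    · simp only [sub_self]
      rw [zero_rpow (by linarith), zero_rpow (by linarith)]; ring
    · have : (x - s) ^ (1 - α) = (x - s) ^ (-α) * (x - s) := by
        rw [← rpow_add_one (by linarith)]; ring_nf
      simp only [this]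
      rw [show s - (a + b) / 2 = (1 - α) / 2 * (b - a) - (x - s) by rw [hx]; ring]
      ring
  rw [intervalIntegral.integral_congr e, intervalIntegral.integral_comp_sub_left
    (fun y => (1 - α) / 2 * (b - a) * y ^ (-α) - y ^ (1 - α)) x, sub_self,
    intervalIntegral.integral_sub ((hI _ (by linarith)).const_mul _) (hI _ (by linarith)),
    intervalIntegral.integral_const_mul, integral_rpow (Or.inl (by linarith)),
    integral_rpow (Or.inl (by linarith)), zero_rpow (by linarith), zero_rpow (by linarith)]
  have : (x - a) ^ (1 - α + 1) = (x - a) ^ (-α + 1) * (x - a) := by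
    rw [← rpow_add_one hxa.ne']; ring_nf
  rw [this, show x - a = (1 - α + 1) / 2 * (b - a) by rw [hx]; ring]
  have h1 : -α + 1 ≠ 0 := by linarith
  have h2 : 1 - α + 1 ≠ 0 := by linarith
  field_simp
  ring

end Kernel

/-! ### The Alikhanov operator as a weighted sum of increments -/

theorem lagQuad_eq_newton {x0 x1 x2 : ℝ} (h01 : x0 < x1) (h12 : x1 < x2) (y0 y1 y2 s : ℝ) :
    lagQuad x0 x1 x2 y0 y1 y2 s = y0 + (y1 - y0) / (x1 - x0) * (s - x0) +
      ((y2 - y1) / (x2 - x1) - (y1 - y0) / (x1 - x0)) / (x2 - x0) * ((s - x0) * (s - x1)) := by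
  have h1 : x1 - x0 ≠ 0 := (sub_pos.2 h01).ne'
  have h2 : x2 - x1 ≠ 0 := (sub_pos.2 h12).ne'
  have h3 : x2 - x0 ≠ 0 := (sub_pos.2 (h01.trans h12)).ne'
  have h4 : x0 - x1 ≠ 0 := (sub_neg.2 h01).ne
  have h5 : x1 - x2 ≠ 0 := (sub_neg.2 h12).ne
  have h6 : x0 - x2 ≠ 0 := (sub_neg.2 (h01.trans h12)).ne
  unfold lagQuad
  rw [show x0 - x1 = -(x1 - x0) by ring, show x0 - x2 = -(x2 - x0) by ring,
    show x1 - x2 = -(x2 - x1) by ring]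
  field_simp
  ring

theorem lagQuad_hasDerivAt {x0 x1 x2 : ℝ} (h01 : x0 < x1) (h12 : x1 < x2) (y0 y1 y2 s : ℝ) :
    HasDerivAt (fun s => lagQuad x0 x1 x2 y0 y1 y2 s) ((y1 - y0) / (x1 - x0) +
      2 / (x2 - x0) * ((y2 - y1) / (x2 - x1) - (y1 - y0) / (x1 - x0)) *
        (s - (x0 + x1) / 2)) s := by
  rw [funext (lagQuad_eq_newton h01 h12 y0 y1 y2)]
  have h (c : ℝ) : HasDerivAt (fun s => s - c) 1 s := by
    simpa using (hasDerivAt_id s).sub_const c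
  refine HasDerivAt.congr_deriv ((((h x0).const_mul _).const_add y0).add
    (((h x0).mul (h x1)).const_mul _)) ?_
  ring

/-- Integral of the kernel over the `i`-th subinterval (the last one being cut at `t_{n+1}^*`). -/
noncomputable def kernelMass (α : ℝ) (t : ℕ → ℝ) (n i : ℕ) : ℝ :=
  if i < n then ∫ s in (t i)..(t (i + 1)), (tStar α t (n + 1) - s) ^ (-α)
  else ∫ s in (t n)..(tStar α t (n + 1)), (tStar α t (n + 1) - s) ^ (-α)

/-- Contribution of the second divided difference attached to the `i`-th subinterval. -/
noncomputable def kernelCorr (α : ℝ) (t : ℕ → ℝ) (n i : ℕ) : ℝ :=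
  if i < n then 2 / (t (i + 2) - t i) * kernelMoment α (tStar α t (n + 1)) (t i) (t (i + 1))
  else 0

/-- The correction inherited from the preceding subinterval. -/
noncomputable def kernelCorrPrev (α : ℝ) (t : ℕ → ℝ) (n : ℕ) : ℕ → ℝ
  | 0 => 0
  | i + 1 => kernelCorr α t n i

/-- Coefficient of the increment `U (i + 1) - U i` in the Alikhanov operator at level `n + 1`. -/
noncomputable def alikCoeff (α : ℝ) (t : ℕ → ℝ) (n i : ℕ) : ℝ :=
  (kernelMass α t n i - kernelCorr α t n i + kernelCorrPrev α t n i) / (t (i + 1) - t i)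

theorem sum_Icc_one_eq_sum_range (f : ℕ → ℝ) (n : ℕ) :
    ∑ j ∈ Finset.Icc 1 n, f j = ∑ i ∈ Finset.range n, f (i + 1) := by
  rw [Finset.range_eq_Ico, Finset.sum_Ico_add' f 0 n 1]
  rfl

theorem sum_increments_by_parts (a b p d : ℕ → ℝ) (hp0 : p 0 = 0) (hp : ∀ i, p (i + 1) = b i)
    (n : ℕ) :
    ∑ i ∈ Finset.range n, (d i * a i + b i * (d (i + 1) - d i)) =
      ∑ i ∈ Finset.range n, (a i - b i + p i) * d i + p n * d n := by
  induction n with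
  | zero => simp [hp0]
  | succ n ih => rw [Finset.sum_range_succ, ih, Finset.sum_range_succ, hp]; ring

section Operator

variable {α : ℝ} {t : ℕ → ℝ} {n : ℕ}

theorem mesh_lt (ht : ∀ i ≤ n, t i < t (i + 1)) : ∀ {i j : ℕ}, i < j → j ≤ n + 1 → t i < t j := by
  intro i j hij
  induction j, hij using Nat.le_induction with
  | base => intro h; exact ht i (by omega)
  | succ j hj ih => intro h; exact (ih (by omega)).trans (ht j (by omega))

theorem mesh_le (ht : ∀ i ≤ n, t i < t (i + 1)) {i j : ℕ} (hij : i ≤ j) (hj : j ≤ n + 1) :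
    t i ≤ t j := by
  rcases hij.eq_or_lt with rfl | h
  · rfl
  · exact (mesh_lt ht h hj).le

theorem tStar_gt (hα1 : α < 1) (hn : t n < t (n + 1)) : t n < tStar α t (n + 1) := by
  simp only [tStar, Nat.add_sub_cancel]; nlinarith

theorem tStar_lt (hα0 : 0 < α) (hn : t n < t (n + 1)) : tStar α t (n + 1) < t (n + 1) := by
  simp only [tStar, Nat.add_sub_cancel]; nlinarith

theorem tStar_sub (t : ℕ → ℝ) (n : ℕ) :
    tStar α t (n + 1) - t n = (1 - α / 2) * (t (n + 1) - t n) := by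
  simp only [tStar, Nat.add_sub_cancel]; ring

theorem deltaAlik_eq_sum (hα1 : α < 1) (ht : ∀ i ≤ n, t i < t (i + 1)) (U : ℕ → ℝ) :
    deltaAlik α t U (n + 1) = 1 / Real.Gamma (1 - α) *
      ∑ i ∈ Finset.range (n + 1), alikCoeff α t n i * (U (i + 1) - U i) := by
  set x := tStar α t (n + 1) with hx
  have hxn : t n < x := tStar_gt hα1 (ht n le_rfl)
  let d : ℕ → ℝ := fun i => (U (i + 1) - U i) / (t (i + 1) - t i)
  have hlast : ∫ s in (t n)..x, (x - s) ^ (-α) * ((U (n + 1) - U n) / (t (n + 1) - t n)) =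
      d n * kernelMass α t n n := by
    rw [intervalIntegral.integral_mul_const, kernelMass, if_neg (lt_irrefl n), mul_comm]
  have hmain : ∀ i < n, ∫ s in (t i)..(t (i + 1)), (x - s) ^ (-α) *
      deriv (fun y => lagQuad (t i) (t (i + 1)) (t (i + 1 + 1)) (U i) (U (i + 1))
        (U (i + 1 + 1)) y) s =
      d i * kernelMass α t n i + kernelCorr α t n i * (d (i + 1) - d i) := by
    intro i hi
    have h1 := ht i (by omega)
    have h2 := ht (i + 1) (by omega)
    have hb : t (i + 1) < x := lt_of_le_of_lt (mesh_le ht (by omega) (by omega)) hxn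
    have e : ∀ s, (x - s) ^ (-α) * deriv (fun y => lagQuad (t i) (t (i + 1)) (t (i + 1 + 1)) (U i)
        (U (i + 1)) (U (i + 1 + 1)) y) s = d i * (x - s) ^ (-α) +
        2 / (t (i + 2) - t i) * (d (i + 1) - d i) *
          ((s - (t i + t (i + 1)) / 2) * (x - s) ^ (-α)) := by
      intro s
      rw [(lagQuad_hasDerivAt h1 h2 _ _ _ s).deriv]
      simp only [d]
      ring
    simp_rw [e]
    rw [intervalIntegral.integral_add ((kernel_intervalIntegrable h1.le hb).const_mul _)
      ((kernel_moment_integrable _ h1.le hb).const_mul _), intervalIntegral.integral_const_mul,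
      intervalIntegral.integral_const_mul, kernelMass, if_pos hi, kernelCorr, if_pos hi,
      kernelMoment]
    ring
  have hsum : ∑ j ∈ Finset.Icc 1 n, ∫ s in (t (j - 1))..(t j), (x - s) ^ (-α) *
      deriv (fun y => lagQuad (t (j - 1)) (t j) (t (j + 1)) (U (j - 1)) (U j) (U (j + 1)) y) s =
      ∑ i ∈ Finset.range n,
        (d i * kernelMass α t n i + kernelCorr α t n i * (d (i + 1) - d i)) := by
    rw [sum_Icc_one_eq_sum_range, ← Finset.sum_congr rfl fun i hi => hmain i (Finset.mem_range.1 hi)]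
    rfl
  rw [deltaAlik, Nat.add_sub_cancel, ← hx, hlast, hsum,
    sum_increments_by_parts (kernelMass α t n) (kernelCorr α t n) (kernelCorrPrev α t n) d rfl
      (fun _ => rfl) n,
    Finset.sum_range_succ]
  congr 1
  have hn0 : kernelCorr α t n n = 0 := if_neg (lt_irrefl n)
  have e2 : ∀ i, alikCoeff α t n i * (U (i + 1) - U i) =
      (kernelMass α t n i - kernelCorr α t n i + kernelCorrPrev α t n i) * d i := by
    intro i; simp only [alikCoeff, d]; ring
  simp_rw [e2, hn0]
  ring

theorem kernelCorr_nonneg (hα0 : 0 < α) (hα1 : α < 1) (ht : ∀ i ≤ n, t i < t (i + 1)) (i : ℕ) :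
    0 ≤ kernelCorr α t n i := by
  rw [kernelCorr]
  split_ifs with h
  · have h1 := ht i (by omega)
    have h2 := ht (i + 1) (by omega)
    have hb : t (i + 1) < tStar α t (n + 1) :=
      lt_of_le_of_lt (mesh_le ht (by omega) (by omega)) (tStar_gt hα1 (ht n le_rfl))
    exact mul_nonneg (div_nonneg (by norm_num) (by linarith))
      (kernelMoment_nonneg hα0 h1.le hb)
  · exact le_rfl

theorem kernelCorrPrev_nonneg (hα0 : 0 < α) (hα1 : α < 1) (ht : ∀ i ≤ n, t i < t (i + 1))
    (i : ℕ) : 0 ≤ kernelCorrPrev α t n i := by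
  cases i with
  | zero => exact le_rfl
  | succ i => exact kernelCorr_nonneg hα0 hα1 ht i

theorem alikCoeff_ge (hα0 : 0 < α) (hα1 : α < 1) (ht : ∀ i ≤ n, t i < t (i + 1)) {i : ℕ}
    (hi : i ≤ n) :
    (tStar α t (n + 1) - t i) ^ (-α) + kernelCorrPrev α t n i / (t (i + 1) - t i) ≤
      alikCoeff α t n i := by
  have h1 := ht i hi
  have hτ : 0 < t (i + 1) - t i := sub_pos.2 h1
  have hxn := tStar_gt hα1 (ht n le_rfl)
  rw [alikCoeff, add_div]
  refine add_le_add_left ?_ _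
  rw [le_div_iff₀ hτ]
  rcases hi.lt_or_eq with h | rfl
  · have h2 := ht (i + 1) (by omega)
    have hb : t (i + 1) < tStar α t (n + 1) :=
      lt_of_le_of_lt (mesh_le ht (by omega) (by omega)) hxn
    rw [kernelMass, if_pos h, kernelCorr, if_pos h]
    refine (kernel_integral_sub_moment_ge hα0 h1 hb).trans (sub_le_sub_left ?_ _)
    exact mul_le_mul_of_nonneg_right (div_le_div_of_nonneg_left (by norm_num) hτ (by linarith))
      (kernelMoment_nonneg hα0 h1.le hb)
  · rw [kernelMass, if_neg (lt_irrefl i), kernelCorr, if_neg (lt_irrefl i), sub_zero,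
      kernel_integral hα1]
    have hxi : 0 < tStar α t (i + 1) - t i := sub_pos.2 hxn
    have e : (tStar α t (i + 1) - t i) ^ (1 - α) =
        (tStar α t (i + 1) - t i) ^ (-α) * ((1 - α / 2) * (t (i + 1) - t i)) := by
      rw [← tStar_sub, ← rpow_add_one hxi.ne']; ring_nf
    rw [e, le_div_iff₀ (by linarith)]
    have := mul_nonneg (rpow_nonneg hxi.le (-α)) hτ.le
    nlinarith

theorem alikCoeff_ge_kernel (hα0 : 0 < α) (hα1 : α < 1) (ht : ∀ i ≤ n, t i < t (i + 1)) {i : ℕ}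
    (hi : i ≤ n) : (tStar α t (n + 1) - t i) ^ (-α) ≤ alikCoeff α t n i := by
  have h := alikCoeff_ge hα0 hα1 ht hi
  have := div_nonneg (kernelCorrPrev_nonneg hα0 hα1 ht i) (sub_pos.2 (ht i hi)).le
  linarith

theorem alikCoeff_nonneg (hα0 : 0 < α) (hα1 : α < 1) (ht : ∀ i ≤ n, t i < t (i + 1)) {i : ℕ}
    (hi : i ≤ n) : 0 ≤ alikCoeff α t n i := by
  refine le_trans (rpow_nonneg ?_ _) (alikCoeff_ge_kernel hα0 hα1 ht hi)
  have := tStar_gt hα1 (ht n le_rfl)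
  linarith [mesh_le ht hi (by omega)]

theorem alikCoeff_succ_sub_ge (hα0 : 0 < α) (hα1 : α < 1) (ht : ∀ i ≤ n, t i < t (i + 1)) {i : ℕ}
    (hi : i < n) :
    α * (tStar α t (n + 1) - t i) ^ (-α - 1) *
        ((t (i + 1) - t i) / 2 + (t (i + 1) - t i) ^ 2 / (6 * (t (i + 2) - t (i + 1)))) -
      kernelCorrPrev α t n i / (t (i + 1) - t i) ≤
    alikCoeff α t n (i + 1) - alikCoeff α t n i := by
  have h1 := ht i hi.le
  have h2 := ht (i + 1) (by omega)
  have hb : t (i + 1) < tStar α t (n + 1) :=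
    lt_of_le_of_lt (mesh_le ht (by omega) (by omega)) (tStar_gt hα1 (ht n le_rfl))
  have h3 := alikCoeff_ge hα0 hα1 ht (i := i + 1) (by omega)
  have h4 := kernel_integral_le_sub hα0 h1.le hb
  have h5 := kernelMoment_ge hα0 h1.le hb
  simp only [kernelCorrPrev, kernelCorr, if_pos hi] at h3
  have e : alikCoeff α t n i = (∫ s in (t i)..(t (i + 1)), (tStar α t (n + 1) - s) ^ (-α)) /
      (t (i + 1) - t i) - 2 / (t (i + 2) - t i) *
        kernelMoment α (tStar α t (n + 1)) (t i) (t (i + 1)) / (t (i + 1) - t i) +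
      kernelCorrPrev α t n i / (t (i + 1) - t i) := by
    rw [alikCoeff, kernelMass, if_pos hi, kernelCorr, if_pos hi]; ring
  rw [show i + 1 + 1 = i + 2 from rfl] at h2 h3
  rw [e]
  set m := kernelMoment α (tStar α t (n + 1)) (t i) (t (i + 1))
  set κ := α * (tStar α t (n + 1) - t i) ^ (-α - 1)
  set p := t (i + 1) - t i with hp
  set q := t (i + 2) - t (i + 1) with hq
  have hp0 : 0 < p := sub_pos.2 h1
  have hq0 : 0 < q := sub_pos.2 h2
  have hpq : t (i + 2) - t i = p + q := by rw [hp, hq]; ring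
  rw [hpq] at h3 ⊢
  have h6 : (∫ s in (t i)..(t (i + 1)), (tStar α t (n + 1) - s) ^ (-α)) / p ≤
      (tStar α t (n + 1) - t (i + 1)) ^ (-α) - κ * p / 2 := by
    rw [div_le_iff₀ hp0]
    refine h4.trans (le_of_eq ?_)
    ring
  have h7 : κ * (p ^ 2 / (6 * q)) ≤ 2 / (p + q) * m / q + 2 / (p + q) * m / p := by
    have : 2 / (p + q) * m / q + 2 / (p + q) * m / p = m * (2 / (p * q)) := by
      field_simp
    rw [this]
    calc κ * (p ^ 2 / (6 * q)) = κ * p ^ 3 / 12 * (2 / (p * q)) := by field_simp; ring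
      _ ≤ _ := mul_le_mul_of_nonneg_right h5 (by positivity)
  have h8 : κ * (p / 2 + p ^ 2 / (6 * q)) = κ * p / 2 + κ * (p ^ 2 / (6 * q)) := by ring
  rw [h8]
  linarith

theorem kernelCorr_le (hα0 : 0 < α) (hα1 : α < 1) (ht : ∀ i ≤ n, t i < t (i + 1)) {i : ℕ}
    (hi : i < n) :
    kernelCorr α t n i ≤ α * (tStar α t (n + 1) - t (i + 1)) ^ (-α - 1) *
      ((t (i + 1) - t i) ^ 3 / (6 * (t (i + 2) - t i))) := by
  have h1 := ht i hi.le
  have h2 := ht (i + 1) (by omega)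
  have hb : t (i + 1) < tStar α t (n + 1) :=
    lt_of_le_of_lt (mesh_le ht (by omega) (by omega)) (tStar_gt hα1 (ht n le_rfl))
  have h5 := kernelMoment_le hα0 h1.le hb
  have h6 : 0 < t (i + 2) - t i := by
    have : t (i + 1) < t (i + 2) := h2
    linarith
  rw [kernelCorr, if_pos hi]
  refine (mul_le_mul_of_nonneg_left h5 (by positivity)).trans (le_of_eq ?_)
  field_simp
  ring

theorem alikCoeff_mono (hα0 : 0 < α) (hα1 : α < 1) (ht : ∀ i ≤ n, t i < t (i + 1)) {i : ℕ}
    (hi : i + 1 < n)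
    (hρ : (t (i + 1) - t i) ^ 3 / (6 * (t (i + 2) - t i)) ≤ (t (i + 2) - t (i + 1)) *
      ((t (i + 2) - t (i + 1)) / 2 +
        (t (i + 2) - t (i + 1)) ^ 2 / (6 * (t (i + 3) - t (i + 2))))) :
    alikCoeff α t n (i + 1) ≤ alikCoeff α t n (i + 2) := by
  have h := alikCoeff_succ_sub_ge hα0 hα1 ht hi
  have h1 := kernelCorr_le hα0 hα1 ht (by omega : i < n)
  have h2 : t (i + 1) < t (i + 2) := ht (i + 1) (by omega)
  have h3 : kernelCorrPrev α t n (i + 1) / (t (i + 2) - t (i + 1)) ≤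
      α * (tStar α t (n + 1) - t (i + 1)) ^ (-α - 1) * ((t (i + 2) - t (i + 1)) / 2 +
        (t (i + 2) - t (i + 1)) ^ 2 / (6 * (t (i + 3) - t (i + 2)))) := by
    rw [div_le_iff₀ (by linarith)]
    refine h1.trans ?_
    rw [mul_assoc (α * _) (_ + _), mul_comm (_ + _)]
    refine mul_le_mul_of_nonneg_left hρ ?_
    have := tStar_gt hα1 (ht n le_rfl)
    have := mesh_le ht (by omega : i + 1 ≤ n) (by omega)
    exact mul_nonneg hα0.le (rpow_nonneg (by linarith) _)
  have : alikCoeff α t n (i + 1 + 1) = alikCoeff α t n (i + 2) := rfl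
  simp only [show i + 1 + 1 = i + 2 from rfl, show i + 1 + 2 = i + 3 from rfl] at h
  linarith

theorem alikCoeff_sub_ge_neg_corr (hα0 : 0 < α) (hα1 : α < 1) (ht : ∀ i ≤ n, t i < t (i + 1))
    {i : ℕ} (hi : i < n) :
    alikCoeff α t n i ≤ alikCoeff α t n (i + 1) +
      kernelCorrPrev α t n i / (t (i + 1) - t i) := by
  have h := alikCoeff_succ_sub_ge hα0 hα1 ht hi
  have h1 := ht i hi.le
  have h2 : t (i + 1) < t (i + 2) := ht (i + 1) (by omega)
  have : 0 ≤ α * (tStar α t (n + 1) - t i) ^ (-α - 1) *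
        ((t (i + 1) - t i) / 2 + (t (i + 1) - t i) ^ 2 / (6 * (t (i + 2) - t (i + 1)))) := by
    have := tStar_gt hα1 (ht n le_rfl)
    have := mesh_le ht (by omega : i ≤ n) (by omega)
    have h3 := rpow_nonneg (by linarith : 0 ≤ tStar α t (n + 1) - t i) (-α - 1)
    have h4 : 0 < t (i + 1) - t i := by linarith
    have h5 : 0 < t (i + 2) - t (i + 1) := by linarith
    positivity
  linarith

theorem alikCoeff_le_last (hα0 : 0 < α) (hα1 : α < 1) (ht : ∀ i ≤ n, t i < t (i + 1)) {Λ : ℝ}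
    (hΛ0 : 0 ≤ Λ) (hΛ : ∀ i < n, t (i + 1) - t i ≤ Λ * (t (i + 2) - t (i + 1))) {i : ℕ}
    (hi : i ≤ n) : alikCoeff α t n i ≤ (1 + Λ) * alikCoeff α t n n := by
  have hxn := tStar_gt hα1 (ht n le_rfl)
  have hlast := alikCoeff_nonneg hα0 hα1 ht (i := n) le_rfl
  rcases hi.eq_or_lt with rfl | hin
  · nlinarith
  have hk := alikCoeff_ge_kernel hα0 hα1 ht (i := n) le_rfl
  have hmass : ∀ j < n, ∫ s in (t j)..(t (j + 1)), (tStar α t (n + 1) - s) ^ (-α) ≤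
      alikCoeff α t n n * (t (j + 1) - t j) := by
    intro j hj
    have h1 := ht j hj.le
    have h2 := mesh_le ht (by omega : j + 1 ≤ n) (by omega)
    refine (kernel_integral_le hα0 h1.le (lt_of_le_of_lt h2 hxn)).trans
      (mul_le_mul_of_nonneg_right ((kernel_mono hα0 h2 hxn).trans hk) (by linarith))
  have h1 := ht i hi
  have hcorr : kernelCorrPrev α t n i ≤ Λ * alikCoeff α t n n * (t (i + 1) - t i) := by
    cases i with
    | zero => exact mul_nonneg (mul_nonneg hΛ0 hlast) (by linarith)
    | succ j =>
      have h2 := ht j (by omega)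
      have hb : t (j + 1) < tStar α t (n + 1) :=
        lt_of_le_of_lt (mesh_le ht (by omega) (by omega)) hxn
      calc kernelCorr α t n j
          ≤ 2 / (t (j + 1) - t j) * kernelMoment α (tStar α t (n + 1)) (t j) (t (j + 1)) := by
            rw [kernelCorr, if_pos (by omega)]
            refine mul_le_mul_of_nonneg_right (div_le_div_of_nonneg_left (by norm_num)
              (by linarith) ?_) (kernelMoment_nonneg hα0 h2.le hb)
            have : t (j + 1) < t (j + 2) := h1
            linarith
        _ ≤ alikCoeff α t n n * (t (j + 1) - t j) :=
            (kernel_moment_le_integral hα0 h2 hb).trans (hmass j (by omega))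
        _ ≤ alikCoeff α t n n * (Λ * (t (j + 2) - t (j + 1))) :=
            mul_le_mul_of_nonneg_left (hΛ j (by omega)) hlast
        _ = _ := by ring
  have hb0 := kernelCorr_nonneg hα0 hα1 ht i
  rw [alikCoeff, div_le_iff₀ (by linarith), kernelMass, if_pos hin]
  have := hmass i hin
  nlinarith

end Operator

theorem AlikhanovCond.ratio_bound {M : ℕ} {t : ℕ → ℝ} (ht : ∀ i < M, t i < t (i + 1))
    (h : AlikhanovCond M t) {i : ℕ} (hi : i + 4 ≤ M) :
    (t (i + 2) - t (i + 1)) ^ 3 / (6 * (t (i + 3) - t (i + 1))) ≤ (t (i + 3) - t (i + 2)) *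
      ((t (i + 3) - t (i + 2)) / 2 +
        (t (i + 3) - t (i + 2)) ^ 2 / (6 * (t (i + 4) - t (i + 3)))) := by
  have hp : 0 < t (i + 2) - t (i + 1) := sub_pos.2 (ht (i + 1) (by omega))
  have hq : 0 < t (i + 3) - t (i + 2) := sub_pos.2 (ht (i + 2) (by omega))
  have hw : 0 < t (i + 4) - t (i + 3) := sub_pos.2 (ht (i + 3) (by omega))
  have hpq : t (i + 3) - t (i + 1) = (t (i + 2) - t (i + 1)) + (t (i + 3) - t (i + 2)) := by ring
  rw [hpq]
  have h' : (4 / 7 : ℝ) ≤ (t (i + 3) - t (i + 2)) / (t (i + 2) - t (i + 1)) ∨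
      (0.4656 : ℝ) ≤ (t (i + 3) - t (i + 2)) / (t (i + 2) - t (i + 1)) ∧
      (t (i + 4) - t (i + 3)) / (t (i + 3) - t (i + 2)) ≤
        (t (i + 3) - t (i + 2)) / (t (i + 2) - t (i + 1)) := by
    rcases h with h | h
    · right
      exact ⟨(h (i + 2) (by omega) (by omega)).1, (h (i + 3) (by omega) (by omega)).2⟩
    · left
      exact h (i + 2) (by omega) (by omega)
  generalize t (i + 2) - t (i + 1) = p at *
  generalize t (i + 3) - t (i + 2) = q at *
  generalize t (i + 4) - t (i + 3) = w at *
  rw [div_le_iff₀ (by positivity)]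
  have key : p ^ 3 ≤ 3 * q ^ 2 * (p + q) + q ^ 3 / w * (p + q) := by
    have h0 : 0 ≤ q ^ 3 / w * (p + q) := by positivity
    rcases h' with h | ⟨h, h2⟩
    · rw [le_div_iff₀ hp] at h
      nlinarith [mul_pos hp hq, mul_pos hp hp, mul_pos (mul_pos hp hq) hq,
        mul_nonneg (mul_pos hp hp).le (by linarith : 0 ≤ q - 4 / 7 * p),
        mul_nonneg (mul_pos hp hq).le (by linarith : 0 ≤ q - 4 / 7 * p), pow_pos hq 3]
    · rw [le_div_iff₀ hp] at h
      rw [div_le_div_iff₀ hq hp] at h2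
      have h3 : q * p ≤ q ^ 3 / w := by
        rw [le_div_iff₀ hw]; nlinarith
      have h4 := mul_le_mul_of_nonneg_right h3 (by positivity : 0 ≤ p + q)
      norm_num at h
      nlinarith [mul_pos hp hq, mul_pos hp hp, mul_pos (mul_pos hp hq) hq,
        mul_nonneg (mul_pos hp hp).le (by linarith : 0 ≤ q - 291 / 625 * p),
        mul_nonneg (mul_pos hp hq).le (by linarith : 0 ≤ q - 291 / 625 * p), pow_pos hq 3]
  refine key.trans (le_of_eq ?_)
  field_simp
  ring

/-! ### Discrete comparison principle -/

/-- The Alikhanov operator at level `n + 1` without the factor `1 / Γ(1 - α)`. -/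
noncomputable def alikSum (α : ℝ) (t U : ℕ → ℝ) (n : ℕ) : ℝ :=
  ∑ i ∈ Finset.range (n + 1), alikCoeff α t n i * (U (i + 1) - U i)

/-- The possible failure of monotonicity of the Alikhanov coefficients. -/
noncomputable def alikDefect (α : ℝ) (t : ℕ → ℝ) (n : ℕ) : ℝ :=
  kernelCorr α t n 0 / (t 2 - t 1)

theorem sum_mul_increment_le {c W : ℕ → ℝ} {X : ℝ} {n : ℕ} (hn : 2 ≤ n) (hc0 : 0 ≤ c 0)
    (hc : ∀ i < n, i ≠ 1 → c i ≤ c (i + 1)) (hc1 : c 1 ≤ c 2 + X) (hX : 0 ≤ X)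
    (hW : ∀ i ≤ n, 0 ≤ W i) :
    ∑ i ∈ Finset.range (n + 1), c i * (W (i + 1) - W i) ≤ c n * W (n + 1) + X * W 2 := by
  have hW2 := mul_nonneg hX (hW 2 hn)
  have key : ∀ k ≤ n, ∑ i ∈ Finset.range (k + 1), c i * (W (i + 1) - W i) ≤
      c k * W (k + 1) + if 2 ≤ k then X * W 2 else 0 := by
    intro k
    induction k with
    | zero =>
      intro _
      have := mul_nonneg hc0 (hW 0 (by omega))
      simp
      linarith
    | succ k ih =>
      intro hk
      rw [Finset.sum_range_succ]
      have h := ih (by omega)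
      have hWk := hW (k + 1) (by omega)
      by_cases h1 : k = 1
      · subst h1
        simp only [show ¬ 2 ≤ 1 by omega, if_false] at h
        simp only [show 2 ≤ 1 + 1 by omega, if_true]
        have := mul_le_mul_of_nonneg_right hc1 (hW 2 hn)
        norm_num at *
        linarith
      · have h2 := mul_le_mul_of_nonneg_right (hc k (by omega) h1) hWk
        have h3 : (if 2 ≤ k then X * W 2 else 0) ≤ if 2 ≤ k + 1 then X * W 2 else 0 := by
          split_ifs <;> first | omega | linarith
        linarith
  have := key n le_rfl
  rwa [if_pos hn] at this

section Stability

variable {α : ℝ} {t : ℕ → ℝ} {M n : ℕ}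

theorem alikDefect_nonneg (hα0 : 0 < α) (hα1 : α < 1) (ht : ∀ i ≤ n, t i < t (i + 1))
    (hn : 1 ≤ n) : 0 ≤ alikDefect α t n :=
  div_nonneg (kernelCorr_nonneg hα0 hα1 ht 0) (sub_pos.2 (ht 1 hn)).le

theorem alikSum_le (hα0 : 0 < α) (hα1 : α < 1) (ht : ∀ i < M, t i < t (i + 1))
    (hA : AlikhanovCond M t) (hnM : n < M) (hn : 2 ≤ n) {W : ℕ → ℝ} (hW : ∀ i ≤ n, 0 ≤ W i) :
    alikSum α t W n ≤ alikCoeff α t n n * W (n + 1) + alikDefect α t n * W 2 := by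
  have ht' : ∀ i ≤ n, t i < t (i + 1) := fun i hi => ht i (by omega)
  refine sum_mul_increment_le hn (alikCoeff_nonneg hα0 hα1 ht' (by omega)) ?_ ?_
    (alikDefect_nonneg hα0 hα1 ht' (by omega)) hW
  · intro i hi hi1
    rcases i with _ | _ | i
    · simpa [kernelCorrPrev] using alikCoeff_sub_ge_neg_corr hα0 hα1 ht' hi
    · exact absurd rfl hi1
    · exact alikCoeff_mono hα0 hα1 ht' (i := i + 1) hi (hA.ratio_bound ht (by omega))
  · exact alikCoeff_sub_ge_neg_corr hα0 hα1 ht' (by omega : 1 < n)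

theorem alikSum_comparison (hα0 : 0 < α) (hα1 : α < 1) (ht : ∀ i < M, t i < t (i + 1))
    (hA : AlikhanovCond M t) (hnM : n < M) (hn : 2 ≤ n) {W : ℕ → ℝ} (hW : ∀ i ≤ n, 0 ≤ W i)
    (h : alikDefect α t n * W 2 ≤ alikSum α t W n) : 0 ≤ W (n + 1) := by
  have ht' : ∀ i ≤ n, t i < t (i + 1) := fun i hi => ht i (by omega)
  have h1 := alikSum_le hα0 hα1 ht hA hnM hn hW
  have h2 : 0 < alikCoeff α t n n :=
    lt_of_lt_of_le (rpow_pos_of_pos (sub_pos.2 (tStar_gt hα1 (ht n hnM))) _)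
      (alikCoeff_ge_kernel hα0 hα1 ht' le_rfl)
  exact (mul_nonneg_iff_of_pos_left h2).1 (by linarith)

theorem alikSum_add (U V : ℕ → ℝ) :
    alikSum α t (fun i => U i + V i) n = alikSum α t U n + alikSum α t V n := by
  simp only [alikSum, ← Finset.sum_add_distrib]
  exact Finset.sum_congr rfl fun i _ => by ring

theorem alikSum_smul (c : ℝ) (U : ℕ → ℝ) :
    alikSum α t (fun i => c * U i) n = c * alikSum α t U n := by
  simp only [alikSum, Finset.mul_sum]
  exact Finset.sum_congr rfl fun i _ => by ring

theorem alikSum_sum {ι : Type*} (s : Finset ι) (U : ι → ℕ → ℝ) :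
    alikSum α t (fun i => ∑ k ∈ s, U k i) n = ∑ k ∈ s, alikSum α t (U k) n := by
  simp only [alikSum, ← Finset.sum_sub_distrib, Finset.mul_sum]
  exact Finset.sum_comm

/-- A bound growing geometrically with the level, useful for the first few levels only. -/
theorem abs_le_of_alikSum_le (hα0 : 0 < α) (hα1 : α < 1) (ht : ∀ i < M, t i < t (i + 1)) {Λ : ℝ}
    (hΛ0 : 0 ≤ Λ) (hΛ : ∀ i, i + 1 < M → t (i + 1) - t i ≤ Λ * (t (i + 2) - t (i + 1)))
    {E : ℝ} (hE : 0 ≤ E) {V : ℕ → ℝ} (hV0 : V 0 = 0) {N : ℕ} (hN : N ≤ M)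
    (hV : ∀ n < N, |alikSum α t V n| ≤ E * (tStar α t (n + 1) - t n) ^ (-α)) :
    |V N| ≤ E * (3 + Λ) ^ N := by
  suffices h : ∀ k ≤ N, ∑ i ∈ Finset.range k, |V (i + 1) - V i| ≤ E * (3 + Λ) ^ k by
    have h1 := h N le_rfl
    have h2 : V N = ∑ i ∈ Finset.range N, (V (i + 1) - V i) := by
      rw [Finset.sum_range_sub, hV0, sub_zero]
    rw [h2]
    exact (Finset.abs_sum_le_sum_abs _ _).trans h1
  intro k
  induction k with
  | zero => intro _; simpa using hE
  | succ k ih =>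
    intro hk
    have hs := ih (by omega)
    have ht' : ∀ i ≤ k, t i < t (i + 1) := fun i hi => ht i (by omega)
    set S := ∑ i ∈ Finset.range k, |V (i + 1) - V i|
    set c := alikCoeff α t k k with hc
    have hker : (tStar α t (k + 1) - t k) ^ (-α) ≤ c := alikCoeff_ge_kernel hα0 hα1 ht' le_rfl
    have hcpos : 0 < c :=
      lt_of_lt_of_le (rpow_pos_of_pos (sub_pos.2 (tStar_gt hα1 (ht k (by omega)))) _) hker
    have h1 : |c * (V (k + 1) - V k)| ≤ E * c + (1 + Λ) * c * S := by
      have e : c * (V (k + 1) - V k) = alikSum α t V k -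
          ∑ i ∈ Finset.range k, alikCoeff α t k i * (V (i + 1) - V i) := by
        rw [alikSum, Finset.sum_range_succ]; ring
      rw [e]
      refine (abs_sub _ _).trans (add_le_add ?_ ?_)
      · exact (hV k (by omega)).trans (mul_le_mul_of_nonneg_left hker hE)
      · refine (Finset.abs_sum_le_sum_abs _ _).trans ?_
        rw [Finset.mul_sum]
        refine Finset.sum_le_sum fun i hi => ?_
        have hik : i ≤ k := (Finset.mem_range.1 hi).le
        rw [abs_mul, abs_of_nonneg (alikCoeff_nonneg hα0 hα1 ht' hik)]
        exact mul_le_mul_of_nonneg_right (alikCoeff_le_last hα0 hα1 ht' hΛ0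
          (fun i hi => hΛ i (by omega)) hik) (abs_nonneg _)
    have h2 : |V (k + 1) - V k| ≤ E + (1 + Λ) * S := by
      rw [abs_mul, abs_of_pos hcpos] at h1
      refine le_of_mul_le_mul_left ?_ hcpos
      linarith
    rw [Finset.sum_range_succ]
    have h3 : E ≤ E * (3 + Λ) ^ k := le_mul_of_one_le_right hE (one_le_pow₀ (by linarith))
    have h4 := mul_le_mul_of_nonneg_left hs (by linarith : 0 ≤ 2 + Λ)
    rw [pow_succ]
    linarith

end Stability

/-! ### Quasi-graded meshes -/

/-- The model step size `τ^{1/r} s^{1-1/r}` of a quasi-graded mesh at the point `s`. -/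
noncomputable def gradedStep (r τ s : ℝ) : ℝ := τ ^ (1 / r) * s ^ (1 - 1 / r)

/-- The consequences of quasi-gradedness which are used below, with a single constant. -/
structure GradedMesh (r Λ : ℝ) (M : ℕ) (t : ℕ → ℝ) : Prop where
  one_le_r : 1 ≤ r
  one_le : 1 ≤ Λ
  two_le : 2 ≤ M
  zero : t 0 = 0
  lt_succ : ∀ i < M, t i < t (i + 1)
  step_le : ∀ i < M, t (i + 1) - t i ≤ Λ * gradedStep r (t 1) (t (i + 1))
  le_step : ∀ i < M, gradedStep r (t 1) (t (i + 1)) ≤ Λ * (t (i + 1) - t i)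
  succ_le : ∀ i, 1 ≤ i → i < M → t (i + 1) ≤ Λ * t i
  step_le_succ : ∀ i, i + 1 < M → t (i + 1) - t i ≤ Λ * (t (i + 2) - t (i + 1))
  linear_le : ∀ i, 1 ≤ i → i ≤ M → t 1 * i ≤ Λ * t i
  le_power : ∀ i, 1 ≤ i → i ≤ M → t i ≤ Λ * (t 1 * (i : ℝ) ^ r)

theorem gradedStep_pos {r τ s : ℝ} (hτ : 0 < τ) (hs : 0 < s) : 0 < gradedStep r τ s :=
  mul_pos (rpow_pos_of_pos hτ _) (rpow_pos_of_pos hs _)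

theorem gradedStep_mono {r τ s y : ℝ} (hr : 1 ≤ r) (hτ : 0 < τ) (hs : 0 < s) (hsy : s ≤ y) :
    gradedStep r τ s ≤ gradedStep r τ y := by
  have : 1 / r ≤ 1 := by rw [div_le_one (by linarith)]; exact hr
  exact mul_le_mul_of_nonneg_left (rpow_le_rpow hs.le hsy (by linarith)) (rpow_nonneg hτ.le _)

/-- Powers of the step are controlled by mixed powers of `τ` and `s`. -/
theorem gradedStep_rpow_le {r τ s a p : ℝ} (hτ : 0 < τ) (hs : τ ≤ s) (hp : p ≤ a / r) :
    gradedStep r τ s ^ a ≤ τ ^ p * s ^ (a - p) := by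
  have hs0 : 0 < s := hτ.trans_le hs
  rw [gradedStep, mul_rpow (rpow_nonneg hτ.le _) (rpow_nonneg hs0.le _), ← rpow_mul hτ.le,
    ← rpow_mul hs0.le]
  have e1 : τ ^ (1 / r * a) = τ ^ p * τ ^ (a / r - p) := by
    rw [← rpow_add hτ]; ring_nf
  have e2 : s ^ (a - p) = s ^ (a / r - p) * s ^ ((1 - 1 / r) * a) := by
    rw [← rpow_add hs0]; ring_nf
  rw [e1, e2, mul_assoc]
  refine mul_le_mul_of_nonneg_left ?_ (rpow_nonneg hτ.le _)
  exact mul_le_mul_of_nonneg_right (rpow_le_rpow hτ.le hs (by linarith)) (rpow_nonneg hs0.le _)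

theorem QuasiGraded.gradedMesh {r c0 C0 T : ℝ} (hr : 1 ≤ r) (hc0 : 0 < c0) (hcC : c0 ≤ C0) :
    ∃ Λ : ℝ, 1 ≤ Λ ∧ ∀ (M : ℕ) (t : ℕ → ℝ), IsMesh T M t → QuasiGraded r c0 C0 M t →
      GradedMesh r Λ M t := by
  have hC0 : 0 < C0 := hc0.trans_le hcC
  have hr0 : 0 < r := by linarith
  have h2r : 1 ≤ (2:ℝ) ^ r := one_le_rpow (by norm_num) hr0.le
  have hK : 1 ≤ C0 / c0 := by rw [le_div_iff₀ hc0]; linarith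
  set Λ := 1 + C0 + 1 / c0 + C0 / c0 * 2 ^ r with hΛ
  have hi : 0 < 1 / c0 := by positivity
  have hKr : 0 < C0 / c0 * 2 ^ r := by positivity
  have hKr' : C0 / c0 ≤ C0 / c0 * 2 ^ r := le_mul_of_one_le_right (by positivity) h2r
  refine ⟨Λ, by linarith, fun M t ⟨hM, h0, hlt, hT⟩ ⟨_, hg, hs⟩ => ?_⟩
  have hτ : 0 < t 1 := by have := hlt 0 (by omega); rw [h0] at this; simpa using this
  have hpos : ∀ i, 1 ≤ i → i ≤ M → 0 < t i := by
    intro i hi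
    induction i, hi using Nat.le_induction with
    | base => intro _; exact hτ
    | succ j hj ih => intro h; exact (ih (by omega)).trans (hlt j (by omega))
  have hstep : ∀ i < M, c0 * gradedStep r (t 1) (t (i + 1)) ≤ t (i + 1) - t i ∧
      t (i + 1) - t i ≤ C0 * gradedStep r (t 1) (t (i + 1)) := fun i hi =>
    hs (i + 1) (by omega) (by omega)
  refine ⟨hr, by linarith, hM, h0, hlt, ?_, ?_, ?_, ?_, ?_, ?_⟩
  · intro i hi
    refine (hstep i hi).2.trans (mul_le_mul_of_nonneg_right (by linarith)
      (gradedStep_pos hτ (hpos _ (by omega) (by omega))).le)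
  · intro i hi
    have h1 := (hstep i hi).1
    have h2 : gradedStep r (t 1) (t (i + 1)) ≤ 1 / c0 * (t (i + 1) - t i) := by
      rw [div_mul_eq_mul_div, one_mul, le_div_iff₀ hc0]; linarith
    refine h2.trans (mul_le_mul_of_nonneg_right (by linarith) (sub_pos.2 (hlt i hi)).le)
  · intro i hi1 hi
    have h1 := (hg (i + 1) (by omega) (by omega)).2
    have h2 := (hg i hi1 (by omega)).1
    have h3 : ((i + 1 : ℕ) : ℝ) ^ r ≤ 2 ^ r * (i : ℝ) ^ r := by
      rw [← mul_rpow (by norm_num) (by positivity)]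
      have : (1 : ℝ) ≤ i := by exact_mod_cast hi1
      refine rpow_le_rpow (by positivity) ?_ hr0.le
      push_cast; linarith
    calc t (i + 1) ≤ C0 * (t 1 * (2 ^ r * (i : ℝ) ^ r)) := h1.trans (by gcongr)
      _ = C0 / c0 * 2 ^ r * (c0 * (t 1 * (i : ℝ) ^ r)) := by field_simp
      _ ≤ C0 / c0 * 2 ^ r * t i := by gcongr
      _ ≤ Λ * t i := mul_le_mul_of_nonneg_right (by linarith) (hpos i hi1 (by omega)).le
  · intro i hi
    have h1 := (hstep i (by omega)).2
    have h2 := (hstep (i + 1) hi).1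
    have hti := hpos (i + 1) (by omega) (by omega)
    have h3 := gradedStep_mono (r := r) hr hτ hti (hlt (i + 1) hi).le
    have h4 : 0 < t (i + 2) - t (i + 1) := sub_pos.2 (hlt (i + 1) hi)
    calc t (i + 1) - t i ≤ C0 * gradedStep r (t 1) (t (i + 1 + 1)) := h1.trans (by gcongr)
      _ = C0 / c0 * (c0 * gradedStep r (t 1) (t (i + 1 + 1))) := by field_simp
      _ ≤ C0 / c0 * (t (i + 2) - t (i + 1)) := by gcongr
      _ ≤ _ := mul_le_mul_of_nonneg_right (by linarith) h4.le
  · intro i hi1 hi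
    have h2 := (hg i hi1 hi).1
    have h3 : (i : ℝ) ≤ (i : ℝ) ^ r := by
      conv_lhs => rw [← rpow_one (i : ℝ)]
      exact rpow_le_rpow_of_exponent_le (by exact_mod_cast hi1) hr
    calc t 1 * i ≤ t 1 * (i : ℝ) ^ r := by gcongr
      _ = 1 / c0 * (c0 * (t 1 * (i : ℝ) ^ r)) := by field_simp
      _ ≤ 1 / c0 * t i := by gcongr
      _ ≤ _ := mul_le_mul_of_nonneg_right (by linarith) (hpos i hi1 hi).le
  · intro i hi1 hi
    refine (hg i hi1 hi).2.trans (mul_le_mul_of_nonneg_right (by linarith) (by positivity))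

namespace GradedMesh

variable {r Λ : ℝ} {M : ℕ} {t : ℕ → ℝ}

theorem tau_pos (h : GradedMesh r Λ M t) : 0 < t 1 := by
  have := h.lt_succ 0 (by have := h.two_le; omega)
  rw [h.zero] at this; simpa using this

theorem lt_of_lt (h : GradedMesh r Λ M t) {i j : ℕ} (hij : i < j) (hj : j ≤ M) : t i < t j :=
  mesh_lt (n := M - 1) (fun i hi => h.lt_succ i (by have := h.two_le; omega)) hij
    (by omega)

theorem le_of_le (h : GradedMesh r Λ M t) {i j : ℕ} (hij : i ≤ j) (hj : j ≤ M) : t i ≤ t j := by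
  rcases hij.eq_or_lt with rfl | h'
  · rfl
  · exact (h.lt_of_lt h' hj).le

theorem tau_le (h : GradedMesh r Λ M t) {i : ℕ} (hi : 1 ≤ i) (hiM : i ≤ M) : t 1 ≤ t i :=
  h.le_of_le hi hiM

theorem pos (h : GradedMesh r Λ M t) {i : ℕ} (hi : 1 ≤ i) (hiM : i ≤ M) : 0 < t i :=
  h.tau_pos.trans_le (h.tau_le hi hiM)

theorem nonneg (h : GradedMesh r Λ M t) {i : ℕ} (hiM : i ≤ M) : 0 ≤ t i :=
  h.zero ▸ h.le_of_le (Nat.zero_le i) hiM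

/-- Consecutive model steps are comparable. -/
theorem gradedStep_succ_le (h : GradedMesh r Λ M t) {i : ℕ} (hi : 1 ≤ i) (hiM : i < M) :
    gradedStep r (t 1) (t (i + 1)) ≤ Λ * gradedStep r (t 1) (t i) := by
  have hr := h.one_le_r
  have hΛ := h.one_le
  have h1 : 1 / r ≤ 1 := by rw [div_le_one (by linarith)]; exact hr
  have h1' : 0 ≤ 1 / r := by positivity
  have hti := h.pos hi hiM.le
  have h2 : t (i + 1) ^ (1 - 1 / r) ≤ Λ * t i ^ (1 - 1 / r) := by
    calc t (i + 1) ^ (1 - 1 / r) ≤ (Λ * t i) ^ (1 - 1 / r) :=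
          rpow_le_rpow (h.nonneg (by omega)) (h.succ_le i hi hiM) (by linarith)
      _ = Λ ^ (1 - 1 / r) * t i ^ (1 - 1 / r) := mul_rpow (by linarith) hti.le
      _ ≤ Λ ^ (1 : ℝ) * t i ^ (1 - 1 / r) := by
          gcongr
          linarith
      _ = _ := by rw [rpow_one]
  calc _ ≤ t 1 ^ (1 / r) * (Λ * t i ^ (1 - 1 / r)) :=
        mul_le_mul_of_nonneg_left h2 (rpow_nonneg h.tau_pos.le _)
    _ = _ := by rw [gradedStep]; ring

theorem tStar_ge (h : GradedMesh r Λ M t) {α : ℝ} (hα1 : α < 1) {n : ℕ}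
    (hn : n < M) : t (n + 1) / 2 ≤ tStar α t (n + 1) := by
  have h1 := h.nonneg hn.le
  have h2 := h.lt_succ n hn
  simp only [tStar, Nat.add_sub_cancel]
  nlinarith

/-- Increments of powers control left-endpoint-free Riemann sums. -/
theorem sum_step_mul_rpow_le (h : GradedMesh r Λ M t) {p : ℝ} (hp : 0 < p) {n : ℕ} (hn : n ≤ M) :
    ∑ i ∈ Finset.range n, (t (i + 1) - t i) * t (i + 1) ^ (p - 1) ≤
      max 1 (1 / p) * t n ^ p := by
  have key : ∀ i < n, (t (i + 1) - t i) * t (i + 1) ^ (p - 1) ≤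
      max 1 (1 / p) * (t (i + 1) ^ p - t i ^ p) := by
    intro i hi
    have ha := h.nonneg (by omega : i ≤ M)
    have hab := h.lt_succ i (by omega)
    set a := t i
    set b := t (i + 1)
    have hb : 0 < b := ha.trans_lt hab
    have hbp : b ^ p = b * b ^ (p - 1) := by
      rw [rpow_sub_one hb.ne']; field_simp
    rcases le_total 1 p with h1 | h1
    · have h2 : a ^ p ≤ a * b ^ (p - 1) := by
        rcases ha.eq_or_lt with h0 | h0
        · rw [← h0, zero_rpow hp.ne']; simp
        · rw [show a ^ p = a * a ^ (p - 1) by rw [rpow_sub_one h0.ne']; field_simp]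
          exact mul_le_mul_of_nonneg_left (rpow_le_rpow h0.le hab.le (by linarith)) ha
      have h3 : (b - a) * b ^ (p - 1) ≤ b ^ p - a ^ p := by rw [hbp]; linarith
      refine h3.trans (le_mul_of_one_le_left ?_ (le_max_left _ _))
      have := mul_nonneg (sub_nonneg.2 hab.le) (rpow_nonneg hb.le (p - 1))
      linarith
    · have h2 : p * ((b - a) * b ^ (p - 1)) ≤ b ^ p - a ^ p := by
        have hx := rpow_one_add_le_one_add_mul_self (s := a / b - 1)
          (by have := div_nonneg ha hb.le; linarith) hp.le h1
        rw [add_sub_cancel, div_rpow ha hb.le, div_le_iff₀ (rpow_pos_of_pos hb _)] at hx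
        have e : (1 + p * (a / b - 1)) * b ^ p = b ^ p - p * ((b - a) * b ^ (p - 1)) := by
          rw [rpow_sub_one hb.ne']; field_simp; ring
        linarith
      have h3 : (b - a) * b ^ (p - 1) ≤ 1 / p * (b ^ p - a ^ p) := by
        rw [div_mul_eq_mul_div, one_mul, le_div_iff₀ hp]; linarith
      refine h3.trans (mul_le_mul_of_nonneg_right (le_max_right _ _) ?_)
      exact sub_nonneg.2 (rpow_le_rpow ha hab.le hp.le)
  refine (Finset.sum_le_sum fun i hi => key i (Finset.mem_range.1 hi)).trans ?_
  rw [← Finset.mul_sum, Finset.sum_range_sub (fun i => t i ^ p), h.zero, zero_rpow hp.ne', sub_zero]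

end GradedMesh

/-! ### Taylor expansion and interpolation error -/

section Taylor

variable {f f1 f2 f3 : ℝ → ℝ} {A B L : ℝ}

theorem abs_sub_le_of_hasDerivAt {g g' : ℝ → ℝ} {s : Set ℝ} {C : ℝ} (hs : Convex ℝ s)
    (hg : ∀ y ∈ s, HasDerivAt g (g' y) y) (hC : ∀ y ∈ s, |g' y| ≤ C) {a y : ℝ} (ha : a ∈ s)
    (hy : y ∈ s) : |g y - g a| ≤ C * |y - a| :=
  hs.norm_image_sub_le_of_norm_hasDerivWithin_le (fun z hz => (hg z hz).hasDerivWithinAt) hC ha hy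

theorem abs_sub_le_of_mem_uIcc {a s y : ℝ} (hy : y ∈ uIcc a s) : |y - a| ≤ |s - a| :=
  abs_sub_left_of_mem_uIcc hy

theorem taylor_first (h2 : ∀ s ∈ Ioo A B, HasDerivAt f1 (f2 s) s)
    (h3 : ∀ s ∈ Ioo A B, HasDerivAt f2 (f3 s) s) (hL : ∀ s ∈ Ioo A B, |f3 s| ≤ L)
    {a s : ℝ} (ha : a ∈ Ioo A B) (hs : s ∈ Ioo A B) :
    |f1 s - f1 a - f2 a * (s - a)| ≤ L * |s - a| ^ 2 := by
  have hL0 : 0 ≤ L := (abs_nonneg _).trans (hL a ha)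
  have hsub : uIcc a s ⊆ Ioo A B := ordConnected_Ioo.uIcc_subset ha hs
  have h := abs_sub_le_of_hasDerivAt (g := fun y => f1 y - f2 a * (y - a))
    (g' := fun y => f2 y - f2 a) (s := uIcc a s) (C := L * |s - a|) (convex_uIcc a s)
    (fun y hy => by
      have e := (h2 y (hsub hy)).sub (((hasDerivAt_id y).sub_const a).const_mul (f2 a))
      refine e.congr_deriv (by ring))
    (fun y hy => (abs_sub_le_of_hasDerivAt (convex_Ioo A B) h3 hL ha (hsub hy)).trans
      (mul_le_mul_of_nonneg_left (abs_sub_le_of_mem_uIcc hy) hL0)) left_mem_uIcc right_mem_uIcc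
  have e : f1 s - f2 a * (s - a) - (f1 a - f2 a * (a - a)) = f1 s - f1 a - f2 a * (s - a) := by ring
  simp only [e] at h
  rw [pow_two, ← mul_assoc]
  exact h

theorem taylor_second (hAB : A < B) (hf : ContinuousOn f (Icc A B))
    (h1 : ∀ s ∈ Ioo A B, HasDerivAt f (f1 s) s)
    (h2 : ∀ s ∈ Ioo A B, HasDerivAt f1 (f2 s) s)
    (h3 : ∀ s ∈ Ioo A B, HasDerivAt f2 (f3 s) s) (hL : ∀ s ∈ Ioo A B, |f3 s| ≤ L)
    {a s : ℝ} (ha : a ∈ Ioo A B) (hs : s ∈ Icc A B) :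
    |f s - (f a + f1 a * (s - a) + f2 a / 2 * (s - a) ^ 2)| ≤ L * |s - a| ^ 3 := by
  have hL0 : 0 ≤ L := (abs_nonneg _).trans (hL a ha)
  have hopen : ∀ s ∈ Ioo A B,
      |f s - (f a + f1 a * (s - a) + f2 a / 2 * (s - a) ^ 2)| ≤ L * |s - a| ^ 3 := by
    intro s hs
    have hsub : uIcc a s ⊆ Ioo A B := ordConnected_Ioo.uIcc_subset ha hs
    have h := abs_sub_le_of_hasDerivAt
      (g := fun y => f y - (f1 a * (y - a) + f2 a / 2 * (y - a) ^ 2))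
      (g' := fun y => f1 y - f1 a - f2 a * (y - a)) (s := uIcc a s) (C := L * |s - a| ^ 2)
      (convex_uIcc a s)
      (fun y hy => by
        have hy1 : HasDerivAt (fun y => y - a) 1 y := by simpa using (hasDerivAt_id y).sub_const a
        have e := (h1 y (hsub hy)).sub ((hy1.const_mul (f1 a)).add
          ((hy1.pow 2).const_mul (f2 a / 2)))
        refine e.congr_deriv (by norm_num; ring))
      (fun y hy => (taylor_first h2 h3 hL ha (hsub hy)).trans
        (mul_le_mul_of_nonneg_left (pow_le_pow_left₀ (abs_nonneg _)
          (abs_sub_le_of_mem_uIcc hy) 2) hL0)) left_mem_uIcc right_mem_uIcc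
    have e : f s - (f1 a * (s - a) + f2 a / 2 * (s - a) ^ 2) -
        (f a - (f1 a * (a - a) + f2 a / 2 * (a - a) ^ 2)) =
        f s - (f a + f1 a * (s - a) + f2 a / 2 * (s - a) ^ 2) := by ring
    simp only [e] at h
    exact h.trans (le_of_eq (by ring))
  have hcl : closure (Ioo A B) = Icc A B := closure_Ioo hAB.ne
  refine le_on_closure (s := Ioo A B)
    (f := fun s => |f s - (f a + f1 a * (s - a) + f2 a / 2 * (s - a) ^ 2)|)
    (g := fun s => L * |s - a| ^ 3) hopen ?_ ?_ (hcl ▸ hs)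
  · rw [hcl]
    exact (hf.sub (Continuous.continuousOn (by fun_prop))).abs
  · exact Continuous.continuousOn (by fun_prop)

theorem lagQuad_sub_le {x0 x1 x2 : ℝ} (h01 : x0 < x1) (h12 : x1 < x2)
    (hf : ContinuousOn f (Icc x0 x2))
    (h1 : ∀ s ∈ Ioo x0 x2, HasDerivAt f (f1 s) s)
    (h2 : ∀ s ∈ Ioo x0 x2, HasDerivAt f1 (f2 s) s)
    (h3 : ∀ s ∈ Ioo x0 x2, HasDerivAt f2 (f3 s) s) (hL : ∀ s ∈ Ioo x0 x2, |f3 s| ≤ L)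
    {s : ℝ} (hs : s ∈ Icc x0 x1) :
    |lagQuad x0 x1 x2 (f x0) (f x1) (f x2) s - f s| ≤ 3 * L * (x2 - x0) ^ 3 := by
  have hx1 : x1 ∈ Ioo x0 x2 := ⟨h01, h12⟩
  have hL0 : 0 ≤ L := (abs_nonneg _).trans (hL x1 hx1)
  let R : ℝ → ℝ := fun s => f s - (f x1 + f1 x1 * (s - x1) + f2 x1 / 2 * (s - x1) ^ 2)
  have hR : ∀ y ∈ Icc x0 x2, |R y| ≤ L * |y - x1| ^ 3 := fun y hy =>
    taylor_second (h01.trans h12) hf h1 h2 h3 hL hx1 hy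
  have hp : 0 < x1 - x0 := sub_pos.2 h01
  have hq : 0 < x2 - x1 := sub_pos.2 h12
  have hpq : 0 < x2 - x0 := by linarith
  have e : lagQuad x0 x1 x2 (f x0) (f x1) (f x2) s - f s =
      R x0 * ((x1 - s) * (x2 - s) / ((x1 - x0) * (x2 - x0))) -
        R x2 * ((s - x0) * (x1 - s) / ((x2 - x0) * (x2 - x1))) - R s := by
    have n4 : x0 - x1 ≠ 0 := by linarith
    have n5 : x1 - x2 ≠ 0 := by linarith
    have n6 : x0 - x2 ≠ 0 := by linarith
    simp only [lagQuad, R]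
    rw [show x0 - x1 = -(x1 - x0) by ring, show x0 - x2 = -(x2 - x0) by ring,
      show x1 - x2 = -(x2 - x1) by ring]
    field_simp
    ring
  have hW : ∀ y ∈ Icc x0 x2, |R y| ≤ L * (x2 - x0) ^ 3 := by
    intro y hy
    refine (hR y hy).trans (mul_le_mul_of_nonneg_left (pow_le_pow_left₀ (abs_nonneg _) ?_ 3) hL0)
    rw [abs_le]
    constructor <;> linarith [hy.1, hy.2]
  have b0 : |R x0 * ((x1 - s) * (x2 - s) / ((x1 - x0) * (x2 - x0)))| ≤ L * (x2 - x0) ^ 3 := by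
    rw [abs_mul]
    have h0 := hW x0 ⟨le_rfl, by linarith⟩
    have h4 : 0 ≤ (x1 - s) * (x2 - s) := mul_nonneg (by linarith [hs.2]) (by linarith [hs.2])
    have h5 : |(x1 - s) * (x2 - s) / ((x1 - x0) * (x2 - x0))| ≤ 1 := by
      rw [abs_of_nonneg (div_nonneg h4 (by positivity)), div_le_one (by positivity)]
      exact mul_le_mul (by linarith [hs.1]) (by linarith [hs.1]) (by linarith [hs.2]) hp.le
    calc _ ≤ |R x0| * 1 := mul_le_mul_of_nonneg_left h5 (abs_nonneg _)
      _ ≤ _ := by linarith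
  have b2 : |R x2 * ((s - x0) * (x1 - s) / ((x2 - x0) * (x2 - x1)))| ≤ L * (x2 - x0) ^ 3 := by
    rw [abs_mul]
    have h0 := hR x2 ⟨by linarith, le_rfl⟩
    rw [abs_of_pos hq] at h0
    have h4 : 0 ≤ (s - x0) * (x1 - s) := mul_nonneg (by linarith [hs.1]) (by linarith [hs.2])
    have h4' : (s - x0) * (x1 - s) ≤ (x2 - x0) * (x2 - x0) :=
      mul_le_mul (by linarith [hs.2]) (by linarith [hs.1]) (by linarith [hs.2]) hpq.le
    rw [abs_of_nonneg (div_nonneg h4 (by positivity))]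
    calc _ ≤ L * (x2 - x1) ^ 3 * ((x2 - x0) * (x2 - x0) / ((x2 - x0) * (x2 - x1))) := by
          gcongr
      _ = L * (x2 - x1) ^ 2 * (x2 - x0) := by field_simp
      _ ≤ L * (x2 - x0) ^ 2 * (x2 - x0) := by gcongr
      _ = _ := by ring
  have b3 := hW s ⟨hs.1, by linarith [hs.2]⟩
  rw [e]
  refine (abs_sub _ _).trans ?_
  have := abs_sub (R x0 * ((x1 - s) * (x2 - s) / ((x1 - x0) * (x2 - x0))))
    (R x2 * ((s - x0) * (x1 - s) / ((x2 - x0) * (x2 - x1))))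
  linarith

end Taylor

/-! ### Truncation error of the Alikhanov operator -/

section Truncation

variable {α : ℝ} {f f1 f2 f3 : ℝ → ℝ}

theorem integral_kernel_mul_deriv_sub_le (hα0 : 0 < α) {a b x E : ℝ} (hab : a < b) (hbx : b < x)
    {P P1 : ℝ → ℝ} (hP : ∀ s, HasDerivAt P (P1 s) s) (hP1 : Continuous P1)
    (hf : ContinuousOn f (Icc a b)) (h1 : ∀ s ∈ Ioo a b, HasDerivAt f (f1 s) s)
    (hf1 : IntervalIntegrable f1 volume a b) (hPa : P a = f a) (hPb : P b = f b)
    (hE : ∀ s ∈ Icc a b, |P s - f s| ≤ E) :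
    |(∫ s in a..b, (x - s) ^ (-α) * P1 s) - ∫ s in a..b, (x - s) ^ (-α) * f1 s| ≤
      E * ((x - b) ^ (-α) - (x - a) ^ (-α)) := by
  have hk := kernel_continuousOn (α := α) (a := a) hbx
  have hk' : ContinuousOn (fun s => (x - s) ^ (-α)) (uIcc a b) := by rwa [uIcc_of_le hab.le]
  have hd : ∀ s ∈ uIcc a b, HasDerivAt (fun s => (x - s) ^ (-α)) (α * (x - s) ^ (-α - 1)) s := by
    intro s hs
    rw [uIcc_of_le hab.le] at hs
    exact kernel_hasDerivAt (by linarith [hs.2])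
  have hdi : IntervalIntegrable (fun s => α * (x - s) ^ (-α - 1)) volume a b := by
    refine ContinuousOn.intervalIntegrable_of_Icc hab.le (continuousOn_const.mul ?_)
    refine ContinuousOn.rpow_const (by fun_prop) fun s hs => Or.inl ?_
    have := hs.2
    linarith
  rw [← intervalIntegral.integral_sub ((hP1.intervalIntegrable a b).continuousOn_mul hk')
    (hf1.continuousOn_mul hk')]
  have hPc : Continuous P := continuous_iff_continuousAt.2 fun s => (hP s).continuousAt
  have hparts := intervalIntegral.integral_mul_deriv_eq_deriv_mul_of_hasDerivAt
    (u := fun s => (x - s) ^ (-α)) (v := fun s => P s - f s) (a := a) (b := b)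
    (u' := fun s => α * (x - s) ^ (-α - 1)) (v' := fun s => P1 s - f1 s) hk'
    (by rw [uIcc_of_le hab.le]; exact hPc.continuousOn.sub hf)
    (by
      intro s hs
      exact hd s (Ioo_subset_Icc_self hs))
    (by
      intro s hs
      rw [min_eq_left hab.le, max_eq_right hab.le] at hs
      exact (hP s).sub (h1 s hs)) hdi ((hP1.intervalIntegrable a b).sub hf1)
  have e : ∀ s, (x - s) ^ (-α) * P1 s - (x - s) ^ (-α) * f1 s =
      (x - s) ^ (-α) * (P1 s - f1 s) := fun s => by ring
  simp_rw [e]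
  rw [hparts, hPa, hPb, sub_self, sub_self, mul_zero, mul_zero, sub_self, zero_sub, abs_neg,
    ← intervalIntegral.integral_eq_sub_of_hasDerivAt hd hdi, ← intervalIntegral.integral_const_mul]
  rw [← Real.norm_eq_abs]
  refine intervalIntegral.norm_integral_le_of_norm_le hab.le (Filter.Eventually.of_forall ?_)
    (hdi.const_mul _)
  intro s hs
  have h0 : 0 ≤ α * (x - s) ^ (-α - 1) :=
    mul_nonneg hα0.le (rpow_nonneg (by linarith [hs.2]) _)
  rw [norm_mul, Real.norm_eq_abs, Real.norm_eq_abs, abs_of_nonneg h0, mul_comm]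
  exact mul_le_mul_of_nonneg_right (hE s (Ioc_subset_Icc_self hs)) h0

theorem integral_kernel_mul_slope_sub_le (hα0 : 0 < α) (hα1 : α < 1) {a b x L : ℝ} (hab : a < b)
    (hx : x = b - α / 2 * (b - a)) (hf : ContinuousOn f (Icc a b))
    (h1 : ∀ s ∈ Ioo a b, HasDerivAt f (f1 s) s)
    (h2 : ∀ s ∈ Ioo a b, HasDerivAt f1 (f2 s) s)
    (h3 : ∀ s ∈ Ioo a b, HasDerivAt f2 (f3 s) s) (hL : ∀ s ∈ Ioo a b, |f3 s| ≤ L)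
    (hf1 : IntervalIntegrable (fun s => (x - s) ^ (-α) * f1 s) volume a x) :
    |(∫ s in a..x, (x - s) ^ (-α) * ((f b - f a) / (b - a))) -
        ∫ s in a..x, (x - s) ^ (-α) * f1 s| ≤
      L * (b - a) ^ 2 * ∫ s in a..x, (x - s) ^ (-α) := by
  have hxa : a < x := by rw [hx]; nlinarith
  have hxb : x < b := by rw [hx]; nlinarith
  set c := (a + b) / 2 with hc
  have hcm : c ∈ Ioo a b := ⟨by rw [hc]; linarith, by rw [hc]; linarith⟩
  have hL0 : 0 ≤ L := (abs_nonneg _).trans (hL c hcm)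
  have hba : 0 < b - a := sub_pos.2 hab
  have hki := kernel_intervalIntegrable_sing (x := x) (a := a) hα1
  have hkm : IntervalIntegrable (fun s => (x - s) ^ (-α) * (s - c)) volume a x :=
    hki.mul_continuousOn (Continuous.continuousOn (by fun_prop))
  have hzero : ∫ s in a..x, (x - s) ^ (-α) * (s - c) = 0 :=
    kernel_moment_eq_zero hα0 hα1 hab hx
  have e : (∫ s in a..x, (x - s) ^ (-α) * ((f b - f a) / (b - a))) -
      ∫ s in a..x, (x - s) ^ (-α) * f1 s =
      ∫ s in a..x, (x - s) ^ (-α) * ((f b - f a) / (b - a) - f1 s + f2 c * (s - c)) := by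
    have h : ∀ s, (x - s) ^ (-α) * ((f b - f a) / (b - a) - f1 s + f2 c * (s - c)) =
      (x - s) ^ (-α) * ((f b - f a) / (b - a)) - (x - s) ^ (-α) * f1 s +
        f2 c * ((x - s) ^ (-α) * (s - c)) := fun s => by ring
    simp_rw [h]
    rw [intervalIntegral.integral_add ((hki.mul_const _).sub hf1) (hkm.const_mul _),
      intervalIntegral.integral_sub (hki.mul_const _) hf1, intervalIntegral.integral_const_mul,
      hzero, mul_zero, add_zero]
  rw [e, ← intervalIntegral.integral_const_mul]
  rw [← Real.norm_eq_abs]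
  refine intervalIntegral.norm_integral_le_of_norm_le hxa.le (Filter.Eventually.of_forall ?_)
    (hki.const_mul _)
  intro s hs
  have hk0 : 0 ≤ (x - s) ^ (-α) := rpow_nonneg (by linarith [hs.2]) _
  rw [norm_mul, Real.norm_eq_abs, Real.norm_eq_abs, abs_of_nonneg hk0, mul_comm]
  refine mul_le_mul_of_nonneg_right ?_ hk0
  have hsm : s ∈ Ioo a b := ⟨hs.1, by linarith [hs.2]⟩
  have t1 := taylor_first h2 h3 hL hcm hsm
  have ta := taylor_second hab hf h1 h2 h3 hL hcm (left_mem_Icc.2 hab.le)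
  have tb := taylor_second hab hf h1 h2 h3 hL hcm (right_mem_Icc.2 hab.le)
  have ea : |a - c| = (b - a) / 2 := by
    rw [abs_of_neg (by linarith [hcm.1]), hc]; ring
  have eb : |b - c| = (b - a) / 2 := by
    rw [abs_of_pos (by linarith [hcm.2]), hc]; ring
  have es : |s - c| ≤ (b - a) / 2 := by
    rw [abs_le]
    constructor <;> linarith [hsm.1, hsm.2]
  rw [ea] at ta
  rw [eb] at tb
  have t1' : |f1 s - f1 c - f2 c * (s - c)| ≤ L * ((b - a) / 2) ^ 2 :=
    t1.trans (by gcongr)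
  set Ra := f a - (f c + f1 c * (a - c) + f2 c / 2 * (a - c) ^ 2) with hRa
  set Rb := f b - (f c + f1 c * (b - c) + f2 c / 2 * (b - c) ^ 2) with hRb
  have key : (f b - f a) / (b - a) - f1 s + f2 c * (s - c) =
      (Rb - Ra) / (b - a) - (f1 s - f1 c - f2 c * (s - c)) := by
    rw [hRa, hRb, hc]; field_simp; ring
  have hR : |(Rb - Ra) / (b - a)| ≤ L * ((b - a) / 2) ^ 2 := by
    rw [abs_div, abs_of_pos hba, div_le_iff₀ hba]
    have := abs_sub Rb Ra
    nlinarith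
  rw [key]
  refine (abs_sub _ _).trans ?_
  nlinarith [mul_nonneg hL0 (sq_nonneg (b - a))]

theorem alikSum_sub_integral_le {t : ℕ → ℝ} {n : ℕ} (hα0 : 0 < α) (hα1 : α < 1)
    (ht : ∀ i ≤ n, t i < t (i + 1)) (hn : 1 ≤ n) (hf : ContinuousOn f (Icc (t 0) (t (n + 1))))
    (h1 : ∀ s ∈ Ioo (t 0) (t (n + 1)), HasDerivAt f (f1 s) s)
    (h2 : ∀ s ∈ Ioo (t 0) (t (n + 1)), HasDerivAt f1 (f2 s) s)
    (h3 : ∀ s ∈ Ioo (t 0) (t (n + 1)), HasDerivAt f2 (f3 s) s)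
    (hf1 : IntervalIntegrable f1 volume (t 0) (t 1)) {E : ℕ → ℝ} {L : ℝ}
    (hE : ∀ i < n, ∀ s ∈ Icc (t i) (t (i + 1)),
      |lagQuad (t i) (t (i + 1)) (t (i + 2)) (f (t i)) (f (t (i + 1))) (f (t (i + 2))) s - f s| ≤
        E i)
    (hL : ∀ s ∈ Ioo (t n) (t (n + 1)), |f3 s| ≤ L) :
    |alikSum α t (fun i => f (t i)) n -
        ∫ s in (t 0)..(tStar α t (n + 1)), (tStar α t (n + 1) - s) ^ (-α) * f1 s| ≤
      ∑ i ∈ Finset.range n, E i * ((tStar α t (n + 1) - t (i + 1)) ^ (-α) -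
        (tStar α t (n + 1) - t i) ^ (-α)) +
      L * (t (n + 1) - t n) ^ 2 * ((tStar α t (n + 1) - t n) ^ (1 - α) / (1 - α)) := by
  set x := tStar α t (n + 1) with hx
  have hxn : t n < x := tStar_gt hα1 (ht n le_rfl)
  have hxn' : x < t (n + 1) := tStar_lt hα0 (ht n le_rfl)
  have hn0 : t 0 < t n := mesh_lt ht (by omega) (by omega)
  have hf1c : ContinuousOn f1 (Ioo (t 0) (t (n + 1))) := fun s hs =>
    (h2 s hs).continuousAt.continuousWithinAt
  have hsub : ∀ i < n, ∀ s ∈ Icc (t i) (t (i + 1)), s ∈ Icc (t 0) (t (n + 1)) := fun i hi s hs =>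
    ⟨(mesh_le ht (Nat.zero_le i) (by omega)).trans hs.1,
      hs.2.trans (mesh_le ht (by omega) le_rfl)⟩
  have hsubo : ∀ i ≤ n, ∀ s ∈ Ioo (t i) (t (i + 1)), s ∈ Ioo (t 0) (t (n + 1)) := fun i hi s hs =>
    ⟨(mesh_le ht (Nat.zero_le i) (by omega)).trans_lt hs.1,
      hs.2.trans_le (mesh_le ht (by omega) le_rfl)⟩
  have hint1 : ∀ i < n, IntervalIntegrable f1 volume (t i) (t (i + 1)) := by
    intro i hi
    rcases Nat.eq_zero_or_pos i with rfl | hi0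
    · exact hf1
    · refine ContinuousOn.intervalIntegrable_of_Icc (ht i hi.le).le (hf1c.mono fun s hs => ?_)
      exact ⟨(mesh_lt ht hi0 (by omega)).trans_le hs.1,
        hs.2.trans_lt (mesh_lt ht (by omega) le_rfl)⟩
  have hbx : ∀ i < n, t (i + 1) < x := fun i hi =>
    lt_of_le_of_lt (mesh_le ht (by omega) (by omega)) hxn
  have hintk : ∀ i < n, IntervalIntegrable (fun s => (x - s) ^ (-α) * f1 s) volume (t i)
      (t (i + 1)) := by
    intro i hi
    refine (hint1 i hi).continuousOn_mul ?_
    rw [uIcc_of_le (ht i hi.le).le]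
    exact kernel_continuousOn (hbx i hi)
  have hintl : IntervalIntegrable (fun s => (x - s) ^ (-α) * f1 s) volume (t n) x := by
    refine (kernel_intervalIntegrable_sing hα1).mul_continuousOn ?_
    rw [uIcc_of_le hxn.le]
    exact hf1c.mono fun s hs => ⟨hn0.trans_le hs.1, hs.2.trans_lt hxn'⟩
  have hint0 : IntervalIntegrable (fun s => (x - s) ^ (-α) * f1 s) volume (t 0) (t n) :=
    IntervalIntegrable.trans_iterate hintk
  have hG : 0 < Real.Gamma (1 - α) := Real.Gamma_pos_of_pos (by linarith)
  have hop : alikSum α t (fun i => f (t i)) n =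
      (∑ i ∈ Finset.range n, ∫ s in (t i)..(t (i + 1)), (x - s) ^ (-α) *
        deriv (fun y => lagQuad (t i) (t (i + 1)) (t (i + 2)) (f (t i)) (f (t (i + 1)))
          (f (t (i + 2))) y) s) +
      ∫ s in (t n)..x, (x - s) ^ (-α) * ((f (t (n + 1)) - f (t n)) / (t (n + 1) - t n)) := by
    have h := deltaAlik_eq_sum hα1 ht (fun i => f (t i))
    rw [deltaAlik, sum_Icc_one_eq_sum_range] at h
    exact (mul_left_cancel₀ (one_div_pos.2 hG).ne' h).symm
  rw [hop, ← intervalIntegral.integral_add_adjacent_intervals hint0 hintl,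
    ← intervalIntegral.sum_integral_adjacent_intervals hintk, add_sub_add_comm,
    ← Finset.sum_sub_distrib]
  refine (abs_add_le _ _).trans (add_le_add ?_ ?_)
  · refine (Finset.abs_sum_le_sum_abs _ _).trans (Finset.sum_le_sum fun i hi => ?_)
    have hi := Finset.mem_range.1 hi
    have ha := ht i hi.le
    have hb : t (i + 1) < t (i + 2) := ht (i + 1) (by omega)
    have hder := lagQuad_hasDerivAt ha hb (f (t i)) (f (t (i + 1))) (f (t (i + 2)))
    simp_rw [fun s => (hder s).deriv]
    refine integral_kernel_mul_deriv_sub_le hα0 ha (hbx i hi) hder (by fun_prop)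
      (hf.mono (hsub i hi)) (fun s hs => h1 s (hsubo i hi.le s hs)) (hint1 i hi) ?_ ?_ (hE i hi)
    · rw [lagQuad_eq_newton ha hb]; ring
    · have := (sub_pos.2 ha).ne'
      rw [lagQuad_eq_newton ha hb]; field_simp; ring
  · rw [← kernel_integral hα1]
    refine integral_kernel_mul_slope_sub_le hα0 hα1 (ht n le_rfl) rfl
      (hf.mono fun s hs => ⟨hn0.le.trans hs.1, hs.2⟩) (fun s hs => h1 s (hsubo n le_rfl s hs))
      (fun s hs => h2 s (hsubo n le_rfl s hs)) (fun s hs => h3 s (hsubo n le_rfl s hs)) hL hintl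

end Truncation

namespace GradedMesh

variable {r Λ α : ℝ} {M : ℕ} {t : ℕ → ℝ}

theorem two_step_le (h : GradedMesh r Λ M t) {i : ℕ} (hi : i + 2 ≤ M) :
    t (i + 2) - t i ≤ (Λ + Λ ^ 2) * gradedStep r (t 1) (t (i + 1)) := by
  have h1 := h.step_le i (by omega)
  have h2 : t (i + 2) - t (i + 1) ≤ Λ * gradedStep r (t 1) (t (i + 2)) :=
    h.step_le (i + 1) (by omega)
  have h3 : gradedStep r (t 1) (t (i + 2)) ≤ Λ * gradedStep r (t 1) (t (i + 1)) :=
    h.gradedStep_succ_le (by omega) (by omega)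
  have h4 := mul_le_mul_of_nonneg_left h3 (zero_le_one.trans h.one_le)
  nlinarith

/-- Summation of local truncation errors of size `A h_j³ G(t_j)`. -/
theorem sum_truncation_le (h : GradedMesh r Λ M t) (hα0 : 0 < α) (hα1 : α < 1) {n : ℕ}
    (hnM : n < M) {G : ℝ → ℝ} {c : ℝ} (hc0 : 0 ≤ c) (hG0 : ∀ s, 0 < s → 0 ≤ G s)
    (hG : ∀ s y, 0 < s → s ≤ y → y ≤ 4 * s → G s ≤ c * G y) {A L : ℝ} (hA : 0 ≤ A)
    {E : ℕ → ℝ} (hE : ∀ i < n, E i ≤ A * (gradedStep r (t 1) (t (i + 1)) ^ 3 * G (t (i + 1))))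
    (hL : L ≤ A * G (t (n + 1))) :
    ∑ i ∈ Finset.range n, E i * ((tStar α t (n + 1) - t (i + 1)) ^ (-α) -
        (tStar α t (n + 1) - t i) ^ (-α)) +
      L * (t (n + 1) - t n) ^ 2 * ((tStar α t (n + 1) - t n) ^ (1 - α) / (1 - α)) ≤
    (c * (2 * Λ) ^ α + α * 4 ^ (α + 1) + Λ ^ (3 - α) / (1 - α)) * A *
      (gradedStep r (t 1) (t (n + 1)) ^ (3 - α) * G (t (n + 1)) + t (n + 1) ^ (-α - 1) *
        ∑ i ∈ Finset.range n,
          (t (i + 1) - t i) * (gradedStep r (t 1) (t (i + 1)) ^ 3 * G (t (i + 1)))) := by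
  have ht : ∀ i ≤ n, t i < t (i + 1) := fun i hi => h.lt_succ i (by omega)
  have hr := h.one_le_r
  have hΛ := h.one_le
  have hτ := h.tau_pos
  set x := tStar α t (n + 1) with hx
  have hxn : t n < x := tStar_gt hα1 (ht n le_rfl)
  have hxm : t (n + 1) / 2 ≤ x := h.tStar_ge hα1 hnM
  have htm : 0 < t (n + 1) := h.pos (by omega) hnM
  set T := t (n + 1) with hTdef
  set H := gradedStep r (t 1) T with hH
  have hH0 : 0 < H := gradedStep_pos hτ htm
  have hGT : 0 ≤ G T := hG0 T htm
  set g : ℕ → ℝ := fun i => gradedStep r (t 1) (t (i + 1)) ^ 3 * G (t (i + 1)) with hg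
  have hpos : ∀ i < n, 0 < t (i + 1) := fun i hi => h.pos (by omega) (by omega)
  have hg0 : ∀ i < n, 0 ≤ g i := fun i hi =>
    mul_nonneg (pow_nonneg (gradedStep_pos hτ (hpos i hi)).le 3) (hG0 _ (hpos i hi))
  set κ : ℕ → ℝ := fun i => (x - t (i + 1)) ^ (-α) - (x - t i) ^ (-α) with hκ
  have hbx : ∀ i < n, t (i + 1) < x := fun i hi =>
    lt_of_le_of_lt (mesh_le ht (by omega) (by omega)) hxn
  have hκ0 : ∀ i < n, 0 ≤ κ i := fun i hi =>
    sub_nonneg.2 (kernel_mono hα0 (ht i hi.le).le (hbx i hi))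
  have hterm : ∀ i < n, E i * κ i ≤ A * (c * (H ^ 3 * G T) * κ i +
      α * 4 ^ (α + 1) * T ^ (-α - 1) * ((t (i + 1) - t i) * g i)) := by
    intro i hi
    have hτi : 0 ≤ t (i + 1) - t i := (sub_pos.2 (ht i hi.le)).le
    have h1 : E i * κ i ≤ A * (g i * κ i) := by
      rw [← mul_assoc]; exact mul_le_mul_of_nonneg_right (hE i hi) (hκ0 i hi)
    refine h1.trans (mul_le_mul_of_nonneg_left ?_ hA)
    have hA1 : 0 ≤ c * (H ^ 3 * G T) * κ i :=
      mul_nonneg (mul_nonneg hc0 (mul_nonneg (by positivity) hGT)) (hκ0 i hi)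
    have hA2 : 0 ≤ α * 4 ^ (α + 1) * T ^ (-α - 1) * ((t (i + 1) - t i) * g i) :=
      mul_nonneg (by positivity) (mul_nonneg hτi (hg0 i hi))
    rcases le_total (t (i + 1)) (T / 4) with hf | hf
    · have h2 : κ i ≤ α * (x - t (i + 1)) ^ (-α - 1) * (t (i + 1) - t i) :=
        (kernel_slope hα0 (ht i hi.le).le (hbx i hi)).2
      have h3 : (x - t (i + 1)) ^ (-α - 1) ≤ 4 ^ (α + 1) * T ^ (-α - 1) := by
        calc (x - t (i + 1)) ^ (-α - 1) ≤ (T / 4) ^ (-α - 1) :=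
              rpow_le_rpow_of_nonpos (by positivity) (by linarith) (by linarith)
          _ = _ := by
              rw [div_rpow htm.le (by norm_num), show -α - 1 = -(α + 1) by ring,
                rpow_neg (by norm_num : (0:ℝ) ≤ 4)]
              field_simp
      have h4 : κ i ≤ α * (4 ^ (α + 1) * T ^ (-α - 1)) * (t (i + 1) - t i) :=
        h2.trans (by gcongr)
      have := mul_le_mul_of_nonneg_left h4 (hg0 i hi)
      linarith
    · have h2 : gradedStep r (t 1) (t (i + 1)) ≤ H :=
        gradedStep_mono hr hτ (hpos i hi) (h.le_of_le (by omega) hnM)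
      have h3 := hG (t (i + 1)) T (hpos i hi) (h.le_of_le (by omega) hnM) (by linarith)
      have h4 : g i ≤ H ^ 3 * (c * G T) :=
        mul_le_mul (pow_le_pow_left₀ (gradedStep_pos hτ (hpos i hi)).le h2 3) h3
          (hG0 _ (hpos i hi)) (by positivity)
      have := mul_le_mul_of_nonneg_right h4 (hκ0 i hi)
      linarith
  have hstepT : H ≤ Λ * (T - t n) := h.le_step n hnM
  have hstepT' : T - t n ≤ Λ * H := h.step_le n hnM
  have hxτ : x - t n = (1 - α / 2) * (T - t n) := tStar_sub t n
  have hτm : 0 < T - t n := sub_pos.2 (ht n le_rfl)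
  have hker : (x - t n) ^ (-α) ≤ (2 * Λ) ^ α * H ^ (-α) := by
    have h1 : H / (2 * Λ) ≤ x - t n := by
      rw [div_le_iff₀ (by linarith), hxτ]; nlinarith
    calc (x - t n) ^ (-α) ≤ (H / (2 * Λ)) ^ (-α) :=
          rpow_le_rpow_of_nonpos (by positivity) h1 (by linarith)
      _ = _ := by
          rw [div_rpow hH0.le (by linarith), rpow_neg (by linarith : 0 ≤ 2 * Λ)]
          field_simp
  have hsumκ : ∑ i ∈ Finset.range n, κ i ≤ (2 * Λ) ^ α * H ^ (-α) := by
    have h1 : ∑ i ∈ Finset.range n, κ i = (x - t n) ^ (-α) - (x - t 0) ^ (-α) :=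
      Finset.sum_range_sub (fun i => (x - t i) ^ (-α)) n
    have h2 : 0 ≤ (x - t 0) ^ (-α) := by
      refine rpow_nonneg ?_ _
      rw [h.zero]; linarith
    linarith
  have hHH : H ^ 3 * H ^ (-α) = H ^ (3 - α) := by
    rw [← rpow_natCast, ← rpow_add hH0]; norm_num; ring_nf
  set S := ∑ i ∈ Finset.range n, (t (i + 1) - t i) * g i with hS
  have hS0 : 0 ≤ S := Finset.sum_nonneg fun i hi =>
    mul_nonneg (sub_pos.2 (ht i (Finset.mem_range.1 hi).le)).le (hg0 i (Finset.mem_range.1 hi))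
  have hpart1 : ∑ i ∈ Finset.range n, E i * κ i ≤ A * (c * (2 * Λ) ^ α * (H ^ (3 - α) * G T) +
      α * 4 ^ (α + 1) * (T ^ (-α - 1) * S)) := by
    refine (Finset.sum_le_sum fun i hi => hterm i (Finset.mem_range.1 hi)).trans ?_
    rw [← Finset.mul_sum, Finset.sum_add_distrib, ← Finset.mul_sum, ← Finset.mul_sum]
    refine mul_le_mul_of_nonneg_left (add_le_add ?_ (le_of_eq (by ring))) hA
    calc c * (H ^ 3 * G T) * ∑ i ∈ Finset.range n, κ i
        ≤ c * (H ^ 3 * G T) * ((2 * Λ) ^ α * H ^ (-α)) :=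
          mul_le_mul_of_nonneg_left hsumκ (mul_nonneg hc0 (mul_nonneg (by positivity) hGT))
      _ = _ := by rw [← hHH]; ring
  have hpart2 : L * (T - t n) ^ 2 * ((x - t n) ^ (1 - α) / (1 - α)) ≤
      A * (Λ ^ (3 - α) / (1 - α) * (H ^ (3 - α) * G T)) := by
    have h1 : (x - t n) ^ (1 - α) ≤ (Λ * H) ^ (1 - α) := by
      refine rpow_le_rpow (by linarith) ?_ (by linarith)
      rw [hxτ]; nlinarith
    have h2 : (Λ * H) ^ 2 * (Λ * H) ^ (1 - α) = Λ ^ (3 - α) * H ^ (3 - α) := by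
      rw [← mul_rpow (by linarith) hH0.le, ← rpow_natCast, ← rpow_add (by positivity)]
      norm_num; ring_nf
    have h1α : 0 < 1 - α := by linarith
    have h0 : 0 ≤ (x - t n) ^ (1 - α) := rpow_nonneg (by linarith) _
    calc L * (T - t n) ^ 2 * ((x - t n) ^ (1 - α) / (1 - α))
        ≤ A * G T * (Λ * H) ^ 2 * ((Λ * H) ^ (1 - α) / (1 - α)) := by
          gcongr
      _ = A * G T / (1 - α) * ((Λ * H) ^ 2 * (Λ * H) ^ (1 - α)) := by ring
      _ = _ := by rw [h2]; ring
  have q1 : 0 ≤ H ^ (3 - α) * G T := by positivity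
  have q2 : 0 ≤ T ^ (-α - 1) * S := by positivity
  have q3 : 0 ≤ c * (2 * Λ) ^ α := by positivity
  have q4 : 0 ≤ Λ ^ (3 - α) / (1 - α) := div_nonneg (by positivity) (by linarith)
  have q5 : 0 ≤ α * 4 ^ (α + 1) := by positivity
  refine (add_le_add hpart1 hpart2).trans ?_
  rw [← mul_add, mul_comm _ A, mul_assoc A]
  refine mul_le_mul_of_nonneg_left ?_ hA
  nlinarith [mul_nonneg q3 q2, mul_nonneg q4 q2, mul_nonneg q5 q1]

end GradedMesh

/-! ### The barrier functions -/

/-- The barrier `s (s + σ)^{α-2}`, in a form convenient for differentiation. -/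
noncomputable def barrier (α σ s : ℝ) : ℝ := (s + σ) ^ (α - 1) - σ * (s + σ) ^ (α - 2)

/-- The derivative of `barrier`. -/
noncomputable def barrierDeriv (α σ s : ℝ) : ℝ :=
  (α - 1) * (s + σ) ^ (α - 2) - σ * ((α - 2) * (s + σ) ^ (α - 3))

theorem barrier_eq {α σ s : ℝ} (hs : 0 < s + σ) : barrier α σ s = s * (s + σ) ^ (α - 2) := by
  rw [barrier, show α - 1 = (α - 2) + 1 by ring, rpow_add hs, rpow_one]
  ring

theorem barrier_nonneg {α σ s : ℝ} (hσ : 0 < σ) (hs : 0 ≤ s) : 0 ≤ barrier α σ s := by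
  rw [barrier_eq (by linarith)]
  positivity

theorem shifted_rpow_hasDerivAt {σ s : ℝ} (p : ℝ) (hs : 0 < s + σ) :
    HasDerivAt (fun y => (y + σ) ^ p) (p * (s + σ) ^ (p - 1)) s := by
  have h := ((hasDerivAt_id s).add_const σ).rpow_const (p := p) (Or.inl hs.ne')
  exact h.congr_deriv (by simp)

theorem barrier_hasDerivAt {α σ s : ℝ} (hs : 0 < s + σ) :
    HasDerivAt (barrier α σ) (barrierDeriv α σ s) s := by
  have h := (shifted_rpow_hasDerivAt (α - 1) hs).sub
    ((shifted_rpow_hasDerivAt (α - 2) hs).const_mul σ)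
  refine h.congr_deriv ?_
  rw [barrierDeriv]; ring_nf

theorem barrierDeriv_hasDerivAt {α σ s : ℝ} (hs : 0 < s + σ) :
    HasDerivAt (barrierDeriv α σ) ((α - 1) * ((α - 2) * (s + σ) ^ (α - 3)) -
      σ * ((α - 2) * ((α - 3) * (s + σ) ^ (α - 4)))) s := by
  have h := ((shifted_rpow_hasDerivAt (α - 2) hs).const_mul (α - 1)).sub
    (((shifted_rpow_hasDerivAt (α - 3) hs).const_mul (α - 2)).const_mul σ)
  refine h.congr_deriv ?_
  ring_nf

theorem barrierDeriv_hasDerivAt_two {α σ s : ℝ} (hs : 0 < s + σ) :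
    HasDerivAt (fun s => (α - 1) * ((α - 2) * (s + σ) ^ (α - 3)) -
      σ * ((α - 2) * ((α - 3) * (s + σ) ^ (α - 4))))
      ((α - 1) * ((α - 2) * ((α - 3) * (s + σ) ^ (α - 4))) -
      σ * ((α - 2) * ((α - 3) * ((α - 4) * (s + σ) ^ (α - 5))))) s := by
  have h := (((shifted_rpow_hasDerivAt (α - 3) hs).const_mul (α - 2)).const_mul (α - 1)).sub
    ((((shifted_rpow_hasDerivAt (α - 4) hs).const_mul (α - 3)).const_mul (α - 2)).const_mul σ)
  refine h.congr_deriv ?_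
  ring_nf

theorem abs_barrier_third_le {α σ s : ℝ} (hα0 : 0 < α) (hα1 : α < 1) (hσ : 0 < σ) (hs : 0 ≤ s) :
    |(α - 1) * ((α - 2) * ((α - 3) * (s + σ) ^ (α - 4))) -
      σ * ((α - 2) * ((α - 3) * ((α - 4) * (s + σ) ^ (α - 5))))| ≤ 30 * (s + σ) ^ (α - 4) := by
  have h0 : 0 < s + σ := by linarith
  have h1 : (s + σ) ^ (α - 4) = (s + σ) ^ (α - 5) * (s + σ) := by
    rw [show α - 4 = (α - 5) + 1 by ring, rpow_add h0, rpow_one]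
  have hP : 0 < (s + σ) ^ (α - 5) := rpow_pos_of_pos h0 _
  rw [h1]
  set P := (s + σ) ^ (α - 5)
  have e : (α - 1) * ((α - 2) * ((α - 3) * (P * (s + σ)))) -
      σ * ((α - 2) * ((α - 3) * ((α - 4) * P))) =
      P * (σ * ((2 - α) * (3 - α) * (4 - α)) - (s + σ) * ((1 - α) * ((2 - α) * (3 - α)))) := by
    ring
  have b1 : (2 - α) * (3 - α) ≤ 6 := by nlinarith
  have b1' : 0 ≤ (2 - α) * (3 - α) := by nlinarith
  have b2 : (2 - α) * (3 - α) * (4 - α) ≤ 24 := by nlinarith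
  have b2' : 0 ≤ (2 - α) * (3 - α) * (4 - α) := by nlinarith
  have b3 : (1 - α) * ((2 - α) * (3 - α)) ≤ 6 := by nlinarith
  have b3' : 0 ≤ (1 - α) * ((2 - α) * (3 - α)) := by nlinarith
  have c1 := mul_le_mul_of_nonneg_left b2 hσ.le
  have c1' := mul_nonneg hσ.le b2'
  have c2 := mul_le_mul_of_nonneg_left b3 h0.le
  have c2' := mul_nonneg h0.le b3'
  rw [e, abs_mul, abs_of_pos hP, show 30 * (P * (s + σ)) = P * (30 * (s + σ)) by ring]
  refine mul_le_mul_of_nonneg_left ?_ hP.le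
  rw [abs_le]
  constructor <;> linarith

/-- The (unnormalised) Caputo derivative of the barrier. -/
theorem integral_kernel_barrierDeriv {α σ t : ℝ} (hα1 : α < 1) (hσ : 0 < σ) (ht : 0 < t) :
    ∫ s in (0:ℝ)..t, (t - s) ^ (-α) * barrierDeriv α σ s =
      σ ^ α * t ^ (1 - α) / ((1 - α) * (t + σ) ^ 2) := by
  have hα : 0 < 1 - α := by linarith
  have htσ : 0 < t + σ := by linarith
  set F : ℝ → ℝ := fun s => -(((t - s) / (s + σ)) ^ (1 - α) *
    (-(t + σ) + (2 - α) * σ / (1 - α) + σ * ((t - s) / (s + σ))) / (t + σ) ^ 2) with hF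
  have hx : ContinuousOn (fun s : ℝ => (t - s) / (s + σ)) (Icc 0 t) := by
    refine ContinuousOn.div (by fun_prop) (by fun_prop) fun s hs => ?_
    have := hs.1; linarith
  have hcont : ContinuousOn F (Icc 0 t) := by
    refine ((ContinuousOn.mul (hx.rpow_const fun _ _ => Or.inr hα.le) ?_).div_const _).neg
    exact continuousOn_const.add (continuousOn_const.mul hx)
  have hder : ∀ s ∈ Ioo 0 t, HasDerivAt F ((t - s) ^ (-α) * barrierDeriv α σ s) s := by
    intro s hs
    have h0 : 0 < s + σ := by linarith [hs.1]
    have hts : 0 < t - s := by linarith [hs.2]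
    have hX : 0 < (t - s) / (s + σ) := div_pos hts h0
    have d1 : HasDerivAt (fun s : ℝ => (t - s) / (s + σ)) (-(t + σ) / (s + σ) ^ 2) s := by
      have := ((hasDerivAt_id s).const_sub t).div ((hasDerivAt_id s).add_const σ) h0.ne'
      refine this.congr_deriv ?_
      simp only [id]
      congr 1
      ring
    have d2 := d1.rpow_const (p := 1 - α) (Or.inl hX.ne')
    have d3 := (d1.const_mul σ).const_add (-(t + σ) + (2 - α) * σ / (1 - α))
    have d4 := ((d2.mul d3).div_const ((t + σ) ^ 2)).neg
    refine d4.congr_deriv ?_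
    have e1 : ((t - s) / (s + σ)) ^ (1 - α) = ((t - s) / (s + σ)) ^ (-α) * ((t - s) / (s + σ)) := by
      rw [show 1 - α = -α + 1 by ring, rpow_add hX, rpow_one]
    have e2 : ((t - s) / (s + σ)) ^ (1 - α - 1) = ((t - s) / (s + σ)) ^ (-α) := by
      congr 1; ring
    have e3 : (t - s) ^ (-α) = ((t - s) / (s + σ)) ^ (-α) * (s + σ) ^ (-α) := by
      rw [← mul_rpow hX.le h0.le, div_mul_cancel₀ _ h0.ne']
    have e4 : (s + σ) ^ (α - 2) = (s + σ) ^ α * ((s + σ) ^ 2)⁻¹ := by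
      rw [rpow_sub h0]; norm_num [div_eq_mul_inv]
    have e5 : (s + σ) ^ (α - 3) = (s + σ) ^ α * ((s + σ) ^ 3)⁻¹ := by
      rw [rpow_sub h0]
      have : (s + σ) ^ (3:ℝ) = (s + σ) ^ 3 := by exact_mod_cast rpow_natCast (s + σ) 3
      rw [this, div_eq_mul_inv]
    have e6 : (s + σ) ^ (-α) = ((s + σ) ^ α)⁻¹ := rpow_neg h0.le α
    rw [barrierDeriv, e1, e2, e3, e4, e5, e6]
    have hp : (s + σ) ^ α ≠ 0 := (rpow_pos_of_pos h0 α).ne'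
    generalize ((t - s) / (s + σ)) ^ (-α) = Y
    generalize (s + σ) ^ α = Z at hp
    field_simp
    ring
  have hint : IntervalIntegrable (fun s => (t - s) ^ (-α) * barrierDeriv α σ s) volume 0 t := by
    refine (kernel_intervalIntegrable_sing hα1).mul_continuousOn ?_
    rw [uIcc_of_le ht.le]
    intro s hs
    exact (barrierDeriv_hasDerivAt (by linarith [hs.1])).continuousAt.continuousWithinAt
  rw [intervalIntegral.integral_eq_sub_of_hasDerivAt_of_le ht.le hcont hder hint, hF]
  have e1 : (t / σ) ^ (1 - α) * σ = σ ^ α * t ^ (1 - α) := by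
    rw [div_rpow ht.le hσ.le, rpow_sub hσ, rpow_one]
    field_simp
  simp only [sub_self, zero_div, zero_rpow hα.ne', zero_mul, neg_zero, sub_zero, zero_add, zero_sub,
    neg_neg]
  rw [← e1]
  field_simp
  ring

namespace GradedMesh

variable {r Λ α : ℝ} {M : ℕ} {t : ℕ → ℝ}

theorem succ_add_le (h : GradedMesh r Λ M t) {σ : ℝ} (hσ : t 1 ≤ σ) {i : ℕ} (hi : i < M) :
    t (i + 1) + σ ≤ 2 * Λ * (t i + σ) := by
  have hΛ := h.one_le
  have hτ := h.tau_pos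
  rcases Nat.eq_zero_or_pos i with rfl | hi1
  · rw [h.zero, zero_add, zero_add]
    nlinarith
  · have h1 := h.succ_le i hi1 hi
    have h2 := h.pos hi1 hi.le
    nlinarith

/-- Consistency of the Alikhanov operator on a barrier, in the form of the abstract
truncation estimate. -/
theorem barrier_truncation_le (h : GradedMesh r Λ M t) (hα0 : 0 < α) (hα1 : α < 1) {n : ℕ}
    (hn : 1 ≤ n) (hnM : n < M) {σ : ℝ} (hσ : t 1 ≤ σ) :
    |alikSum α t (fun i => barrier α σ (t i)) n - σ ^ α * tStar α t (n + 1) ^ (1 - α) /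
        ((1 - α) * (tStar α t (n + 1) + σ) ^ 2)| ≤
    (4 ^ (4 - α) * (2 * Λ) ^ α + α * 4 ^ (α + 1) + Λ ^ (3 - α) / (1 - α)) *
      (90 * (2 * Λ) ^ (4 - α) * (Λ + Λ ^ 2) ^ 3) *
      (gradedStep r (t 1) (t (n + 1)) ^ (3 - α) * (t (n + 1) + σ) ^ (α - 4) +
        t (n + 1) ^ (-α - 1) * ∑ i ∈ Finset.range n,
          (t (i + 1) - t i) * (gradedStep r (t 1) (t (i + 1)) ^ 3 *
            (t (i + 1) + σ) ^ (α - 4))) := by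
  have hΛ := h.one_le
  have hτ := h.tau_pos
  have hσ0 : 0 < σ := hτ.trans_le hσ
  have ht : ∀ i ≤ n, t i < t (i + 1) := fun i hi => h.lt_succ i (by omega)
  have hx : 0 < tStar α t (n + 1) :=
    (h.nonneg hnM.le).trans_lt (tStar_gt hα1 (ht n le_rfl))
  have hA : 0 ≤ 90 * (2 * Λ) ^ (4 - α) * (Λ + Λ ^ 2) ^ 3 := by positivity
  have hshift : ∀ i < M, ∀ s, t i ≤ s → (s + σ) ^ (α - 4) ≤
      (2 * Λ) ^ (4 - α) * (t (i + 1) + σ) ^ (α - 4) := by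
    intro i hi s hs
    have h0 : 0 ≤ t i := h.nonneg hi.le
    have h1 := h.succ_add_le hσ hi
    have h2 : 0 ≤ t (i + 1) := h.nonneg hi
    calc (s + σ) ^ (α - 4) ≤ ((t (i + 1) + σ) / (2 * Λ)) ^ (α - 4) := by
          refine rpow_le_rpow_of_nonpos (by positivity) ?_ (by linarith)
          rw [div_le_iff₀ (by positivity)]
          nlinarith
      _ = _ := by
          rw [div_rpow (by positivity) (by positivity), show α - 4 = -(4 - α) by ring,
            rpow_neg (by positivity : (0:ℝ) ≤ 2 * Λ)]
          field_simp
  rw [← integral_kernel_barrierDeriv hα1 hσ0 hx]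
  have hI := alikSum_sub_integral_le (f := barrier α σ) (f1 := barrierDeriv α σ) (t := t) hα0 hα1
    ht hn (f2 := fun s => (α - 1) * ((α - 2) * (s + σ) ^ (α - 3)) -
      σ * ((α - 2) * ((α - 3) * (s + σ) ^ (α - 4))))
    (f3 := fun s => (α - 1) * ((α - 2) * ((α - 3) * (s + σ) ^ (α - 4))) -
      σ * ((α - 2) * ((α - 3) * ((α - 4) * (s + σ) ^ (α - 5)))))
    (E := fun i => 90 * (2 * Λ) ^ (4 - α) * (Λ + Λ ^ 2) ^ 3 *
      (gradedStep r (t 1) (t (i + 1)) ^ 3 * (t (i + 1) + σ) ^ (α - 4)))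
    (L := 90 * (2 * Λ) ^ (4 - α) * (Λ + Λ ^ 2) ^ 3 * (t (n + 1) + σ) ^ (α - 4))
    ?_ ?_ ?_ ?_ ?_ ?_ ?_
  · rw [h.zero] at hI
    refine hI.trans ?_
    refine h.sum_truncation_le hα0 hα1 hnM (G := fun s => (s + σ) ^ (α - 4)) (by positivity)
      (fun s hs => by positivity) ?_ hA (fun i hi => le_rfl) le_rfl
    intro s y hs hsy hy
    calc (s + σ) ^ (α - 4) ≤ ((y + σ) / 4) ^ (α - 4) :=
          rpow_le_rpow_of_nonpos (by linarith) (by linarith) (by linarith)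
      _ = _ := by
          rw [div_rpow (by linarith) (by positivity), show α - 4 = -(4 - α) by ring,
            rpow_neg (by positivity : (0:ℝ) ≤ 4)]
          field_simp
  · intro s hs
    have := hs.1
    rw [h.zero] at this
    exact (barrier_hasDerivAt (by linarith)).continuousAt.continuousWithinAt
  · intro s hs
    have := hs.1
    rw [h.zero] at this
    exact barrier_hasDerivAt (by linarith)
  · intro s hs
    have := hs.1
    rw [h.zero] at this
    exact barrierDeriv_hasDerivAt (by linarith)
  · intro s hs
    have := hs.1
    rw [h.zero] at this
    exact barrierDeriv_hasDerivAt_two (by linarith)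
  · refine ContinuousOn.intervalIntegrable_of_Icc (ht 0 (by omega)).le fun s hs => ?_
    have := hs.1
    rw [h.zero] at this
    exact (barrierDeriv_hasDerivAt (by linarith)).continuousAt.continuousWithinAt
  · intro i hi s hs
    have h0 : 0 ≤ t i := h.nonneg (by omega)
    have hq := lagQuad_sub_le (f := barrier α σ) (f1 := barrierDeriv α σ)
      (f2 := fun s => (α - 1) * ((α - 2) * (s + σ) ^ (α - 3)) -
        σ * ((α - 2) * ((α - 3) * (s + σ) ^ (α - 4))))
      (f3 := fun s => (α - 1) * ((α - 2) * ((α - 3) * (s + σ) ^ (α - 4))) -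
        σ * ((α - 2) * ((α - 3) * ((α - 4) * (s + σ) ^ (α - 5)))))
      (L := 30 * ((2 * Λ) ^ (4 - α) * (t (i + 1) + σ) ^ (α - 4)))
      (ht i hi.le) (ht (i + 1) hi)
      (fun s hs => (barrier_hasDerivAt
        (by linarith [hs.1])).continuousAt.continuousWithinAt)
      (fun s hs => barrier_hasDerivAt (by linarith [hs.1]))
      (fun s hs => barrierDeriv_hasDerivAt (by linarith [hs.1]))
      (fun s hs => barrierDeriv_hasDerivAt_two (by linarith [hs.1]))
      (fun s hs => (abs_barrier_third_le hα0 hα1 hσ0 (h0.trans hs.1.le)).trans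
        (mul_le_mul_of_nonneg_left (hshift i (by omega) s hs.1.le) (by norm_num))) hs
    refine hq.trans ?_
    have h1 := h.two_step_le (i := i) (by omega)
    have h2 : 0 ≤ t (i + 2) - t i := by
      have := ht i hi.le
      have := ht (i + 1) hi
      show 0 ≤ t (i + 1 + 1) - t i
      linarith
    have h3 := pow_le_pow_left₀ h2 h1 3
    have h4 : 0 ≤ t (i + 1) := h.nonneg (by omega)
    calc 3 * (30 * ((2 * Λ) ^ (4 - α) * (t (i + 1) + σ) ^ (α - 4))) * (t (i + 2) - t i) ^ 3
        ≤ 3 * (30 * ((2 * Λ) ^ (4 - α) * (t (i + 1) + σ) ^ (α - 4))) *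
          ((Λ + Λ ^ 2) * gradedStep r (t 1) (t (i + 1))) ^ 3 := by gcongr
      _ = _ := by rw [mul_pow]; ring
  · intro s hs
    have h0 : 0 ≤ t n := h.nonneg (by omega)
    refine (abs_barrier_third_le hα0 hα1 hσ0 (h0.trans hs.1.le)).trans
      ((mul_le_mul_of_nonneg_left (hshift n hnM s hs.1.le) (by norm_num)).trans ?_)
    have h4 : 0 ≤ t (n + 1) := h.nonneg (by omega)
    have h5 : (1:ℝ) ≤ (Λ + Λ ^ 2) ^ 3 := one_le_pow₀ (by nlinarith)
    have h6 : 0 ≤ (2 * Λ) ^ (4 - α) * (t (n + 1) + σ) ^ (α - 4) := by positivity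
    nlinarith

end GradedMesh

namespace GradedMesh

variable {r Λ α : ℝ} {M : ℕ} {t : ℕ → ℝ}

theorem barrier_bracket_le (h : GradedMesh r Λ M t) (hα1 : α < 1) {n : ℕ}
    (hnM : n < M) {σ e b : ℝ} (hσ : t 1 ≤ σ) (he : -1 ≤ e) (heα : e < α) (heb : e ≤ b)
    (hb1 : b ≤ 1) (hbr : b ≤ (3 - α) / r) (hα0 : 0 < α) :
    gradedStep r (t 1) (t (n + 1)) ^ (3 - α) * (t (n + 1) + σ) ^ (α - 4) +
        t (n + 1) ^ (-α - 1) * ∑ i ∈ Finset.range n,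
          (t (i + 1) - t i) * (gradedStep r (t 1) (t (i + 1)) ^ 3 *
            (t (i + 1) + σ) ^ (α - 4)) ≤
      (1 + max 1 (1 / (α - e))) *
        (t 1 ^ b * σ ^ (e - b) * t (n + 1) ^ (1 - α) * (t (n + 1) + σ) ^ (α - e - 2)) := by
  have hτ := h.tau_pos
  have hr := h.one_le_r
  have hσ0 : 0 < σ := hτ.trans_le hσ
  have hT : 0 < t (n + 1) := h.pos (by omega) hnM
  have hδ : 0 < α - e := by linarith
  have key : ∀ s, 0 < s → s ^ (2 - b) * (s + σ) ^ (α - 4) ≤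
      σ ^ (e - b) * (s + σ) ^ (α - e - 2) := by
    intro s hs
    have hsσ : 0 < s + σ := by linarith
    calc s ^ (2 - b) * (s + σ) ^ (α - 4)
        = s ^ (2 - b) * ((s + σ) ^ (b - 2) * (s + σ) ^ (e - b) * (s + σ) ^ (α - e - 2)) := by
          rw [← rpow_add hsσ, ← rpow_add hsσ]; ring_nf
      _ ≤ (s + σ) ^ (2 - b) * ((s + σ) ^ (b - 2) * σ ^ (e - b) * (s + σ) ^ (α - e - 2)) := by
          have h1 : s ^ (2 - b) ≤ (s + σ) ^ (2 - b) :=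
            rpow_le_rpow hs.le (by linarith) (by linarith)
          have h2 : (s + σ) ^ (e - b) ≤ σ ^ (e - b) :=
            rpow_le_rpow_of_nonpos hσ0 (by linarith) (by linarith)
          gcongr
      _ = ((s + σ) ^ (2 - b) * (s + σ) ^ (b - 2)) *
            (σ ^ (e - b) * (s + σ) ^ (α - e - 2)) := by ring
      _ = _ := by rw [← rpow_add hsσ]; norm_num
  set Q := t 1 ^ b * σ ^ (e - b) * t (n + 1) ^ (1 - α) * (t (n + 1) + σ) ^ (α - e - 2) with hQ
  have hfirst : gradedStep r (t 1) (t (n + 1)) ^ (3 - α) * (t (n + 1) + σ) ^ (α - 4) ≤ Q := by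
    have h1 := gradedStep_rpow_le (r := r) (a := 3 - α) hτ (h.tau_le (by omega) hnM) hbr
    have hTσ : 0 < t (n + 1) + σ := by linarith
    calc gradedStep r (t 1) (t (n + 1)) ^ (3 - α) * (t (n + 1) + σ) ^ (α - 4)
        ≤ t 1 ^ b * t (n + 1) ^ (3 - α - b) * (t (n + 1) + σ) ^ (α - 4) := by gcongr
      _ = t 1 ^ b * t (n + 1) ^ (1 - α) * (t (n + 1) ^ (2 - b) * (t (n + 1) + σ) ^ (α - 4)) := by
          rw [show 3 - α - b = (1 - α) + (2 - b) by ring, rpow_add hT]; ring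
      _ ≤ t 1 ^ b * t (n + 1) ^ (1 - α) * (σ ^ (e - b) * (t (n + 1) + σ) ^ (α - e - 2)) := by
          have := key _ hT
          gcongr
      _ = Q := by rw [hQ]; ring
  have hterm : ∀ i < n, (t (i + 1) - t i) * (gradedStep r (t 1) (t (i + 1)) ^ 3 *
      (t (i + 1) + σ) ^ (α - 4)) ≤ t 1 ^ b * σ ^ (e - b) *
        (t (n + 1) ^ (2 - (α - e)) * (t (n + 1) + σ) ^ (α - e - 2)) *
        ((t (i + 1) - t i) * t (i + 1) ^ (α - e - 1)) := by
    intro i hi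
    have hs : 0 < t (i + 1) := h.pos (by omega) (by omega)
    have hd : 0 ≤ t (i + 1) - t i := (sub_pos.2 (h.lt_succ i (by omega))).le
    have hsT : t (i + 1) ≤ t (n + 1) := h.le_of_le (by omega) hnM
    have hsσ : 0 < t (i + 1) + σ := by linarith
    have hTσ : 0 < t (n + 1) + σ := by linarith
    have h1 : gradedStep r (t 1) (t (i + 1)) ^ 3 ≤ t 1 ^ b * t (i + 1) ^ (3 - b) := by
      have := gradedStep_rpow_le (r := r) (a := 3) (p := b) hτ (h.tau_le (i := i + 1) (by omega)
        (by omega)) (hbr.trans (by gcongr; linarith))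
      have e : gradedStep r (t 1) (t (i + 1)) ^ (3:ℝ) = gradedStep r (t 1) (t (i + 1)) ^ 3 := by
        exact_mod_cast rpow_natCast (gradedStep r (t 1) (t (i + 1))) 3
      rwa [e] at this
    have h2 : t (i + 1) ^ (2 - (α - e)) * (t (i + 1) + σ) ^ (α - e - 2) ≤
        t (n + 1) ^ (2 - (α - e)) * (t (n + 1) + σ) ^ (α - e - 2) := by
      rw [show α - e - 2 = -(2 - (α - e)) by ring, rpow_neg hsσ.le, rpow_neg hTσ.le,
        ← div_eq_mul_inv, ← div_eq_mul_inv, ← div_rpow hs.le hsσ.le, ← div_rpow hT.le hTσ.le]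
      refine rpow_le_rpow (by positivity) ?_ (by linarith)
      rw [div_le_div_iff₀ hsσ hTσ]
      nlinarith
    calc (t (i + 1) - t i) * (gradedStep r (t 1) (t (i + 1)) ^ 3 * (t (i + 1) + σ) ^ (α - 4))
        ≤ (t (i + 1) - t i) * (t 1 ^ b * t (i + 1) ^ (3 - b) * (t (i + 1) + σ) ^ (α - 4)) := by
          gcongr
      _ = (t (i + 1) - t i) * (t 1 ^ b * t (i + 1) *
            (t (i + 1) ^ (2 - b) * (t (i + 1) + σ) ^ (α - 4))) := by
          rw [show 3 - b = 1 + (2 - b) by ring, rpow_add hs, rpow_one]; ring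
      _ ≤ (t (i + 1) - t i) * (t 1 ^ b * t (i + 1) *
            (σ ^ (e - b) * (t (i + 1) + σ) ^ (α - e - 2))) := by
          have := key _ hs
          gcongr
      _ = t 1 ^ b * σ ^ (e - b) *
            (t (i + 1) ^ (2 - (α - e)) * (t (i + 1) + σ) ^ (α - e - 2)) *
            ((t (i + 1) - t i) * t (i + 1) ^ (α - e - 1)) := by
          have : t (i + 1) ^ (2 - (α - e)) * t (i + 1) ^ (α - e - 1) = t (i + 1) := by
            rw [← rpow_add hs]; norm_num
          linear_combination (-(t (i + 1) - t i) * t 1 ^ b * σ ^ (e - b) *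
            (t (i + 1) + σ) ^ (α - e - 2)) * this
      _ ≤ _ := by gcongr
  have hsum : t (n + 1) ^ (-α - 1) * ∑ i ∈ Finset.range n, (t (i + 1) - t i) *
      (gradedStep r (t 1) (t (i + 1)) ^ 3 * (t (i + 1) + σ) ^ (α - 4)) ≤
      max 1 (1 / (α - e)) * Q := by
    have h1 := Finset.sum_le_sum fun i hi => hterm i (Finset.mem_range.1 hi)
    rw [← Finset.mul_sum] at h1
    have h2 := h.sum_step_mul_rpow_le hδ (n := n) hnM.le
    have h3 : t n ^ (α - e) ≤ t (n + 1) ^ (α - e) :=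
      rpow_le_rpow (h.nonneg hnM.le) (h.le_of_le (by omega) hnM) hδ.le
    have hTσ : 0 < t (n + 1) + σ := by linarith
    have hm : 0 ≤ max 1 (1 / (α - e)) := zero_le_one.trans (le_max_left _ _)
    calc _ ≤ t (n + 1) ^ (-α - 1) * (t 1 ^ b * σ ^ (e - b) *
            (t (n + 1) ^ (2 - (α - e)) * (t (n + 1) + σ) ^ (α - e - 2)) *
            (max 1 (1 / (α - e)) * t (n + 1) ^ (α - e))) := by
          refine mul_le_mul_of_nonneg_left (h1.trans ?_) (by positivity)
          refine mul_le_mul_of_nonneg_left (h2.trans ?_) (by positivity)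
          exact mul_le_mul_of_nonneg_left h3 hm
      _ = max 1 (1 / (α - e)) * (t 1 ^ b * σ ^ (e - b) *
            (t (n + 1) ^ (-α - 1) * t (n + 1) ^ (2 - (α - e)) * t (n + 1) ^ (α - e)) *
            (t (n + 1) + σ) ^ (α - e - 2)) := by ring
      _ = max 1 (1 / (α - e)) * Q := by
          rw [← rpow_add hT, ← rpow_add hT, hQ]; ring_nf
  linarith

end GradedMesh

/-! ### Dyadic sums -/

theorem dyadic_term_le {p q s σ t : ℝ} (hs : 0 < s) (hsp : s ≤ p) (hsq : s ≤ q) (hσ : 0 < σ)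
    (ht : 0 < t) :
    σ ^ p * (t + σ) ^ (-p - q) ≤ 4 * 2 ^ s / (2 ^ s - 1) * t ^ (-q) *
      ((2 * σ) ^ s / (t ^ s + (2 * σ) ^ s) - σ ^ s / (t ^ s + σ ^ s)) := by
  have hσt : 0 < t + σ := by linarith
  have hl : (1:ℝ) < 2 ^ s := one_lt_rpow (by norm_num) hs
  have ha : 0 < σ ^ s := rpow_pos_of_pos hσ s
  have hb : 0 < t ^ s := rpow_pos_of_pos ht s
  have h1 : σ ^ p * (t + σ) ^ (-p - q) ≤
      t ^ (-q) * ((σ / (t + σ)) ^ s * (t / (t + σ)) ^ s) := by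
    calc σ ^ p * (t + σ) ^ (-p - q) = t ^ (-q) * ((σ / (t + σ)) ^ p * (t / (t + σ)) ^ q) := by
          rw [div_rpow hσ.le hσt.le, div_rpow ht.le hσt.le, show -p - q = -(p + q) by ring,
            rpow_neg hσt.le, rpow_add hσt, rpow_neg ht.le]
          have := rpow_pos_of_pos ht q
          field_simp
      _ ≤ _ := by
          have h2 : (σ / (t + σ)) ^ p ≤ (σ / (t + σ)) ^ s :=
            rpow_le_rpow_of_exponent_ge (by positivity)
              ((div_le_one hσt).2 (by linarith)) hsp
          have h3 : (t / (t + σ)) ^ q ≤ (t / (t + σ)) ^ s :=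
            rpow_le_rpow_of_exponent_ge (by positivity)
              ((div_le_one hσt).2 (by linarith)) hsq
          gcongr
  refine h1.trans ?_
  rw [div_rpow hσ.le hσt.le, div_rpow ht.le hσt.le, mul_rpow (by norm_num) hσ.le,
    mul_comm (4 * 2 ^ s / (2 ^ s - 1)) (t ^ (-q)), mul_assoc]
  refine mul_le_mul_of_nonneg_left ?_ (rpow_nonneg ht.le _)
  have hZa : σ ^ s ≤ (t + σ) ^ s := rpow_le_rpow hσ.le (by linarith) hs.le
  have hZb : t ^ s ≤ (t + σ) ^ s := rpow_le_rpow ht.le (by linarith) hs.le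
  generalize σ ^ s = a at *
  generalize t ^ s = b at *
  generalize (t + σ) ^ s = Z at *
  generalize (2:ℝ) ^ s = l at *
  have hZ : 0 < Z := ha.trans_le hZa
  have hl1 : 0 < l - 1 := by linarith
  have hl0 : 0 < l := by linarith
  have e : 4 * l / (l - 1) * (l * a / (b + l * a) - a / (b + a)) =
      4 * l * (a * b) / ((b + l * a) * (b + a)) := by
    field_simp
    ring
  rw [e, div_mul_div_comm, div_le_div_iff₀ (by positivity) (by positivity)]
  have h4 : (b + l * a) * (b + a) ≤ 4 * l * (Z * Z) := by
    have : b + l * a ≤ l * (b + a) := by nlinarith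
    calc (b + l * a) * (b + a) ≤ l * (b + a) * (b + a) := by gcongr
      _ ≤ l * (2 * Z) * (2 * Z) := by gcongr <;> linarith
      _ = _ := by ring
  calc a * b * ((b + l * a) * (b + a)) ≤ a * b * (4 * l * (Z * Z)) := by gcongr
    _ = _ := by ring

theorem dyadic_sum_le {p q : ℝ} (hp : 0 < p) (hq : 0 < q) :
    ∃ C : ℝ, 0 < C ∧ ∀ (σ t : ℝ) (N : ℕ), 0 < σ → 0 < t →
      ∑ k ∈ Finset.range N, (2 ^ k * σ) ^ p * (t + 2 ^ k * σ) ^ (-p - q) ≤ C * t ^ (-q) := by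
  set s := min p q with hs
  have hs0 : 0 < s := lt_min hp hq
  have hl : (1:ℝ) < 2 ^ s := one_lt_rpow (by norm_num) hs0
  have hC : 0 < 4 * 2 ^ s / ((2:ℝ) ^ s - 1) := div_pos (by positivity) (by linarith)
  refine ⟨4 * 2 ^ s / (2 ^ s - 1), hC, fun σ t N hσ ht => ?_⟩
  have hterm : ∀ k ∈ Finset.range N, (2 ^ k * σ) ^ p * (t + 2 ^ k * σ) ^ (-p - q) ≤
      4 * 2 ^ s / (2 ^ s - 1) * t ^ (-q) *
      ((2 ^ (k + 1) * σ) ^ s / (t ^ s + (2 ^ (k + 1) * σ) ^ s) -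
        (2 ^ k * σ) ^ s / (t ^ s + (2 ^ k * σ) ^ s)) := by
    intro k _
    have := dyadic_term_le (p := p) (q := q) hs0 (min_le_left _ _) (min_le_right _ _)
      (σ := 2 ^ k * σ) (by positivity) ht
    rwa [← mul_assoc 2, ← pow_succ'] at this
  refine (Finset.sum_le_sum hterm).trans ?_
  rw [← Finset.mul_sum,
    Finset.sum_range_sub (fun k => (2 ^ k * σ) ^ s / (t ^ s + (2 ^ k * σ) ^ s))]
  refine mul_le_of_le_one_right (mul_nonneg hC.le (by positivity)) ?_
  have h1 : (2 ^ N * σ) ^ s / (t ^ s + (2 ^ N * σ) ^ s) ≤ 1 := by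
    rw [div_le_one (by positivity)]
    have : 0 ≤ t ^ s := by positivity
    linarith
  have h2 : 0 ≤ (2 ^ 0 * σ) ^ s / (t ^ s + (2 ^ 0 * σ) ^ s) := by positivity
  linarith

theorem dyadic_sum_log_le {σ t : ℝ} (hσ : 0 < σ) (ht : 0 < t) (N : ℕ) :
    ∑ k ∈ Finset.range N, t / (t + 2 ^ k * σ) ≤ 2 * log ((t + σ) / σ) := by
  have hterm : ∀ k ∈ Finset.range N, t / (t + 2 ^ k * σ) ≤
      2 * (log (2 ^ (k + 1) * σ / (t + 2 ^ (k + 1) * σ)) - log (2 ^ k * σ / (t + 2 ^ k * σ))) := by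
    intro k _
    have hy : 0 < 2 ^ k * σ := by positivity
    rw [pow_succ', mul_assoc]
    generalize 2 ^ k * σ = y at *
    rw [← log_div (by positivity) (by positivity)]
    have e : 2 * y / (t + 2 * y) / (y / (t + y)) = (1 - t / (2 * (t + y)))⁻¹ := by
      have : 1 - t / (2 * (t + y)) = (t + 2 * y) / (2 * (t + y)) := by field_simp; ring
      rw [this]
      field_simp
    have hpos : 0 < 1 - t / (2 * (t + y)) := by
      have : 1 - t / (2 * (t + y)) = (t + 2 * y) / (2 * (t + y)) := by field_simp; ring
      rw [this]
      positivity
    rw [e, log_inv]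
    have h1 := log_le_sub_one_of_pos hpos
    have h2 : t / (t + y) = 2 * (t / (2 * (t + y))) := by field_simp
    linarith
  refine (Finset.sum_le_sum hterm).trans ?_
  rw [← Finset.mul_sum,
    Finset.sum_range_sub (fun k => log (2 ^ k * σ / (t + 2 ^ k * σ)))]
  refine mul_le_mul_of_nonneg_left ?_ (by norm_num)
  have h1 : log (2 ^ N * σ / (t + 2 ^ N * σ)) ≤ 0 := by
    refine log_nonpos (by positivity) ?_
    rw [div_le_one (by positivity)]
    linarith
  have h2 : log (2 ^ 0 * σ / (t + 2 ^ 0 * σ)) = -log ((t + σ) / σ) := by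
    rw [← log_inv, inv_div]; norm_num
  rw [h2]
  linarith

theorem dyadic_sum_neg_le {γ σ : ℝ} (hγ : 0 < γ) (hσ : 0 < σ) (N : ℕ) :
    ∑ k ∈ Finset.range N, (2 ^ k * σ) ^ (-γ) ≤ (1 - 2 ^ (-γ))⁻¹ * σ ^ (-γ) := by
  have h1 : (2:ℝ) ^ (-γ) < 1 := rpow_lt_one_of_one_lt_of_neg (by norm_num) (by linarith)
  have e : ∀ k ∈ Finset.range N, (2 ^ k * σ) ^ (-γ) = ((2:ℝ) ^ (-γ)) ^ k * σ ^ (-γ) := by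
    intro k _
    rw [mul_rpow (by positivity) hσ.le, ← rpow_natCast, ← rpow_natCast, ← rpow_mul (by norm_num),
      ← rpow_mul (by norm_num)]
    ring_nf
  rw [Finset.sum_congr rfl e, ← Finset.sum_mul]
  refine mul_le_mul_of_nonneg_right ?_ (by positivity)
  have h2 := geom_sum_mul_neg ((2:ℝ) ^ (-γ)) N
  rw [← one_div, le_div_iff₀ (by linarith), h2]
  have : 0 ≤ ((2:ℝ) ^ (-γ)) ^ N := by positivity
  linarith

theorem exists_dyadic_between {σ t : ℝ} {N : ℕ} (hσ : 0 < σ) (hσt : σ ≤ t) (ht : t ≤ 2 ^ N * σ) :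
    ∃ k ∈ Finset.range (N + 1), 2 ^ k * σ ≤ t ∧ t ≤ 2 * (2 ^ k * σ) := by
  induction N with
  | zero =>
    refine ⟨0, by simp, by simpa using hσt, ?_⟩
    simp only [pow_zero, one_mul] at *
    linarith
  | succ N ih =>
    rcases le_total t (2 ^ N * σ) with h | h
    · obtain ⟨k, hk, h1⟩ := ih h
      exact ⟨k, by simp at *; omega, h1⟩
    · exact ⟨N, by simp, h, by rw [← mul_assoc, ← pow_succ']; exact ht⟩

/-- The superposition of barriers over dyadic scales. -/
noncomputable def dyadicBarrier (α γ σ : ℝ) (N : ℕ) (s : ℝ) : ℝ :=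
  ∑ k ∈ Finset.range (N + 1), (2 ^ k * σ) ^ (-γ) * barrier α (2 ^ k * σ) s

theorem dyadicBarrier_nonneg {α γ σ s : ℝ} (hσ : 0 < σ) (hs : 0 ≤ s) (N : ℕ) :
    0 ≤ dyadicBarrier α γ σ N s :=
  Finset.sum_nonneg fun k _ =>
    mul_nonneg (by positivity) (barrier_nonneg (by positivity) hs)

theorem barrier_le {α σ s : ℝ} (hα : α < 2) (hσ : 0 < σ) (hs : 0 < s) :
    barrier α σ s ≤ s ^ (α - 1) := by
  rw [barrier_eq (by linarith)]
  calc s * (s + σ) ^ (α - 2) ≤ s * s ^ (α - 2) :=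
        mul_le_mul_of_nonneg_left
          (rpow_le_rpow_of_nonpos hs (by linarith) (by linarith)) hs.le
    _ = s ^ (α - 1) := by
        rw [show α - 1 = 1 + (α - 2) by ring, rpow_add hs, rpow_one]

theorem dyadicBarrier_le_of_pos {α γ σ s : ℝ} (hα : α < 2) (hγ : 0 < γ) (hσ : 0 < σ) (hs : 0 < s)
    (N : ℕ) : dyadicBarrier α γ σ N s ≤ (1 - 2 ^ (-γ))⁻¹ * σ ^ (-γ) * s ^ (α - 1) := by
  calc dyadicBarrier α γ σ N s ≤
        ∑ k ∈ Finset.range (N + 1), (2 ^ k * σ) ^ (-γ) * s ^ (α - 1) :=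
        Finset.sum_le_sum fun k _ =>
          mul_le_mul_of_nonneg_left (barrier_le hα (by positivity) hs) (by positivity)
    _ ≤ _ := by
        rw [← Finset.sum_mul]
        exact mul_le_mul_of_nonneg_right (dyadic_sum_neg_le hγ hσ _) (by positivity)

theorem dyadicBarrier_zero_le {α σ s : ℝ} (hα : α < 1) (hσ : 0 < σ) (hs : 0 < s)
    (N : ℕ) : dyadicBarrier α 0 σ N s ≤ 2 * s ^ (α - 1) * log ((s + σ) / σ) := by
  calc dyadicBarrier α 0 σ N s ≤
        ∑ k ∈ Finset.range (N + 1), s ^ (α - 1) * (s / (s + 2 ^ k * σ)) := by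
        refine Finset.sum_le_sum fun k _ => ?_
        have hk : 0 < 2 ^ k * σ := by positivity
        rw [neg_zero, rpow_zero, one_mul, barrier_eq (by linarith)]
        generalize 2 ^ k * σ = y at *
        have hsy : 0 < s + y := by linarith
        rw [show α - 2 = (α - 1) + -1 by ring, rpow_add hsy, rpow_neg_one]
        have h1 : (s + y) ^ (α - 1) ≤ s ^ (α - 1) :=
          rpow_le_rpow_of_nonpos hs (by linarith) (by linarith)
        calc s * ((s + y) ^ (α - 1) * (s + y)⁻¹) = (s + y) ^ (α - 1) * (s / (s + y)) := by
              ring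
          _ ≤ _ := by gcongr
    _ ≤ _ := by
        rw [← Finset.mul_sum]
        have := mul_le_mul_of_nonneg_left (dyadic_sum_log_le hσ hs (N + 1))
          (rpow_nonneg hs.le (α - 1))
        linarith

theorem dyadicBarrier_le_of_neg {α γ : ℝ} (hα : α < 1) (hγ1 : -1 < γ) (hγ : γ < 0) :
    ∃ C : ℝ, 0 < C ∧ ∀ (σ s : ℝ) (N : ℕ), 0 < σ → 0 < s →
      dyadicBarrier α γ σ N s ≤ C * s ^ (α - 1 - γ) := by
  obtain ⟨C, hC, h⟩ := dyadic_sum_le (p := -γ) (q := 2 - α + γ) (by linarith) (by linarith)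
  refine ⟨C, hC, fun σ s N hσ hs => ?_⟩
  calc dyadicBarrier α γ σ N s = s * ∑ k ∈ Finset.range (N + 1),
        (2 ^ k * σ) ^ (-γ) * (s + 2 ^ k * σ) ^ (- -γ - (2 - α + γ)) := by
        rw [dyadicBarrier, Finset.mul_sum]
        refine Finset.sum_congr rfl fun k _ => ?_
        rw [barrier_eq (by positivity)]
        ring_nf
    _ ≤ s * (C * s ^ (-(2 - α + γ))) := mul_le_mul_of_nonneg_left (h σ s _ hσ hs) hs.le
    _ = C * s ^ (α - 1 - γ) := by
        rw [show α - 1 - γ = 1 + -(2 - α + γ) by ring, rpow_add hs, rpow_one]; ring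

namespace GradedMesh

variable {r Λ α : ℝ} {M : ℕ} {t : ℕ → ℝ}

theorem alikDefect_le (h : GradedMesh r Λ M t) (hα0 : 0 < α) (hα1 : α < 1) {n : ℕ} (hn : 1 ≤ n)
    (hnM : n < M) (ht1 : 4 * t 1 ≤ t (n + 1)) :
    alikDefect α t n ≤ 3 * Λ * t 1 * t (n + 1) ^ (-α - 1) := by
  have hΛ := h.one_le
  have hτ := h.tau_pos
  have hT : 0 < t (n + 1) := by linarith
  have ht : ∀ i ≤ n, t i < t (i + 1) := fun i hi => h.lt_succ i (by omega)
  have hX := h.tStar_ge hα1 hnM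
  have h12 : t 1 < t 2 := ht 1 hn
  have hd : t 1 ≤ Λ * (t 2 - t 1) := by
    have := h.step_le_succ 0 (by omega)
    rw [h.zero] at this
    simpa using this
  have h1 := kernelCorr_le hα0 hα1 ht (i := 0) (by omega)
  simp only [zero_add, h.zero, sub_zero] at h1
  have h2 : (tStar α t (n + 1) - t 1) ^ (-α - 1) ≤ 16 * t (n + 1) ^ (-α - 1) := by
    calc (tStar α t (n + 1) - t 1) ^ (-α - 1) ≤ (t (n + 1) / 4) ^ (-α - 1) :=
          rpow_le_rpow_of_nonpos (by positivity) (by linarith) (by linarith)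
      _ = 4 ^ (α + 1) * t (n + 1) ^ (-α - 1) := by
          rw [div_rpow hT.le (by norm_num), show -α - 1 = -(α + 1) by ring,
            rpow_neg (by norm_num : (0:ℝ) ≤ 4)]
          field_simp
      _ ≤ 4 ^ (2:ℝ) * t (n + 1) ^ (-α - 1) := by
          have : (4:ℝ) ^ (α + 1) ≤ 4 ^ (2:ℝ) :=
            rpow_le_rpow_of_exponent_le (by norm_num) (by linarith)
          gcongr
      _ = _ := by norm_num
  have h3 : t 1 ^ 3 / (6 * t 2) ≤ t 1 ^ 2 / 6 := by
    rw [div_le_div_iff₀ (by linarith) (by norm_num)]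
    have := mul_le_mul_of_nonneg_left h12.le (sq_nonneg (t 1))
    nlinarith
  have h4 : kernelCorr α t n 0 ≤ 3 * t (n + 1) ^ (-α - 1) * t 1 ^ 2 := by
    calc kernelCorr α t n 0 ≤ α * (tStar α t (n + 1) - t 1) ^ (-α - 1) *
          (t 1 ^ 3 / (6 * t 2)) := h1
      _ ≤ 1 * (16 * t (n + 1) ^ (-α - 1)) * (t 1 ^ 2 / 6) := by
          have : 0 ≤ t 1 ^ 3 / (6 * t 2) := by
            have : 0 < t 2 := by linarith
            positivity
          have hX1 : 0 ≤ tStar α t (n + 1) - t 1 := by linarith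
          gcongr
      _ ≤ _ := by
          have : 0 ≤ t (n + 1) ^ (-α - 1) * t 1 ^ 2 := by positivity
          linarith
  rw [alikDefect, div_le_iff₀ (by linarith)]
  refine h4.trans ?_
  have h5 := mul_le_mul_of_nonneg_left hd (show 0 ≤ 3 * t (n + 1) ^ (-α - 1) * t 1 by positivity)
  linarith

theorem exists_barrier_truncation_le (hα0 : 0 < α) (hα1 : α < 1) (hΛ : 1 ≤ Λ) {e b : ℝ}
    (he : -1 ≤ e) (heα : e < α) (heb : e ≤ b) (hb1 : b ≤ 1) (hbr : b ≤ (3 - α) / r) :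
    ∃ C : ℝ, 0 < C ∧ ∀ (M : ℕ) (t : ℕ → ℝ), GradedMesh r Λ M t → ∀ n : ℕ, 1 ≤ n → n < M →
      ∀ σ : ℝ, t 1 ≤ σ →
      |alikSum α t (fun i => barrier α σ (t i)) n - σ ^ α * tStar α t (n + 1) ^ (1 - α) /
        ((1 - α) * (tStar α t (n + 1) + σ) ^ 2)| ≤
      C * (t 1 ^ b * σ ^ (e - b) * t (n + 1) ^ (1 - α) * (t (n + 1) + σ) ^ (α - e - 2)) := by
  have hα : 0 < 1 - α := by linarith
  have hδ : 0 < α - e := by linarith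
  refine ⟨(4 ^ (4 - α) * (2 * Λ) ^ α + α * 4 ^ (α + 1) + Λ ^ (3 - α) / (1 - α)) *
      (90 * (2 * Λ) ^ (4 - α) * (Λ + Λ ^ 2) ^ 3) * (1 + max 1 (1 / (α - e))), by positivity,
      fun M t h n hn hnM σ hσ => ?_⟩
  have h1 := h.barrier_truncation_le hα0 hα1 hn hnM hσ
  have h2 := h.barrier_bracket_le hα1 hnM hσ he heα heb hb1 hbr hα0
  rw [mul_assoc _ (1 + max 1 (1 / (α - e)))]
  exact h1.trans (mul_le_mul_of_nonneg_left h2 (by positivity))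

theorem exists_barrier_lower (hα0 : 0 < α) (hα1 : α < 1) (hΛ : 1 ≤ Λ) {e b : ℝ}
    (he : -1 ≤ e) (heα : e < α) (heb : e ≤ b) (hb1 : b ≤ 1) (hbr : b ≤ (3 - α) / r) :
    ∃ C : ℝ, 0 < C ∧ ∀ (M : ℕ) (t : ℕ → ℝ), GradedMesh r Λ M t → ∀ n : ℕ, 1 ≤ n → n < M →
      ∀ σ : ℝ, 10 * Λ * t 1 ≤ σ → 10 * Λ * t 1 ≤ t (n + 1) →
      σ ^ α * t (n + 1) ^ (1 - α) / (t (n + 1) + σ) ^ 2 / 4 -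
        C * (t 1 ^ b * σ ^ (e - b) * t (n + 1) ^ (1 - α) * (t (n + 1) + σ) ^ (α - e - 2)) ≤
      alikSum α t (fun i => barrier α σ (t i)) n - 2 * (alikDefect α t n * barrier α σ (t 2)) := by
  have hα : 0 < 1 - α := by linarith
  obtain ⟨C, hC, H⟩ := exists_barrier_truncation_le (r := r) hα0 hα1 hΛ he heα heb hb1 hbr
  refine ⟨C, hC, fun M t h n hn hnM σ hσ hT10 => ?_⟩
  have hτ := h.tau_pos
  have hστ : t 1 ≤ σ := by nlinarith
  have hσ0 : 0 < σ := by linarith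
  have hT : 0 < t (n + 1) := h.pos (by omega) hnM
  have ht : ∀ i ≤ n, t i < t (i + 1) := fun i hi => h.lt_succ i (by omega)
  have h4 := (abs_le.1 (H M t h n hn hnM σ hστ)).1
  have hXl := h.tStar_ge hα1 hnM
  have hXu : tStar α t (n + 1) < t (n + 1) := tStar_lt hα0 (ht n le_rfl)
  have hmain : σ ^ α * t (n + 1) ^ (1 - α) / (t (n + 1) + σ) ^ 2 / 2 ≤
      σ ^ α * tStar α t (n + 1) ^ (1 - α) / ((1 - α) * (tStar α t (n + 1) + σ) ^ 2) := by
    have hX0 : 0 < tStar α t (n + 1) := by linarith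
    have e1 : t (n + 1) ^ (1 - α) / 2 ≤ tStar α t (n + 1) ^ (1 - α) := by
      calc t (n + 1) ^ (1 - α) / 2 ≤ t (n + 1) ^ (1 - α) / 2 ^ (1 - α) := by
            have : (2:ℝ) ^ (1 - α) ≤ 2 := by
              conv_rhs => rw [← rpow_one 2]
              exact rpow_le_rpow_of_exponent_le (by norm_num) (by linarith)
            gcongr
        _ = (t (n + 1) / 2) ^ (1 - α) := by rw [div_rpow hT.le (by norm_num)]
        _ ≤ _ := rpow_le_rpow (by positivity) hXl hα.le
    have e2 : (1 - α) * (tStar α t (n + 1) + σ) ^ 2 ≤ (t (n + 1) + σ) ^ 2 := by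
      calc (1 - α) * (tStar α t (n + 1) + σ) ^ 2 ≤ 1 * (t (n + 1) + σ) ^ 2 := by
            gcongr; linarith
        _ = _ := one_mul _
    calc σ ^ α * t (n + 1) ^ (1 - α) / (t (n + 1) + σ) ^ 2 / 2 =
          σ ^ α * (t (n + 1) ^ (1 - α) / 2) / (t (n + 1) + σ) ^ 2 := by ring
      _ ≤ _ := by
          have : 0 < (1 - α) * (tStar α t (n + 1) + σ) ^ 2 := by positivity
          gcongr
  have hdef : 2 * (alikDefect α t n * barrier α σ (t 2)) ≤
      σ ^ α * t (n + 1) ^ (1 - α) / (t (n + 1) + σ) ^ 2 / 4 := by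
    have g1 := h.alikDefect_le hα0 hα1 hn hnM (by nlinarith)
    have g0 := alikDefect_nonneg hα0 hα1 ht hn
    have ht2 : t 2 ≤ Λ * t 1 := h.succ_le 1 le_rfl (by omega)
    have ht20 : 0 < t 2 := h.pos (by omega) (by omega)
    have g2 : barrier α σ (t 2) ≤ Λ * t 1 * σ ^ (α - 2) := by
      rw [barrier_eq (by linarith)]
      have : (t 2 + σ) ^ (α - 2) ≤ σ ^ (α - 2) :=
        rpow_le_rpow_of_nonpos hσ0 (by linarith) (by linarith)
      gcongr
    have hb0 := barrier_nonneg (α := α) hσ0 ht20.le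
    have g3 : (10 * Λ * t 1 * (t (n + 1) + σ)) ^ 2 ≤ (2 * (σ * t (n + 1))) ^ 2 := by
      refine pow_le_pow_left₀ (by positivity) ?_ 2
      nlinarith
    have eσ : σ ^ α = σ ^ (α - 2) * σ ^ 2 := by
      rw [← rpow_natCast, ← rpow_add hσ0]; norm_num
    have eT : t (n + 1) ^ (1 - α) = t (n + 1) ^ (-α - 1) * t (n + 1) ^ 2 := by
      rw [← rpow_natCast, ← rpow_add hT]; ring_nf
    have hP : 0 ≤ σ ^ (α - 2) * t (n + 1) ^ (-α - 1) := by positivity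
    calc 2 * (alikDefect α t n * barrier α σ (t 2)) ≤
          2 * ((3 * Λ * t 1 * t (n + 1) ^ (-α - 1)) * (Λ * t 1 * σ ^ (α - 2))) := by
          gcongr
      _ = (σ ^ (α - 2) * t (n + 1) ^ (-α - 1)) * (6 * (Λ * t 1) ^ 2) := by ring
      _ ≤ (σ ^ (α - 2) * t (n + 1) ^ (-α - 1)) *
            ((σ * t (n + 1)) ^ 2 / (t (n + 1) + σ) ^ 2 / 4) := by
          refine mul_le_mul_of_nonneg_left ?_ hP
          rw [div_div, le_div_iff₀ (by positivity)]
          have := sq_nonneg (Λ * t 1 * (t (n + 1) + σ))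
          linarith
      _ = _ := by rw [eσ, eT]; ring
  linarith

/-- The superposition of barriers satisfies the requirement of the comparison principle. -/
theorem exists_dyadicBarrier_lower (hα0 : 0 < α) (hα1 : α < 1) (hΛ : 1 ≤ Λ) {γ : ℝ}
    (hγ1 : -1 < γ) (hγα : γ < α) (hγr : γ + 1 ≤ (3 - α) / r) :
    ∃ K : ℝ, 1 ≤ K ∧ ∀ (M : ℕ) (t : ℕ → ℝ), GradedMesh r Λ M t → ∀ n N : ℕ, 1 ≤ n → n < M →
      K * t 1 ≤ t (n + 1) → t (n + 1) ≤ 2 ^ N * (K * t 1) →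
      t (n + 1) ^ (-1 - γ) / 128 ≤
      alikSum α t (fun i => dyadicBarrier α γ (K * t 1) N (t i)) n -
        2 * (alikDefect α t n * dyadicBarrier α γ (K * t 1) N (t 2)) := by
  set e := (α + γ) / 2 with he
  set b := min ((3 - α) / r) 1 with hb
  have hb0 : 0 < b := lt_min (by linarith) one_pos
  have heb : e ≤ b := le_min (by linarith) (by linarith)
  obtain ⟨C1, hC1, H1⟩ := exists_barrier_lower (r := r) hα0 hα1 hΛ (e := e) (b := b) (by linarith)
    (by linarith) heb (min_le_right _ _) (min_le_left _ _)
  obtain ⟨C2, hC2, H2⟩ := dyadic_sum_le (p := e - γ) (q := 2 - α + γ) (by linarith) (by linarith)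
  set K := max (10 * Λ) ((128 * (C1 * C2)) ^ (1 / b)) with hK
  have hK1 : 10 * Λ ≤ K := le_max_left _ _
  have hK0 : 0 < K := by linarith
  have hKb : C1 * C2 * K ^ (-b) ≤ 1 / 128 := by
    have : 128 * (C1 * C2) ≤ K ^ b := by
      calc 128 * (C1 * C2) = ((128 * (C1 * C2)) ^ (1 / b)) ^ b := by
            rw [← rpow_mul (by positivity), one_div_mul_cancel hb0.ne', rpow_one]
        _ ≤ K ^ b := rpow_le_rpow (by positivity) (le_max_right _ _) hb0.le
    rw [rpow_neg hK0.le, ← div_eq_mul_inv, div_le_div_iff₀ (by positivity) (by norm_num)]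
    linarith
  refine ⟨K, by linarith, fun M t h n N hn hnM hKT hTN => ?_⟩
  have hτ := h.tau_pos
  have hT : 0 < t (n + 1) := h.pos (by omega) hnM
  have hσ0 : 0 < K * t 1 := by positivity
  set σ : ℕ → ℝ := fun k => 2 ^ k * (K * t 1) with hσ
  have hσk : ∀ k, K * t 1 ≤ σ k := fun k =>
    le_mul_of_one_le_left hσ0.le (one_le_pow₀ (by norm_num))
  have hσp : ∀ k, 0 < σ k := fun k => hσ0.trans_le (hσk k)
  have h10 : 10 * Λ * t 1 ≤ K * t 1 := by gcongr
  have e1 : alikSum α t (fun i => dyadicBarrier α γ (K * t 1) N (t i)) n =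
      ∑ k ∈ Finset.range (N + 1), σ k ^ (-γ) * alikSum α t (fun i => barrier α (σ k) (t i)) n := by
    unfold dyadicBarrier
    rw [alikSum_sum]
    exact Finset.sum_congr rfl fun k _ => alikSum_smul _ _
  have e2 : 2 * (alikDefect α t n * dyadicBarrier α γ (K * t 1) N (t 2)) =
      ∑ k ∈ Finset.range (N + 1), σ k ^ (-γ) *
        (2 * (alikDefect α t n * barrier α (σ k) (t 2))) := by
    rw [dyadicBarrier, Finset.mul_sum, Finset.mul_sum]
    exact Finset.sum_congr rfl fun k _ => by ring
  rw [e1, e2, ← Finset.sum_sub_distrib]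
  set m : ℕ → ℝ := fun k => σ k ^ α * t (n + 1) ^ (1 - α) / (t (n + 1) + σ k) ^ 2 with hm
  have hm0 : ∀ k, 0 ≤ m k := fun k => by have := hσp k; simp only [hm]; positivity
  have hterm : ∀ k ∈ Finset.range (N + 1), σ k ^ (-γ) * m k / 4 -
      C1 * (K ^ (-b) * t (n + 1) ^ (1 - α)) *
        (σ k ^ (e - γ) * (t (n + 1) + σ k) ^ (-(e - γ) - (2 - α + γ))) ≤
      σ k ^ (-γ) * alikSum α t (fun i => barrier α (σ k) (t i)) n -
        σ k ^ (-γ) * (2 * (alikDefect α t n * barrier α (σ k) (t 2))) := by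
    intro k _
    have hs := hσp k
    have := mul_le_mul_of_nonneg_left (H1 M t h n hn hnM (σ k) (h10.trans (hσk k))
      (h10.trans hKT)) (rpow_nonneg hs.le (-γ))
    rw [mul_sub, mul_sub] at this
    refine le_trans ?_ this
    have hg : σ k ^ (-γ) * (C1 * (t 1 ^ b * σ k ^ (e - b) * t (n + 1) ^ (1 - α) *
        (t (n + 1) + σ k) ^ (α - e - 2))) ≤ C1 * (K ^ (-b) * t (n + 1) ^ (1 - α)) *
        (σ k ^ (e - γ) * (t (n + 1) + σ k) ^ (-(e - γ) - (2 - α + γ))) := by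
      have f1 : σ k ^ (-b) ≤ K ^ (-b) * t 1 ^ (-b) := by
        rw [← mul_rpow hK0.le hτ.le]
        exact rpow_le_rpow_of_nonpos hσ0 (hσk k) (by linarith)
      have f2 : t 1 ^ b * t 1 ^ (-b) = 1 := by rw [← rpow_add hτ]; simp
      have f3 : σ k ^ (-γ) * σ k ^ (e - b) = σ k ^ (e - γ) * σ k ^ (-b) := by
        rw [← rpow_add hs, ← rpow_add hs]; ring_nf
      have f4 : α - e - 2 = -(e - γ) - (2 - α + γ) := by ring
      rw [f4]
      have hTσ : 0 < t (n + 1) + σ k := by linarith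
      set Z := (t (n + 1) + σ k) ^ (-(e - γ) - (2 - α + γ)) with hZ
      have hZ0 : 0 ≤ Z := by positivity
      calc _ = C1 * (t 1 ^ b * (σ k ^ (-γ) * σ k ^ (e - b)) * t (n + 1) ^ (1 - α) * Z) := by ring
        _ ≤ C1 * (t 1 ^ b * (σ k ^ (e - γ) * (K ^ (-b) * t 1 ^ (-b))) * t (n + 1) ^ (1 - α) * Z) := by
            rw [f3]; gcongr
        _ = (t 1 ^ b * t 1 ^ (-b)) * (C1 * (K ^ (-b) * t (n + 1) ^ (1 - α)) *
              (σ k ^ (e - γ) * Z)) := by ring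
        _ = _ := by rw [f2, one_mul]
    have : σ k ^ (-γ) * m k / 4 = σ k ^ (-γ) * (m k / 4) := by ring
    linarith
  refine le_trans ?_ (Finset.sum_le_sum hterm)
  rw [Finset.sum_sub_distrib, ← Finset.mul_sum, ← Finset.sum_div]
  have herr : C1 * (K ^ (-b) * t (n + 1) ^ (1 - α)) * ∑ k ∈ Finset.range (N + 1),
      (σ k ^ (e - γ) * (t (n + 1) + σ k) ^ (-(e - γ) - (2 - α + γ))) ≤
      1 / 128 * t (n + 1) ^ (-1 - γ) := by
    have := H2 (K * t 1) (t (n + 1)) (N + 1) hσ0 hT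
    calc _ ≤ C1 * (K ^ (-b) * t (n + 1) ^ (1 - α)) * (C2 * t (n + 1) ^ (-(2 - α + γ))) :=
          mul_le_mul_of_nonneg_left this (by positivity)
      _ = C1 * C2 * K ^ (-b) * (t (n + 1) ^ (1 - α) * t (n + 1) ^ (-(2 - α + γ))) := by ring
      _ = C1 * C2 * K ^ (-b) * t (n + 1) ^ (-1 - γ) := by rw [← rpow_add hT]; ring_nf
      _ ≤ _ := by gcongr
  have hmain : t (n + 1) ^ (-1 - γ) / 16 ≤ ∑ k ∈ Finset.range (N + 1), σ k ^ (-γ) * m k := by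
    obtain ⟨k, hk, hk1, hk2⟩ := exists_dyadic_between hσ0 hKT hTN
    have hs := hσp k
    change σ k ≤ _ at hk1
    change _ ≤ 2 * σ k at hk2
    refine le_trans ?_ (Finset.single_le_sum (f := fun k => σ k ^ (-γ) * m k)
      (fun j _ => mul_nonneg (rpow_nonneg (hσp j).le _) (hm0 j)) hk)
    have hαγ : 0 < α - γ := by linarith
    calc t (n + 1) ^ (-1 - γ) / 16
        = 1 / 4 * t (n + 1) ^ (α - γ) * t (n + 1) ^ (1 - α) / (2 * t (n + 1)) ^ 2 := by
          have : t (n + 1) ^ (-1 - γ) =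
              t (n + 1) ^ (α - γ) * t (n + 1) ^ (1 - α) / t (n + 1) ^ 2 := by
            rw [← rpow_natCast, ← rpow_add hT, ← rpow_sub hT]; norm_num; ring_nf
          rw [this]; ring
      _ ≤ σ k ^ (α - γ) * t (n + 1) ^ (1 - α) / (t (n + 1) + σ k) ^ 2 := by
          have f1 : 1 / 4 * t (n + 1) ^ (α - γ) ≤ σ k ^ (α - γ) := by
            calc 1 / 4 * t (n + 1) ^ (α - γ) ≤ (1 / 2) ^ (α - γ) * t (n + 1) ^ (α - γ) := by
                  have : (1 / 4 : ℝ) ≤ (1 / 2) ^ (α - γ) := by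
                    calc (1 / 4 : ℝ) = (1 / 2) ^ (2:ℝ) := by norm_num
                      _ ≤ _ := rpow_le_rpow_of_exponent_ge (by norm_num) (by norm_num)
                          (by linarith)
                  gcongr
              _ = (t (n + 1) / 2) ^ (α - γ) := by
                  rw [← mul_rpow (by norm_num) hT.le]; ring_nf
              _ ≤ _ := rpow_le_rpow (by positivity) (by linarith) hαγ.le
          have f2 : t (n + 1) + σ k ≤ 2 * t (n + 1) := by linarith
          gcongr
      _ = _ := by
          simp only [hm]
          rw [show α - γ = -γ + α by ring, rpow_add hs]; ring
  linarith

end GradedMesh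

namespace GradedMesh

variable {r Λ α : ℝ}

/-- On the first levels the barrier dominates the crude stability bound. -/
theorem initial_stability {M : ℕ} {t : ℕ → ℝ} (h : GradedMesh r Λ M t) (hα0 : 0 < α) (hα1 : α < 1)
    {γ K F D : ℝ} (hγ1 : -1 < γ) (hK : 1 ≤ K) (hF : 0 ≤ F) {V : ℕ → ℝ} (hV0 : V 0 = 0)
    (hV : ∀ n < M, |alikSum α t V n| ≤ F * (t 1 / t (n + 1)) ^ (1 + γ)) {m : ℕ} (hm : 1 ≤ m)
    (hmM : m ≤ M) (hD : t m ≤ D * t 1) (N : ℕ) :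
    |V m| ≤ D ^ α * (3 + Λ) ^ m / (K ^ (-γ) * (D + K) ^ (α - 2)) *
      (F * t 1 ^ (1 + γ) * dyadicBarrier α γ (K * t 1) N (t m)) := by
  have hτ := h.tau_pos
  have hΛ := h.one_le
  have htm := h.tau_le hm hmM
  have hD1 : 1 ≤ D := by
    by_contra! hcon
    nlinarith
  have hD0 : 0 < D := by linarith
  have hK0 : 0 < K := by linarith
  have h1 : |V m| ≤ F * (D * t 1) ^ α * (3 + Λ) ^ m := by
    refine abs_le_of_alikSum_le hα0 hα1 h.lt_succ (by linarith) h.step_le_succ (by positivity) hV0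
      hmM fun n hn => ?_
    have hT : 0 < t (n + 1) := h.pos (by omega) (by omega)
    have hTm : t (n + 1) ≤ t m := h.le_of_le (by omega) hmM
    have hn0 : 0 ≤ t n := h.nonneg (by omega)
    have hlt := h.lt_succ n (by omega)
    have h2 : (t 1 / t (n + 1)) ^ (1 + γ) ≤ 1 :=
      rpow_le_one (by positivity)
        ((div_le_one hT).2 (h.tau_le (by omega) (by omega))) (by linarith)
    have h3 : (D * t 1) ^ (-α) ≤ (tStar α t (n + 1) - t n) ^ (-α) := by
      have hs := sub_pos.2 (tStar_gt hα1 hlt)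
      have hs' := tStar_lt hα0 hlt
      exact rpow_le_rpow_of_nonpos hs (by linarith) (by linarith)
    calc |alikSum α t V n| ≤ F * 1 := (hV n (by omega)).trans (by gcongr)
      _ = F * ((D * t 1) ^ α * (D * t 1) ^ (-α)) := by
          rw [← rpow_add (by positivity)]; simp
      _ ≤ F * ((D * t 1) ^ α * (tStar α t (n + 1) - t n) ^ (-α)) := by gcongr
      _ = _ := by ring
  have h2 : K ^ (-γ) * (D + K) ^ (α - 2) * t 1 ^ α ≤
      t 1 ^ (1 + γ) * dyadicBarrier α γ (K * t 1) N (t m) := by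
    have hσ0 : 0 < K * t 1 := by positivity
    have htm0 : 0 < t m := by linarith
    have g1 : (K * t 1) ^ (-γ) * barrier α (K * t 1) (t m) ≤
        dyadicBarrier α γ (K * t 1) N (t m) := by
      have := Finset.single_le_sum (s := Finset.range (N + 1))
        (f := fun k => (2 ^ k * (K * t 1)) ^ (-γ) * barrier α (2 ^ k * (K * t 1)) (t m))
        (fun k _ => mul_nonneg (by positivity) (barrier_nonneg (by positivity) htm0.le))
        (show 0 ∈ Finset.range (N + 1) by simp)
      simpa [dyadicBarrier] using this
    have g2 : t 1 * ((D + K) * t 1) ^ (α - 2) ≤ barrier α (K * t 1) (t m) := by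
      rw [barrier_eq (by positivity)]
      have : ((D + K) * t 1) ^ (α - 2) ≤ (t m + K * t 1) ^ (α - 2) :=
        rpow_le_rpow_of_nonpos (by positivity) (by linarith) (by linarith)
      gcongr
    calc K ^ (-γ) * (D + K) ^ (α - 2) * t 1 ^ α =
          t 1 ^ (1 + γ) * ((K * t 1) ^ (-γ) * (t 1 * ((D + K) * t 1) ^ (α - 2))) := by
          rw [mul_rpow hK0.le hτ.le, mul_rpow (by positivity) hτ.le]
          have : t 1 ^ α = t 1 ^ (1 + γ) * (t 1 ^ (-γ) * (t 1 * t 1 ^ (α - 2))) := by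
            nth_rewrite 4 [← rpow_one (t 1)]
            rw [← rpow_add hτ, ← rpow_add hτ, ← rpow_add hτ]
            ring_nf
          rw [this]; ring
      _ ≤ _ := by
          refine mul_le_mul_of_nonneg_left (le_trans ?_ g1) (by positivity)
          exact mul_le_mul_of_nonneg_left g2 (by positivity)
  have hQ : 0 < K ^ (-γ) * (D + K) ^ (α - 2) := by positivity
  calc |V m| ≤ F * (D * t 1) ^ α * (3 + Λ) ^ m := h1
    _ = D ^ α * (3 + Λ) ^ m / (K ^ (-γ) * (D + K) ^ (α - 2)) *
          (F * (K ^ (-γ) * (D + K) ^ (α - 2) * t 1 ^ α)) := by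
        rw [mul_rpow hD0.le hτ.le]
        generalize K ^ (-γ) * (D + K) ^ (α - 2) = Q at hQ
        field_simp
    _ ≤ D ^ α * (3 + Λ) ^ m / (K ^ (-γ) * (D + K) ^ (α - 2)) *
          (F * (t 1 ^ (1 + γ) * dyadicBarrier α γ (K * t 1) N (t m))) := by gcongr
    _ = _ := by ring

/-- Stability of the Alikhanov operator with a right-hand side decaying like
`(τ / t)^{1+γ}`. -/
theorem exists_stability (hα0 : 0 < α) (hα1 : α < 1) (hr : 1 ≤ r) (hΛ : 1 ≤ Λ) {γ : ℝ}
    (hγ1 : -1 < γ) (hγα : γ < α) (hγr : γ + 1 ≤ (3 - α) / r) :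
    ∃ K C : ℝ, 1 ≤ K ∧ 0 < C ∧ ∀ (M : ℕ) (t : ℕ → ℝ), GradedMesh r Λ M t → AlikhanovCond M t →
      ∀ (V : ℕ → ℝ) (F : ℝ), V 0 = 0 → 0 ≤ F →
      (∀ n < M, |alikSum α t V n| ≤ F * (t 1 / t (n + 1)) ^ (1 + γ)) →
      ∃ N : ℕ, ∀ m ≤ M,
        |V m| ≤ C * (F * t 1 ^ (1 + γ)) * dyadicBarrier α γ (K * t 1) N (t m) := by
  obtain ⟨K, hK, HK⟩ := exists_dyadicBarrier_lower (r := r) hα0 hα1 hΛ hγ1 hγα hγr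
  have hK0 : 0 < K := by linarith
  set m0 : ℕ := max 3 ⌈K * Λ⌉₊ with hm0
  set D : ℝ := Λ * (m0 : ℝ) ^ r with hD
  have hm3 : 3 ≤ m0 := le_max_left _ _
  have hD0 : 0 < D := by
    have : (0:ℝ) < m0 := by exact_mod_cast (by omega : 0 < m0)
    positivity
  set C1 : ℝ := D ^ α * (3 + Λ) ^ m0 / (K ^ (-γ) * (D + K) ^ (α - 2)) with hC1
  have hC10 : 0 < C1 := by positivity
  refine ⟨K, 128 + C1, hK, by positivity, fun M t h hA V F hV0 hF hV => ?_⟩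
  have hτ := h.tau_pos
  have hσ0 : 0 < K * t 1 := by positivity
  obtain ⟨N, hN⟩ := pow_unbounded_of_one_lt (t M / (K * t 1)) (one_lt_two : (1:ℝ) < 2)
  rw [div_lt_iff₀ hσ0] at hN
  refine ⟨N, fun m => ?_⟩
  set B : ℝ → ℝ := dyadicBarrier α γ (K * t 1) N with hB
  have hB0 : ∀ i ≤ M, 0 ≤ B (t i) := fun i hi => dyadicBarrier_nonneg hσ0 (h.nonneg hi) N
  set μ : ℝ := (128 + C1) * (F * t 1 ^ (1 + γ)) with hlam
  have hlam0 : 0 ≤ μ := by positivity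
  induction m using Nat.strong_induction_on with
  | _ m ih =>
  intro hmM
  rcases Nat.eq_zero_or_pos m with rfl | hm
  · rw [hV0, abs_zero]
    exact mul_nonneg hlam0 (hB0 0 hmM)
  rcases le_or_gt m m0 with hmm | hmm
  · have hDm : t m ≤ D * t 1 := by
      refine (h.le_power m hm hmM).trans ?_
      have : (m : ℝ) ^ r ≤ (m0 : ℝ) ^ r :=
        rpow_le_rpow (by positivity) (by exact_mod_cast hmm) (by linarith)
      calc Λ * (t 1 * (m : ℝ) ^ r) ≤ Λ * (t 1 * (m0 : ℝ) ^ r) := by gcongr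
        _ = D * t 1 := by rw [hD]; ring
    have h1 := h.initial_stability hα0 hα1 hγ1 hK hF hV0 hV hm hmM hDm N
    refine h1.trans ?_
    have h2 : D ^ α * (3 + Λ) ^ m / (K ^ (-γ) * (D + K) ^ (α - 2)) ≤ 128 + C1 := by
      have : (3 + Λ) ^ m ≤ (3 + Λ) ^ m0 := pow_le_pow_right₀ (by linarith) hmm
      calc _ ≤ C1 := by rw [hC1]; gcongr
        _ ≤ _ := by linarith
    have h3 := hB0 m hmM
    rw [hlam, mul_assoc (128 + C1)]
    gcongr
  · obtain ⟨n, rfl⟩ : ∃ n, m = n + 1 := ⟨m - 1, by omega⟩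
    have hnM : n < M := by omega
    have hT : 0 < t (n + 1) := h.pos (by omega) hnM
    have hKT : K * t 1 ≤ t (n + 1) := by
      have h1 := h.linear_le (n + 1) (by omega) hnM
      have h2 : K * Λ ≤ ((n + 1 : ℕ) : ℝ) :=
        (Nat.le_ceil _).trans (by exact_mod_cast (le_max_right 3 _).trans hmm.le)
      have h3 : K * t 1 * Λ ≤ t (n + 1) * Λ := by
        calc K * t 1 * Λ = t 1 * (K * Λ) := by ring
          _ ≤ t 1 * ((n + 1 : ℕ) : ℝ) := by gcongr
          _ ≤ _ := by linarith
      exact le_of_mul_le_mul_right h3 (by linarith)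
    have hlow := HK M t h n N (by omega) hnM hKT
      ((h.le_of_le hnM le_rfl).trans hN.le)
    have hdef := alikDefect_nonneg (n := n) hα0 hα1 (fun i hi => h.lt_succ i (by omega)) (by omega)
    have hVn := abs_le.1 (hV n hnM)
    have hR : F * (t 1 / t (n + 1)) ^ (1 + γ) ≤ μ * (t (n + 1) ^ (-1 - γ) / 128) := by
      rw [div_rpow hτ.le hT.le, show -1 - γ = -(1 + γ) by ring, rpow_neg hT.le, hlam]
      have : 0 ≤ F * t 1 ^ (1 + γ) * (t (n + 1) ^ (1 + γ))⁻¹ := by positivity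
      rw [div_eq_mul_inv]
      nlinarith
    have hlow' := mul_le_mul_of_nonneg_left hlow hlam0
    have key : ∀ s : ℝ, |s| = 1 → 0 ≤ μ * B (t (n + 1)) + s * V (n + 1) := by
      intro s hs
      have hsV : ∀ y : ℝ, |s * y| = |y| := fun y => by rw [abs_mul, hs, one_mul]
      refine alikSum_comparison (W := fun i => μ * B (t i) + s * V i) hα0 hα1 h.lt_succ hA hnM
        (by omega) (fun i hi => ?_) ?_
      · have h1 := ih i (by omega) (by omega)
        have h2 := (abs_le.1 (hsV (V i)).le).1
        linarith
      · have e1 : alikSum α t (fun i => μ * B (t i) + s * V i) n =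
            μ * alikSum α t (fun i => B (t i)) n + s * alikSum α t V n := by
          rw [alikSum_add (fun i => μ * B (t i)) (fun i => s * V i), alikSum_smul, alikSum_smul]
        rw [e1]
        have h1 := ih 2 (by omega) (by omega)
        have h2 := (abs_le.1 (hsV (V 2)).le).2
        have h3 : μ * B (t 2) + s * V 2 ≤ 2 * (μ * B (t 2)) := by linarith
        have h4 := mul_le_mul_of_nonneg_left h3 hdef
        have h5 := (abs_le.1 ((hsV (alikSum α t V n)).trans_le (hV n hnM))).1
        linarith
    rw [abs_le]
    constructor
    · have := key 1 (by simp); linarith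
    · have := key (-1) (by simp); linarith

end GradedMesh

/-- Functions on `[0, T]` with three derivatives on the open interval and a weak singularity
of order `α` at the origin. -/
structure WeaklySingular (α A T : ℝ) (u u1 u2 u3 : ℝ → ℝ) : Prop where
  nonneg : 0 ≤ A
  cont : ContinuousOn u (Icc 0 T)
  hasDerivAt_one : ∀ s ∈ Ioo 0 T, HasDerivAt u (u1 s) s
  hasDerivAt_two : ∀ s ∈ Ioo 0 T, HasDerivAt u1 (u2 s) s
  hasDerivAt_three : ∀ s ∈ Ioo 0 T, HasDerivAt u2 (u3 s) s
  abs_one_le : ∀ s ∈ Ioo 0 T, |u1 s| ≤ A * s ^ (α - 1)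
  abs_three_le : ∀ s ∈ Ioo 0 T, |u3 s| ≤ A * s ^ (α - 3)

theorem sub_zero_le_of_deriv_le_rpow {α A T : ℝ} (hα0 : 0 < α) {v v1 : ℝ → ℝ}
    (hc : ContinuousOn v (Icc 0 T)) (hd : ∀ s ∈ Ioo 0 T, HasDerivAt v (v1 s) s)
    (hb : ∀ s ∈ Ioo 0 T, v1 s ≤ A * s ^ (α - 1)) {s : ℝ} (hs : s ∈ Icc 0 T) :
    v s - v 0 ≤ A / α * s ^ α := by
  have hD : ∀ y ∈ Ioo 0 T, HasDerivAt (fun y => A / α * y ^ α - v y)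
      (A * y ^ (α - 1) - v1 y) y := by
    intro y hy
    refine HasDerivAt.congr_deriv
      (((hasDerivAt_rpow_const (p := α) (Or.inl hy.1.ne')).const_mul (A / α)).sub (hd y hy)) ?_
    field_simp
  have hmono : MonotoneOn (fun y => A / α * y ^ α - v y) (Icc 0 T) := by
    refine monotoneOn_of_deriv_nonneg (convex_Icc 0 T) ?_ ?_ ?_
    · exact ((continuous_id.rpow_const fun _ => Or.inr hα0.le).const_mul _).continuousOn.sub hc
    · rw [interior_Icc]
      exact fun y hy => (hD y hy).differentiableAt.differentiableWithinAt
    · rw [interior_Icc]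
      intro y hy
      rw [(hD y hy).deriv]
      linarith [hb y hy]
  have := hmono (left_mem_Icc.2 (hs.1.trans hs.2)) hs hs.1
  simp only [zero_rpow hα0.ne', mul_zero] at this
  linarith

namespace WeaklySingular

variable {α A T : ℝ} {u u1 u2 u3 : ℝ → ℝ}

theorem abs_sub_zero_le (h : WeaklySingular α A T u u1 u2 u3) (hα0 : 0 < α) {s : ℝ}
    (hs : s ∈ Icc 0 T) : |u s - u 0| ≤ A / α * s ^ α := by
  rw [abs_le]
  constructor
  · have := sub_zero_le_of_deriv_le_rpow (v := fun y => -u y) (v1 := fun y => -u1 y) hα0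
      h.cont.neg (fun y hy => (h.hasDerivAt_one y hy).neg)
      (fun y hy => (neg_le_abs _).trans (h.abs_one_le y hy)) hs
    linarith
  · exact sub_zero_le_of_deriv_le_rpow hα0 h.cont h.hasDerivAt_one
      (fun y hy => (le_abs_self _).trans (h.abs_one_le y hy)) hs

theorem intervalIntegrable (h : WeaklySingular α A T u u1 u2 u3) (hα0 : 0 < α) {b : ℝ}
    (hb0 : 0 ≤ b) (hbT : b < T) : IntervalIntegrable u1 volume 0 b := by
  have hg : IntervalIntegrable (fun s : ℝ => A * s ^ (α - 1)) volume 0 b :=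
    (intervalIntegral.intervalIntegrable_rpow' (by linarith)).const_mul A
  rw [intervalIntegrable_iff_integrableOn_Ioc_of_le hb0] at hg ⊢
  have hsub : ∀ s ∈ Ioc 0 b, s ∈ Ioo 0 T := fun s hs => ⟨hs.1, hs.2.trans_lt hbT⟩
  refine Integrable.mono' hg ?_ ?_
  · refine ContinuousOn.aestronglyMeasurable (fun s hs => ?_) measurableSet_Ioc
    exact (h.hasDerivAt_two s (hsub s hs)).continuousAt.continuousWithinAt
  · rw [ae_restrict_iff' measurableSet_Ioc]
    exact Filter.Eventually.of_forall fun s hs => h.abs_one_le s (hsub s hs)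

theorem abs_integral_kernel_le (h : WeaklySingular α A T u u1 u2 u3) (hα0 : 0 < α)
    (hα1 : α < 1) {x : ℝ} (hx0 : 0 < x) (hxT : x < T) :
    |∫ s in (0:ℝ)..x, (x - s) ^ (-α) * u1 s| ≤ A * (2 / α + 2 / (1 - α)) := by
  have hA := h.nonneg
  have hk := kernel_intervalIntegrable_sing (a := 0) (x := x) hα1
  have hp : IntervalIntegrable (fun s : ℝ => s ^ (α - 1)) volume 0 x :=
    intervalIntegral.intervalIntegrable_rpow' (by linarith)
  have hx2 : 0 < x / 2 := by positivity
  rw [← Real.norm_eq_abs]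
  have hle := intervalIntegral.norm_integral_le_of_norm_le (f := fun s => (x - s) ^ (-α) * u1 s)
    (g := fun s => A * ((x / 2) ^ (-α) * s ^ (α - 1) + (x / 2) ^ (α - 1) * (x - s) ^ (-α)))
    (μ := volume) hx0.le ?_ (((hp.const_mul _).add (hk.const_mul _)).const_mul A)
  · refine hle.trans ?_
    rw [intervalIntegral.integral_const_mul,
      intervalIntegral.integral_add (hp.const_mul _) (hk.const_mul _),
      intervalIntegral.integral_const_mul, intervalIntegral.integral_const_mul,
      kernel_integral hα1, integral_rpow (Or.inl (by linarith))]
    refine mul_le_mul_of_nonneg_left (add_le_add ?_ ?_) hA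
    · rw [sub_add_cancel, zero_rpow hα0.ne', sub_zero, ← mul_div_assoc]
      refine div_le_div_of_nonneg_right ?_ hα0.le
      rw [rpow_neg hx2.le, ← div_eq_inv_mul, ← div_rpow hx0.le hx2.le,
        show x / (x / 2) = 2 by field_simp]
      exact (rpow_le_rpow_of_exponent_le (by norm_num) hα1.le).trans_eq (rpow_one 2)
    · rw [sub_zero, ← mul_div_assoc]
      refine div_le_div_of_nonneg_right ?_ (by linarith)
      rw [show α - 1 = -(1 - α) by ring, rpow_neg hx2.le, ← div_eq_inv_mul,
        ← div_rpow hx0.le hx2.le, show x / (x / 2) = 2 by field_simp]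
      exact (rpow_le_rpow_of_exponent_le (by norm_num) (by linarith)).trans_eq (rpow_one 2)
  · refine Filter.Eventually.of_forall fun s hs => ?_
    have h0 : 0 ≤ (x - s) ^ (-α) := rpow_nonneg (by linarith [hs.2]) _
    have h1 : 0 ≤ s ^ (α - 1) := rpow_nonneg hs.1.le _
    rw [Real.norm_eq_abs, abs_mul, abs_of_nonneg h0]
    refine (mul_le_mul_of_nonneg_left (h.abs_one_le s ⟨hs.1, hs.2.trans_lt hxT⟩) h0).trans ?_
    rw [mul_left_comm]
    refine mul_le_mul_of_nonneg_left ?_ hA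
    rcases le_total s (x / 2) with hsx | hsx
    · have h2 : (x - s) ^ (-α) ≤ (x / 2) ^ (-α) :=
        rpow_le_rpow_of_nonpos hx2 (by linarith) (by linarith)
      have h3 : 0 ≤ (x / 2) ^ (α - 1) * (x - s) ^ (-α) := by positivity
      nlinarith
    · have h2 : s ^ (α - 1) ≤ (x / 2) ^ (α - 1) :=
        rpow_le_rpow_of_nonpos hx2 (by linarith) (by linarith)
      have h3 : 0 ≤ (x / 2) ^ (-α) * s ^ (α - 1) := by positivity
      nlinarith

end WeaklySingular

namespace GradedMesh

variable {r Λ α A : ℝ} {M : ℕ} {t : ℕ → ℝ} {u u1 u2 u3 : ℝ → ℝ}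

theorem truncation_zero_le (h : GradedMesh r Λ M t)
    (hu : WeaklySingular α A (t M) u u1 u2 u3) (hα0 : 0 < α) (hα1 : α < 1) :
    |alikSum α t (fun i => u (t i)) 0 -
        ∫ s in (0:ℝ)..(tStar α t 1), (tStar α t 1 - s) ^ (-α) * u1 s| ≤
      (1 / ((1 - α) * α) + (2 / α + 2 / (1 - α))) * A := by
  have hτ := h.tau_pos
  have hM := h.two_le
  have hA := hu.nonneg
  have h01 : t 0 < t (0 + 1) := h.lt_succ 0 (by omega)
  have hX1 : tStar α t 1 < t 1 := tStar_lt hα0 h01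
  have hX0 : 0 < tStar α t 1 := by
    have := tStar_gt hα1 h01
    rwa [h.zero] at this
  have ht1M : t 1 < t M := h.lt_of_lt (by omega) le_rfl
  have hint := hu.abs_integral_kernel_le hα0 hα1 hX0 (hX1.trans ht1M)
  have hinc := hu.abs_sub_zero_le hα0 (s := t 1) ⟨hτ.le, ht1M.le⟩
  have hsum : |alikSum α t (fun i => u (t i)) 0| ≤ 1 / ((1 - α) * α) * A := by
    have hc : alikCoeff α t 0 0 = tStar α t 1 ^ (1 - α) / (1 - α) / t 1 := by
      simp only [alikCoeff, kernelMass, kernelCorr, kernelCorrPrev, lt_irrefl, if_false, zero_add,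
        h.zero, sub_zero, add_zero]
      rw [kernel_integral hα1, sub_zero]
    have h1α : 0 < 1 - α := by linarith
    simp only [alikSum, zero_add, Finset.sum_range_one, hc, h.zero]
    rw [abs_mul, abs_of_nonneg (by positivity)]
    calc tStar α t 1 ^ (1 - α) / (1 - α) / t 1 * |u (t 1) - u 0|
        ≤ t 1 ^ (1 - α) / (1 - α) / t 1 * (A / α * t 1 ^ α) := by gcongr
      _ = t 1 ^ (1 - α) * t 1 ^ α / t 1 * (A / ((1 - α) * α)) := by field_simp
      _ = _ := by
          rw [← rpow_add hτ, sub_add_cancel, rpow_one, div_self hτ.ne', one_mul]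
          ring
  refine (abs_sub _ _).trans ?_
  linarith

theorem power_bracket_le (h : GradedMesh r Λ M t) {n : ℕ} (hnM : n < M) {b : ℝ}
    (hα0 : 0 < α) (hbr : b ≤ (3 - α) / r) (hbα : b < 1 + α) :
    gradedStep r (t 1) (t (n + 1)) ^ (3 - α) * t (n + 1) ^ (α - 3) +
        t (n + 1) ^ (-α - 1) * ∑ i ∈ Finset.range n,
          (t (i + 1) - t i) * (gradedStep r (t 1) (t (i + 1)) ^ 3 * t (i + 1) ^ (α - 3)) ≤
      (1 + max 1 (1 / (α + 1 - b))) * (t 1 / t (n + 1)) ^ b := by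
  have hτ := h.tau_pos
  have hr := h.one_le_r
  have hT : 0 < t (n + 1) := h.pos (by omega) hnM
  have hδ : 0 < α + 1 - b := by linarith
  have hQ : (t 1 / t (n + 1)) ^ b = t 1 ^ b * t (n + 1) ^ (-b) := by
    rw [div_rpow hτ.le hT.le, rpow_neg hT.le, div_eq_mul_inv]
  rw [hQ]
  have hfirst : gradedStep r (t 1) (t (n + 1)) ^ (3 - α) * t (n + 1) ^ (α - 3) ≤
      t 1 ^ b * t (n + 1) ^ (-b) := by
    have h1 := gradedStep_rpow_le (r := r) (a := 3 - α) hτ (h.tau_le (by omega) hnM) hbr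
    calc _ ≤ t 1 ^ b * t (n + 1) ^ (3 - α - b) * t (n + 1) ^ (α - 3) := by gcongr
      _ = _ := by rw [mul_assoc, ← rpow_add hT]; ring_nf
  have hterm : ∀ i < n, (t (i + 1) - t i) * (gradedStep r (t 1) (t (i + 1)) ^ 3 *
      t (i + 1) ^ (α - 3)) ≤ t 1 ^ b * ((t (i + 1) - t i) * t (i + 1) ^ (α + 1 - b - 1)) := by
    intro i hi
    have hs : 0 < t (i + 1) := h.pos (by omega) (by omega)
    have hd : 0 ≤ t (i + 1) - t i := (sub_pos.2 (h.lt_succ i (by omega))).le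
    have h1 : gradedStep r (t 1) (t (i + 1)) ^ 3 ≤ t 1 ^ b * t (i + 1) ^ (3 - b) := by
      have := gradedStep_rpow_le (r := r) (a := 3) (p := b) hτ (h.tau_le (i := i + 1) (by omega)
        (by omega)) (hbr.trans (by gcongr; linarith))
      have e : gradedStep r (t 1) (t (i + 1)) ^ (3:ℝ) = gradedStep r (t 1) (t (i + 1)) ^ 3 := by
        exact_mod_cast rpow_natCast (gradedStep r (t 1) (t (i + 1))) 3
      rwa [e] at this
    calc _ ≤ (t (i + 1) - t i) * (t 1 ^ b * t (i + 1) ^ (3 - b) * t (i + 1) ^ (α - 3)) := by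
          gcongr
      _ = (t (i + 1) - t i) * (t 1 ^ b * (t (i + 1) ^ (3 - b) * t (i + 1) ^ (α - 3))) := by ring
      _ = _ := by rw [← rpow_add hs]; ring_nf
  have hsum : t (n + 1) ^ (-α - 1) * ∑ i ∈ Finset.range n, (t (i + 1) - t i) *
      (gradedStep r (t 1) (t (i + 1)) ^ 3 * t (i + 1) ^ (α - 3)) ≤
      max 1 (1 / (α + 1 - b)) * (t 1 ^ b * t (n + 1) ^ (-b)) := by
    have h1 := Finset.sum_le_sum fun i hi => hterm i (Finset.mem_range.1 hi)
    rw [← Finset.mul_sum] at h1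
    have h2 := h.sum_step_mul_rpow_le hδ (n := n) hnM.le
    have h3 : t n ^ (α + 1 - b) ≤ t (n + 1) ^ (α + 1 - b) :=
      rpow_le_rpow (h.nonneg hnM.le) (h.le_of_le (by omega) hnM) hδ.le
    have hm : 0 ≤ max 1 (1 / (α + 1 - b)) := zero_le_one.trans (le_max_left _ _)
    calc _ ≤ t (n + 1) ^ (-α - 1) * (t 1 ^ b *
            (max 1 (1 / (α + 1 - b)) * t (n + 1) ^ (α + 1 - b))) := by
          refine mul_le_mul_of_nonneg_left (h1.trans ?_) (by positivity)
          refine mul_le_mul_of_nonneg_left (h2.trans ?_) (by positivity)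
          exact mul_le_mul_of_nonneg_left h3 hm
      _ = max 1 (1 / (α + 1 - b)) * (t 1 ^ b *
            (t (n + 1) ^ (-α - 1) * t (n + 1) ^ (α + 1 - b))) := by ring
      _ = _ := by rw [← rpow_add hT]; ring_nf
  linarith

end GradedMesh

/-- The quadratic interpolant on its first subinterval, for data close to a constant. -/
theorem abs_lagQuad_sub_le {x0 x1 x2 y0 y1 y2 y s Λ B : ℝ} (h01 : x0 < x1) (h12 : x1 < x2)
    (hΛ : x1 - x0 ≤ Λ * (x2 - x1)) (hs : s ∈ Icc x0 x1) (h1 : |y1 - y0| ≤ B)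
    (h2 : |y2 - y0| ≤ B) (hy : |y - y0| ≤ B) :
    |lagQuad x0 x1 x2 y0 y1 y2 s - y| ≤ (3 + 2 * Λ) * B := by
  have ha : 0 < x1 - x0 := sub_pos.2 h01
  have hb : 0 < x2 - x1 := sub_pos.2 h12
  have hc : 0 < x2 - x0 := by linarith
  have hB : 0 ≤ B := (abs_nonneg _).trans h1
  have hΛ0 : 0 ≤ Λ := by
    by_contra! hneg
    nlinarith
  obtain ⟨hs0, hs1⟩ := hs
  have h21 : |y2 - y1| ≤ 2 * B := by
    rw [show y2 - y1 = (y2 - y0) - (y1 - y0) by ring]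
    exact (abs_sub _ _).trans (by linarith)
  set p := (s - x0) / (x1 - x0) with hp
  set q := (x1 - s) / (x2 - x0) with hq
  have hp0 : 0 ≤ p := div_nonneg (by linarith) ha.le
  have hp1 : p ≤ 1 := (div_le_one ha).2 (by linarith)
  have hq0 : 0 ≤ q := div_nonneg (by linarith) hc.le
  have hq1 : q ≤ 1 := (div_le_one hc).2 (by linarith)
  have hw : (s - x0) / (x2 - x1) ≤ Λ := by
    rw [div_le_iff₀ hb]; linarith
  have hw0 : 0 ≤ (s - x0) / (x2 - x1) := div_nonneg (by linarith) hb.le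
  have e : lagQuad x0 x1 x2 y0 y1 y2 s - y =
      ((y1 - y0) * (p * (1 + q)) - (y - y0)) - (y2 - y1) * ((s - x0) / (x2 - x1) * q) := by
    rw [lagQuad_eq_newton h01 h12, hp, hq]
    field_simp
    ring
  have hA : |(y1 - y0) * (p * (1 + q))| ≤ 2 * B := by
    rw [abs_mul, abs_of_nonneg (by positivity : 0 ≤ p * (1 + q))]
    calc |y1 - y0| * (p * (1 + q)) ≤ B * (1 * (1 + 1)) := by gcongr
      _ = _ := by ring
  have hC : |(y2 - y1) * ((s - x0) / (x2 - x1) * q)| ≤ 2 * B * Λ := by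
    rw [abs_mul, abs_of_nonneg (by positivity : 0 ≤ (s - x0) / (x2 - x1) * q)]
    calc |y2 - y1| * ((s - x0) / (x2 - x1) * q) ≤ 2 * B * (Λ * 1) := by gcongr
      _ = _ := by ring
  rw [e]
  refine (abs_sub _ _).trans ((add_le_add (abs_sub _ _) le_rfl).trans ?_)
  linarith

theorem gradedStep_self {r τ : ℝ} (hτ : 0 < τ) : gradedStep r τ τ = τ := by
  rw [gradedStep, ← rpow_add hτ, add_sub_cancel, rpow_one]

namespace GradedMesh

variable {r Λ α A : ℝ} {M : ℕ} {t : ℕ → ℝ} {u u1 u2 u3 : ℝ → ℝ}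

theorem rpow_shift_le (h : GradedMesh r Λ M t) (hα1 : α < 1) {i : ℕ} (hi : 1 ≤ i) (hiM : i < M)
    {s : ℝ} (hs : t i ≤ s) : s ^ (α - 3) ≤ Λ ^ (3 - α) * t (i + 1) ^ (α - 3) := by
  have h0 : 0 < t i := h.pos hi hiM.le
  have h1 := h.succ_le i hi hiM
  have h2 : 0 < t (i + 1) := h.pos (by omega) hiM
  have hΛ : 0 < Λ := zero_lt_one.trans_le h.one_le
  calc s ^ (α - 3) ≤ (t (i + 1) / Λ) ^ (α - 3) := by
        refine rpow_le_rpow_of_nonpos (by positivity) ?_ (by linarith)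
        rw [div_le_iff₀ hΛ]
        nlinarith
    _ = _ := by
        rw [div_rpow h2.le hΛ.le, show α - 3 = -(3 - α) by ring, rpow_neg hΛ.le]
        field_simp

theorem lagQuad_sub_zero_le (h : GradedMesh r Λ M t)
    (hu : WeaklySingular α A (t M) u u1 u2 u3) (hα0 : 0 < α) (hα1 : α < 1) {s : ℝ}
    (hs : s ∈ Icc (t 0) (t 1)) :
    |lagQuad (t 0) (t 1) (t 2) (u (t 0)) (u (t 1)) (u (t 2)) s - u s| ≤
      (3 + 2 * Λ) * (Λ / α) * A * (gradedStep r (t 1) (t 1) ^ 3 * t 1 ^ (α - 3)) := by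
  have hτ := h.tau_pos
  have hM := h.two_le
  have hA := hu.nonneg
  have hΛ := h.one_le
  have h12 : t 1 < t 2 := h.lt_succ 1 (by omega)
  have h2M : t 2 ≤ t M := h.le_of_le hM le_rfl
  have h21 : t 2 ≤ Λ * t 1 := h.succ_le 1 le_rfl (by omega)
  have hle : ∀ y ∈ Icc 0 (t 2), |u y - u (t 0)| ≤ A / α * (Λ * t 1 ^ α) := by
    intro y hy
    rw [h.zero]
    refine (hu.abs_sub_zero_le hα0 ⟨hy.1, hy.2.trans h2M⟩).trans ?_
    refine mul_le_mul_of_nonneg_left ?_ (by positivity)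
    calc y ^ α ≤ (Λ * t 1) ^ α := rpow_le_rpow hy.1 (hy.2.trans h21) hα0.le
      _ = Λ ^ α * t 1 ^ α := mul_rpow (by linarith) hτ.le
      _ ≤ Λ * t 1 ^ α := by
          refine mul_le_mul_of_nonneg_right ?_ (by positivity)
          exact (rpow_le_rpow_of_exponent_le hΛ hα1.le).trans_eq (rpow_one Λ)
  have h01 : t 0 < t 1 := h.lt_succ 0 (by omega)
  have hs0 : 0 ≤ s := h.zero ▸ hs.1
  refine (abs_lagQuad_sub_le h01 h12 (h.step_le_succ 0 (by omega)) hs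
    (hle _ ⟨hτ.le, h12.le⟩) (hle _ ⟨(hτ.trans h12).le, le_rfl⟩)
    (hle _ ⟨hs0, hs.2.trans h12.le⟩)).trans_eq ?_
  have e : t 1 ^ 3 * t 1 ^ (α - 3) = t 1 ^ α := by
    rw [← rpow_natCast, ← rpow_add hτ]
    norm_num
  rw [gradedStep_self hτ, e]
  ring

theorem lagQuad_sub_succ_le (h : GradedMesh r Λ M t)
    (hu : WeaklySingular α A (t M) u u1 u2 u3) (hα1 : α < 1) {i : ℕ} (hi : 1 ≤ i)
    (hiM : i + 2 ≤ M) {s : ℝ} (hs : s ∈ Icc (t i) (t (i + 1))) :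
    |lagQuad (t i) (t (i + 1)) (t (i + 2)) (u (t i)) (u (t (i + 1))) (u (t (i + 2))) s - u s| ≤
      3 * Λ ^ (3 - α) * (Λ + Λ ^ 2) ^ 3 * A *
        (gradedStep r (t 1) (t (i + 1)) ^ 3 * t (i + 1) ^ (α - 3)) := by
  have hΛ := h.one_le
  have hA := hu.nonneg
  have h0 : 0 < t i := h.pos hi (by omega)
  have h01 : t i < t (i + 1) := h.lt_succ i (by omega)
  have h12 : t (i + 1) < t (i + 2) := h.lt_succ (i + 1) (by omega)
  have h2M : t (i + 2) ≤ t M := h.le_of_le hiM le_rfl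
  have hsub : ∀ y ∈ Ioo (t i) (t (i + 2)), y ∈ Ioo 0 (t M) :=
    fun y hy => ⟨h0.trans hy.1, hy.2.trans_le h2M⟩
  have hq := lagQuad_sub_le (f := u) (f1 := u1) (f2 := u2) (f3 := u3)
    (L := A * (Λ ^ (3 - α) * t (i + 1) ^ (α - 3))) h01 h12
    (hu.cont.mono (Icc_subset_Icc h0.le h2M))
    (fun y hy => hu.hasDerivAt_one y (hsub y hy))
    (fun y hy => hu.hasDerivAt_two y (hsub y hy))
    (fun y hy => hu.hasDerivAt_three y (hsub y hy))
    (fun y hy => (hu.abs_three_le y (hsub y hy)).trans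
      (mul_le_mul_of_nonneg_left (h.rpow_shift_le hα1 hi (by omega) hy.1.le) hA)) hs
  refine hq.trans ?_
  have h3 := pow_le_pow_left₀ (by linarith) (h.two_step_le (i := i) hiM) 3
  have h4 : 0 ≤ t (i + 1) := (h0.trans h01).le
  calc 3 * (A * (Λ ^ (3 - α) * t (i + 1) ^ (α - 3))) * (t (i + 2) - t i) ^ 3
      ≤ 3 * (A * (Λ ^ (3 - α) * t (i + 1) ^ (α - 3))) *
        ((Λ + Λ ^ 2) * gradedStep r (t 1) (t (i + 1))) ^ 3 := by gcongr
    _ = _ := by rw [mul_pow]; ring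

theorem truncation_succ_le (h : GradedMesh r Λ M t)
    (hu : WeaklySingular α A (t M) u u1 u2 u3) (hα0 : 0 < α) (hα1 : α < 1) {n : ℕ}
    (hn : 1 ≤ n) (hnM : n < M) {b : ℝ} (hbr : b ≤ (3 - α) / r) (hbα : b < 1 + α) {K : ℝ}
    (hK1 : (3 + 2 * Λ) * (Λ / α) ≤ K) (hK2 : 3 * Λ ^ (3 - α) * (Λ + Λ ^ 2) ^ 3 ≤ K) :
    |alikSum α t (fun i => u (t i)) n -
        ∫ s in (0:ℝ)..(tStar α t (n + 1)), (tStar α t (n + 1) - s) ^ (-α) * u1 s| ≤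
      (4 ^ (3 - α) * (2 * Λ) ^ α + α * 4 ^ (α + 1) + Λ ^ (3 - α) / (1 - α)) * (K * A) *
        ((1 + max 1 (1 / (α + 1 - b))) * (t 1 / t (n + 1)) ^ b) := by
  have hΛ := h.one_le
  have hA := hu.nonneg
  have hM := h.two_le
  have h1α : 0 < 1 - α := by linarith
  have hK0 : 0 ≤ K := le_trans (by positivity) hK1
  have hKA : 0 ≤ K * A := by positivity
  have ht : ∀ i ≤ n, t i < t (i + 1) := fun i hi => h.lt_succ i (by omega)
  have hTM : t (n + 1) ≤ t M := h.le_of_le hnM le_rfl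
  have hsub : ∀ s ∈ Ioo (t 0) (t (n + 1)), s ∈ Ioo 0 (t M) := fun s hs =>
    ⟨h.zero ▸ hs.1, hs.2.trans_le hTM⟩
  have hI := alikSum_sub_integral_le (f := u) (f1 := u1) (f2 := u2) (f3 := u3) (t := t) hα0 hα1
    ht hn (E := fun i => K * A * (gradedStep r (t 1) (t (i + 1)) ^ 3 * t (i + 1) ^ (α - 3)))
    (L := K * A * t (n + 1) ^ (α - 3))
    (hu.cont.mono (Icc_subset_Icc h.zero.ge hTM))
    (fun s hs => hu.hasDerivAt_one s (hsub s hs))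
    (fun s hs => hu.hasDerivAt_two s (hsub s hs))
    (fun s hs => hu.hasDerivAt_three s (hsub s hs)) ?_ ?_ ?_
  · rw [h.zero] at hI
    refine hI.trans ?_
    refine (h.sum_truncation_le hα0 hα1 hnM (c := 4 ^ (3 - α)) (A := K * A)
      (G := fun s => s ^ (α - 3)) (by positivity)
      (fun s hs => by positivity) ?_ hKA (fun i hi => le_rfl) le_rfl).trans ?_
    · intro s y hs hsy hy
      have hy0 : 0 < y := hs.trans_le hsy
      calc s ^ (α - 3) ≤ (y / 4) ^ (α - 3) :=
            rpow_le_rpow_of_nonpos (by linarith) (by linarith) (by linarith)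
        _ = _ := by
            rw [div_rpow hy0.le (by positivity), show α - 3 = -(3 - α) by ring,
              rpow_neg (by positivity : (0:ℝ) ≤ 4)]
            field_simp
    · exact mul_le_mul_of_nonneg_left (h.power_bracket_le hnM hα0 hbr hbα) (by positivity)
  · rw [h.zero]
    exact hu.intervalIntegrable hα0 h.tau_pos.le (h.lt_of_lt (by omega) le_rfl)
  · intro i hi s hs
    have hg : 0 ≤ gradedStep r (t 1) (t (i + 1)) ^ 3 * t (i + 1) ^ (α - 3) := by
      have h1 : 0 < t (i + 1) := h.pos (by omega) (by omega)
      have := gradedStep_pos (r := r) h.tau_pos h1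
      positivity
    rcases Nat.eq_zero_or_pos i with rfl | hi1
    · exact (h.lagQuad_sub_zero_le hu hα0 hα1 hs).trans
        (mul_le_mul_of_nonneg_right (mul_le_mul_of_nonneg_right hK1 hA) hg)
    · exact (h.lagQuad_sub_succ_le hu hα1 hi1 (by omega) hs).trans
        (mul_le_mul_of_nonneg_right (mul_le_mul_of_nonneg_right hK2 hA) hg)
  · intro s hs
    have h0 : 0 < t n := h.pos hn (by omega)
    have h2 : 0 ≤ t (n + 1) ^ (α - 3) := rpow_nonneg (h.nonneg hnM) _
    have h3 : Λ ^ (3 - α) ≤ K := by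
      refine le_trans ?_ hK2
      have h5 : (1:ℝ) ≤ (Λ + Λ ^ 2) ^ 3 := one_le_pow₀ (by nlinarith)
      have h6 : 0 ≤ Λ ^ (3 - α) := by positivity
      nlinarith
    refine (hu.abs_three_le s ⟨h0.trans hs.1, hs.2.trans_le hTM⟩).trans
      ((mul_le_mul_of_nonneg_left (h.rpow_shift_le hα1 hn hnM hs.1.le) hA).trans ?_)
    calc A * (Λ ^ (3 - α) * t (n + 1) ^ (α - 3)) ≤ A * (K * t (n + 1) ^ (α - 3)) := by gcongr
      _ = _ := by ring

theorem exists_truncation_le (hα0 : 0 < α) (hα1 : α < 1) (hΛ : 1 ≤ Λ) {b : ℝ}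
    (hbr : b ≤ (3 - α) / r) (hbα : b < 1 + α) :
    ∃ C, 0 < C ∧ ∀ (M : ℕ) (t : ℕ → ℝ), GradedMesh r Λ M t → ∀ (A : ℝ) (u u1 u2 u3 : ℝ → ℝ),
      WeaklySingular α A (t M) u u1 u2 u3 → ∀ n < M,
      |alikSum α t (fun i => u (t i)) n -
          ∫ s in (0:ℝ)..(tStar α t (n + 1)), (tStar α t (n + 1) - s) ^ (-α) * u1 s| ≤
        C * A * (t 1 / t (n + 1)) ^ b := by
  have h1α : 0 < 1 - α := by linarith
  have hm : (0:ℝ) ≤ max 1 (1 / (α + 1 - b)) := zero_le_one.trans (le_max_left _ _)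
  obtain ⟨K, hK1, hK2⟩ : ∃ K, (3 + 2 * Λ) * (Λ / α) ≤ K ∧
      3 * Λ ^ (3 - α) * (Λ + Λ ^ 2) ^ 3 ≤ K := ⟨_, le_max_left _ _, le_max_right _ _⟩
  obtain ⟨C0, hC0, hC0'⟩ : ∃ C0, 0 < C0 ∧
      1 / ((1 - α) * α) + (2 / α + 2 / (1 - α)) ≤ C0 := ⟨_, by positivity, le_rfl⟩
  have hK0 : 0 ≤ K := le_trans (by positivity) hK1
  refine ⟨C0 + (4 ^ (3 - α) * (2 * Λ) ^ α + α * 4 ^ (α + 1) + Λ ^ (3 - α) / (1 - α)) * K *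
    (1 + max 1 (1 / (α + 1 - b))), by positivity, ?_⟩
  obtain ⟨C1, hC1, hC1e⟩ : ∃ C1, 0 ≤ C1 ∧
    C1 = (4 ^ (3 - α) * (2 * Λ) ^ α + α * 4 ^ (α + 1) + Λ ^ (3 - α) / (1 - α)) * K *
    (1 + max 1 (1 / (α + 1 - b))) := ⟨_, by positivity, rfl⟩
  rw [← hC1e]
  intro M t h A u u1 u2 u3 hu n hnM
  have hA := hu.nonneg
  have hτ := h.tau_pos
  have hT : 0 < t (n + 1) := h.pos (by omega) hnM
  have hq : 0 ≤ (t 1 / t (n + 1)) ^ b := by positivity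
  rcases Nat.eq_zero_or_pos n with rfl | hn
  · have h0 := h.truncation_zero_le hu hα0 hα1
    rw [zero_add, div_self hτ.ne', one_rpow, mul_one]
    refine h0.trans ?_
    exact mul_le_mul_of_nonneg_right (by linarith) hA
  · refine (h.truncation_succ_le hu hα0 hα1 hn hnM hbr hbα hK1 hK2).trans ?_
    calc _ = C1 * A * (t 1 / t (n + 1)) ^ b := by rw [hC1e]; ring
      _ ≤ _ := by gcongr; linarith

end GradedMesh

/-- A choice of barrier exponent for which the scaled barrier is dominated by the error
majorant. -/
theorem exists_dyadicBarrier_le_EcalAlik {α r C0 : ℝ} (hα0 : 0 < α) (hα1 : α < 1) (hr : 1 ≤ r)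
    (hC0 : 0 < C0) :
    ∃ γ, -1 < γ ∧ γ < α ∧ γ + 1 ≤ (3 - α) / r ∧ ∀ K : ℝ, 1 ≤ K → ∃ C, 0 < C ∧
      ∀ (M : ℕ) (τ s : ℝ) (N : ℕ), 0 < M → 0 < τ → τ ≤ s → τ ≤ C0 * (M : ℝ) ^ (-r) →
        τ ^ (1 + γ) * dyadicBarrier α γ (K * τ) N s ≤ C * EcalAlik α r M τ s := by
  have hr0 : 0 < r := by linarith
  rcases lt_trichotomy r (3 - α) with hlt | heq | hgt
  · have hb : 1 < (3 - α) / r := (one_lt_div hr0).2 hlt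
    obtain ⟨γ, hγ0, hγα, hγb⟩ : ∃ γ, 0 < γ ∧ γ < α ∧ γ + 1 ≤ (3 - α) / r :=
      ⟨min (α / 2) ((3 - α) / r - 1), lt_min (by linarith) (by linarith),
        (min_le_left _ _).trans_lt (by linarith), by
          linarith [min_le_right (α / 2) ((3 - α) / r - 1)]⟩
    refine ⟨γ, by linarith, hγα, hγb, fun K hK => ?_⟩
    have hc : 0 < (1 - (2:ℝ) ^ (-γ))⁻¹ := by
      have : (2:ℝ) ^ (-γ) < 1 := rpow_lt_one_of_one_lt_of_neg (by norm_num) (by linarith)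
      exact inv_pos.2 (by linarith)
    refine ⟨(1 - 2 ^ (-γ))⁻¹ * C0, by positivity, fun M τ s N hM hτ hτs hτM => ?_⟩
    have hs : 0 < s := hτ.trans_le hτs
    have hKτ : τ ≤ K * τ := by nlinarith
    rw [EcalAlik, if_pos hlt]
    have h1 : (K * τ) ^ (-γ) ≤ τ ^ (-γ) := rpow_le_rpow_of_nonpos hτ hKτ (by linarith)
    have hpos : 0 < K * τ := hτ.trans_le hKτ
    calc τ ^ (1 + γ) * dyadicBarrier α γ (K * τ) N s
        ≤ τ ^ (1 + γ) * ((1 - 2 ^ (-γ))⁻¹ * (K * τ) ^ (-γ) * s ^ (α - 1)) :=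
          mul_le_mul_of_nonneg_left (dyadicBarrier_le_of_pos (by linarith) hγ0 hpos hs N)
            (by positivity)
      _ ≤ τ ^ (1 + γ) * ((1 - 2 ^ (-γ))⁻¹ * τ ^ (-γ) * s ^ (α - 1)) := by gcongr
      _ = (1 - 2 ^ (-γ))⁻¹ * (τ ^ (1 + γ) * τ ^ (-γ)) * s ^ (α - 1) := by ring
      _ = (1 - 2 ^ (-γ))⁻¹ * τ * s ^ (α - 1) := by
          rw [← rpow_add hτ]; norm_num
      _ ≤ (1 - 2 ^ (-γ))⁻¹ * (C0 * (M : ℝ) ^ (-r)) * s ^ (α - 1) := by gcongr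
      _ = _ := by ring
  · refine ⟨0, by norm_num, hα0, by rw [← heq, div_self hr0.ne']; norm_num, fun K hK => ?_⟩
    refine ⟨2 * C0, by positivity, fun M τ s N hM hτ hτs hτM => ?_⟩
    have hs : 0 < s := hτ.trans_le hτs
    have hKτ : τ ≤ K * τ := by nlinarith
    have hpos : 0 < K * τ := hτ.trans_le hKτ
    rw [EcalAlik, if_neg heq.not_lt, if_pos heq, add_zero, rpow_one]
    have hle : (s + K * τ) / (K * τ) ≤ 2 * (s / τ) := by
      rw [div_le_iff₀ hpos]
      have : 2 * (s / τ) * (K * τ) = 2 * K * s := by field_simp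
      rw [this]
      nlinarith
    have hlog : log ((s + K * τ) / (K * τ)) ≤ 1 + log (s / τ) := by
      refine (log_le_log (by positivity) hle).trans ?_
      rw [log_mul (by norm_num) (by positivity)]
      linarith [log_two_lt_d9]
    have hlog0 : 0 ≤ log (s / τ) := log_nonneg ((one_le_div hτ).2 hτs)
    calc τ * dyadicBarrier α 0 (K * τ) N s
        ≤ τ * (2 * s ^ (α - 1) * log ((s + K * τ) / (K * τ))) :=
          mul_le_mul_of_nonneg_left (dyadicBarrier_zero_le hα1 hpos hs N) hτ.le
      _ ≤ τ * (2 * s ^ (α - 1) * (1 + log (s / τ))) := by gcongr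
      _ ≤ (C0 * (M : ℝ) ^ (-r)) * (2 * s ^ (α - 1) * (1 + log (s / τ))) := by gcongr
      _ = _ := by rw [show α - 3 = -r by linarith]; ring
  · have hb : (3 - α) / r < 1 := (div_lt_one hr0).2 hgt
    have hb0 : 0 < (3 - α) / r := div_pos (by linarith) hr0
    refine ⟨(3 - α) / r - 1, by linarith, by linarith, by linarith, fun K hK => ?_⟩
    obtain ⟨C, hC, hCle⟩ := dyadicBarrier_le_of_neg (γ := (3 - α) / r - 1) hα1 (by linarith)
      (by linarith)
    refine ⟨C * C0 ^ ((3 - α) / r), by positivity, fun M τ s N hM hτ hτs hτM => ?_⟩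
    have hs : 0 < s := hτ.trans_le hτs
    have hM0 : (0:ℝ) < M := by exact_mod_cast hM
    have hpos : 0 < K * τ := by positivity
    rw [EcalAlik, if_neg hgt.not_gt, if_neg hgt.ne', add_sub_cancel]
    have hpow : τ ^ ((3 - α) / r) ≤ C0 ^ ((3 - α) / r) * (M : ℝ) ^ (α - 3) := by
      refine (rpow_le_rpow hτ.le hτM hb0.le).trans_eq ?_
      rw [mul_rpow hC0.le (by positivity), ← rpow_mul hM0.le]
      congr 2
      field_simp
      ring
    have h1 := hCle (K * τ) s N hpos hs
    rw [show α - 1 - ((3 - α) / r - 1) = α - (3 - α) / r by ring] at h1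
    calc τ ^ ((3 - α) / r) * dyadicBarrier α ((3 - α) / r - 1) (K * τ) N s
        ≤ (C0 ^ ((3 - α) / r) * (M : ℝ) ^ (α - 3)) * (C * s ^ (α - (3 - α) / r)) :=
          mul_le_mul hpow h1 (dyadicBarrier_nonneg hpos hs.le N) (by positivity)
      _ = _ := by ring

theorem weaklySingular_of_contDiffOn {α T Cu : ℝ} (hα1 : α < 1) (hT : 0 < T) (hCu : 0 < Cu)
    {u : ℝ → ℝ} (hc : ContinuousOn u (Icc 0 T)) (hd : ContDiffOn ℝ 3 u (Ioc 0 T))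
    (h1 : ∀ s ∈ Ioc (0:ℝ) T, |deriv u s| ≤ Cu * (1 + s ^ (α - 1)))
    (h3 : ∀ s ∈ Ioc (0:ℝ) T, |deriv (deriv (deriv u)) s| ≤ Cu * (1 + s ^ (α - 3))) :
    WeaklySingular α (Cu * (1 + T ^ (1 - α) + T ^ (3 - α))) T u (deriv u) (deriv (deriv u))
      (deriv (deriv (deriv u))) := by
  have hopen : IsOpen (Ioo (0:ℝ) T) := isOpen_Ioo
  have hd0 : ContDiffOn ℝ (2 + 1) u (Ioo 0 T) := by
    have e : (2 + 1 : WithTop ℕ∞) = 3 := by norm_num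
    rw [e]
    exact hd.mono Ioo_subset_Ioc_self
  have hd1 : ContDiffOn ℝ (1 + 1) (deriv u) (Ioo 0 T) := by
    have e : (1 + 1 : WithTop ℕ∞) = 2 := by norm_num
    rw [e]
    exact ((contDiffOn_succ_iff_deriv_of_isOpen hopen).1 hd0).2.2
  have hd2 : ContDiffOn ℝ 1 (deriv (deriv u)) (Ioo 0 T) :=
    ((contDiffOn_succ_iff_deriv_of_isOpen hopen).1 hd1).2.2
  have hder : ∀ {f : ℝ → ℝ} {n : WithTop ℕ∞}, n ≠ 0 → ContDiffOn ℝ n f (Ioo 0 T) →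
      ∀ s ∈ Ioo 0 T, HasDerivAt f (deriv f s) s := fun hn hf s hs =>
    ((hf.differentiableOn hn).differentiableAt (hopen.mem_nhds hs)).hasDerivAt
  have hone : ∀ p : ℝ, 0 < p → ∀ s ∈ Ioo 0 T, (1:ℝ) ≤ T ^ p * s ^ (-p) := by
    intro p hp s hs
    rw [rpow_neg hs.1.le, ← div_eq_mul_inv, ← div_rpow hT.le hs.1.le]
    exact one_le_rpow ((one_le_div hs.1).2 hs.2.le) hp.le
  refine ⟨by positivity, hc, hder (by norm_num) hd0, hder (by norm_num) hd1,
    hder (by norm_num) hd2, fun s hs => ?_, fun s hs => ?_⟩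
  · refine (h1 s (Ioo_subset_Ioc_self hs)).trans ?_
    have h := hone (1 - α) (by linarith) s hs
    rw [neg_sub] at h
    have hp : 0 ≤ T ^ (3 - α) * s ^ (α - 1) := mul_nonneg (by positivity) (rpow_nonneg hs.1.le _)
    rw [mul_assoc]
    exact mul_le_mul_of_nonneg_left (by linarith) hCu.le
  · refine (h3 s (Ioo_subset_Ioc_self hs)).trans ?_
    have h := hone (3 - α) (by linarith) s hs
    rw [neg_sub] at h
    have hp : 0 ≤ T ^ (1 - α) * s ^ (α - 3) := mul_nonneg (by positivity) (rpow_nonneg hs.1.le _)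
    rw [mul_assoc]
    exact mul_le_mul_of_nonneg_left (by linarith) hCu.le

/-- The discrete solution reproduces the Caputo integral. -/
theorem alikSum_eq_integral {α : ℝ} (hα1 : α < 1) {t U : ℕ → ℝ} {u : ℝ → ℝ} {n : ℕ}
    (ht : ∀ i ≤ n, t i < t (i + 1))
    (hU : deltaAlik α t U (n + 1) = caputo α u (tStar α t (n + 1))) :
    alikSum α t U n =
      ∫ s in (0:ℝ)..(tStar α t (n + 1)), (tStar α t (n + 1) - s) ^ (-α) * deriv u s := by
  have hG : 1 / Real.Gamma (1 - α) ≠ 0 :=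
    one_div_ne_zero (Real.Gamma_pos_of_pos (by linarith)).ne'
  rw [deltaAlik_eq_sum hα1 ht U, caputo] at hU
  exact mul_left_cancel₀ hG hU

/-- Pointwise-in-time error bound for the Alikhanov discretization of the
initial-value problem `D_t^α u = f` (Theorem 4.4). -/
theorem stmt19 (α r T c0 C0 Cu : ℝ)
    (hα0 : 0 < α) (hα1 : α < 1) (hr1 : 1 ≤ r)
    (hT : 0 < T) (hc0 : 0 < c0) (hcC : c0 ≤ C0) (hCu : 0 < Cu) :
    ∃ C : ℝ, 0 < C ∧
      ∀ (M : ℕ) (t : ℕ → ℝ), IsMesh T M t → QuasiGraded r c0 C0 M t →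
        AlikhanovCond M t →
        ∀ u : ℝ → ℝ, ContinuousOn u (Set.Icc 0 T) → ContDiffOn ℝ 3 u (Set.Ioc 0 T) →
          (∀ s ∈ Set.Ioc (0:ℝ) T, |deriv u s| ≤ Cu * (1 + s ^ (α - 1))) →
          (∀ s ∈ Set.Ioc (0:ℝ) T,
            |deriv (deriv (deriv u)) s| ≤ Cu * (1 + s ^ (α - 3))) →
          ∀ U : ℕ → ℝ, U 0 = u (t 0) →
            (∀ m : ℕ, 1 ≤ m → m ≤ M →
              deltaAlik α t U m = caputo α u (tStar α t m)) →
            ∀ m : ℕ, 1 ≤ m → m ≤ M →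
              |u (t m) - U m| ≤ C * EcalAlik α r M (t 1) (t m) := by
  have hC0 : 0 < C0 := hc0.trans_le hcC
  obtain ⟨Λ, hΛ, hmesh⟩ := QuasiGraded.gradedMesh (T := T) hr1 hc0 hcC
  obtain ⟨γ, hγ1, hγα, hγr, hγE⟩ := exists_dyadicBarrier_le_EcalAlik hα0 hα1 hr1 hC0
  obtain ⟨K, C1, hK, hC1, hstab⟩ :=
    GradedMesh.exists_stability (r := r) (Λ := Λ) hα0 hα1 hr1 hΛ hγ1 hγα hγr
  obtain ⟨C2, hC2, hE⟩ := hγE K hK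
  obtain ⟨C3, hC3, htrunc⟩ := GradedMesh.exists_truncation_le (r := r) (Λ := Λ) (b := 1 + γ)
    hα0 hα1 hΛ (by linarith) (by linarith)
  obtain ⟨A, hA, hAe⟩ : ∃ A, 0 < A ∧ A = Cu * (1 + T ^ (1 - α) + T ^ (3 - α)) :=
    ⟨_, by positivity, rfl⟩
  refine ⟨C1 * (C3 * A) * C2, by positivity, ?_⟩
  intro M t hM hQ hAC u huc hud hu1 hu3 U hU0 hU m hm1 hmM
  have h := hmesh M t hM hQ
  have hu := weaklySingular_of_contDiffOn hα1 hT hCu huc hud hu1 hu3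
  rw [← hAe, ← hM.2.2.2] at hu
  have hres : ∀ n < M, |alikSum α t (fun i => u (t i) - U i) n| ≤
      C3 * A * (t 1 / t (n + 1)) ^ (1 + γ) := by
    intro n hn
    have h1 := htrunc M t h A _ _ _ _ hu n hn
    rw [← alikSum_eq_integral hα1 (fun i hi => h.lt_succ i (by omega))
      (hU (n + 1) (by omega) hn)] at h1
    have e : alikSum α t (fun i => u (t i) - U i) n =
        alikSum α t (fun i => u (t i)) n - alikSum α t U n := by
      rw [alikSum, alikSum, alikSum, ← Finset.sum_sub_distrib]
      exact Finset.sum_congr rfl fun i _ => by ring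
    rwa [e]
  obtain ⟨N, hN⟩ := hstab M t h hAC (fun i => u (t i) - U i) (C3 * A) (by rw [hU0, sub_self])
    (by positivity) hres
  have hMpos : 0 < M := by omega
  have h2 := hE M (t 1) (t m) N hMpos h.tau_pos (h.tau_le hm1 hmM) hQ.1.2
  calc |u (t m) - U m|
      ≤ C1 * (C3 * A * t 1 ^ (1 + γ)) * dyadicBarrier α γ (K * t 1) N (t m) := hN m hmM
    _ = C1 * (C3 * A) * (t 1 ^ (1 + γ) * dyadicBarrier α γ (K * t 1) N (t m)) := by ring
    _ ≤ C1 * (C3 * A) * (C2 * EcalAlik α r M (t 1) (t m)) :=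
        mul_le_mul_of_nonneg_left h2 (by positivity)
    _ = _ := by ring
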